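/- arXiv:1012.1234 — 7 statements merged into one kernel-verified Lean document; each statement's English description precedes it below -/
import Mathlib

section
/- Let p ≤ n be positive integers, let Λ₁,…,Λ_p be positive reals with Λ = diag(Λ₁,…,Λ_p), and let H be a complex Hermitian positive semidefinite n×n matrix. Then ∫ over all complex p×n matrices W of (π^p det Λ)^{-n} · exp(-tr(W† Λ⁻¹ W)) · exp(-i tr(W H W†)) dW = ∏_{j=1}^{p} det(1_n + i Λ_j H)^{-1}, where the determinant on the right-hand side is the complex determinant of the n×n matrix 1_n + i Λ_j H (which is invertible since H is positive semidefinite). -/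
open MeasureTheory Matrix
open scoped ComplexOrder

/-- Right multiplication by a unitary matrix preserves Lebesgue measure on `ℂⁿ`. -/
theorem Matrix.measurePreserving_vecMul_of_mem_unitary {ι : Type*} [Fintype ι] [DecidableEq ι]
    {U : Matrix ι ι ℂ} (hU : U ∈ unitary (Matrix ι ι ℂ)) :
    MeasurePreserving (fun w : ι → ℂ => w ᵥ* U) := by
  have hdet : LinearMap.det ((Matrix.toLin' Uᵀ).restrictScalars ℝ) = 1 := by
    have h : U.det ∈ unitary ℂ := Matrix.det_of_mem_unitary hU
    rw [LinearMap.det_restrictScalars, LinearMap.det_toLin', Matrix.det_transpose,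
      Algebra.norm_complex_apply, Complex.normSq_eq_norm_sq, CStarRing.norm_of_mem_unitary h,
      one_pow]
  have hfun : (fun w : ι → ℂ => w ᵥ* U) = (Matrix.toLin' Uᵀ).restrictScalars ℝ := by
    ext1 w
    simp [Matrix.mulVec_transpose]
  have hcont : Continuous fun w : ι → ℂ => w ᵥ* U := by fun_prop
  refine ⟨hcont.measurable, ?_⟩
  rw [hfun, Measure.map_linearMap_addHaar_eq_smul_addHaar _ (by rw [hdet]; exact one_ne_zero),
    hdet]
  simp

theorem Complex.integral_cexp_neg_mul_mul_star {b : ℂ} (hb : 0 < b.re) :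
    ∫ z : ℂ, Complex.exp (-(b * (z * star z))) = Real.pi / b := by
  have h := GaussianFourier.integral_cexp_neg_mul_sq_norm (V := ℂ) hb
  rw [Complex.finrank_real_complex] at h
  simpa [Complex.mul_conj'] using h

theorem Matrix.IsHermitian.det_one_add_smul {ι : Type*} [Fintype ι] [DecidableEq ι]
    {H : Matrix ι ι ℂ} (hH : H.IsHermitian) (c : ℂ) :
    (1 + c • H).det = ∏ k, (1 + c * hH.eigenvalues k) := by
  set U := (hH.eigenvectorUnitary : Matrix ι ι ℂ)
  have hUU : U * star U = 1 := Unitary.mul_star_self_of_mem hH.eigenvectorUnitary.2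
  have hspec : H = U * diagonal (fun k => (hH.eigenvalues k : ℂ)) * star U := by
    conv_lhs => rw [hH.spectral_theorem, Unitary.conjStarAlgAut_apply]
    rfl
  have key : 1 + c • H
      = U * diagonal (fun k => 1 + c * (hH.eigenvalues k : ℂ)) * star U := by
    have hd : diagonal (fun k => 1 + c * (hH.eigenvalues k : ℂ))
        = 1 + c • diagonal (fun k => (hH.eigenvalues k : ℂ)) := by
      rw [← diagonal_one, ← diagonal_smul, diagonal_add]
      rfl
    conv_lhs => rw [hspec]
    rw [hd, mul_add, add_mul, mul_one, hUU, mul_smul_comm, smul_mul_assoc]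
  have hdet : U.det * (star U).det = 1 := by rw [← det_mul, hUU, det_one]
  rw [key, det_mul, det_mul, det_diagonal, mul_right_comm, hdet, one_mul]

/-- The Gaussian integral over `ℂⁿ` with a positive scalar real part and a positive semidefinite
imaginary part. -/
theorem Matrix.PosSemidef.integral_cexp_neg_add_I_mul {ι : Type*} [Fintype ι] [DecidableEq ι]
    {H : Matrix ι ι ℂ} (hH : H.PosSemidef) {t : ℝ} (ht : 0 < t) :
    ∫ w : ι → ℂ, Complex.exp (-((t : ℂ)⁻¹ * (w ⬝ᵥ star w) + Complex.I * (w ᵥ* H ⬝ᵥ star w)))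
      = (Real.pi * t : ℂ) ^ Fintype.card ι * (1 + (Complex.I * t) • H).det⁻¹ := by
  have hHerm := hH.isHermitian
  set U := (hHerm.eigenvectorUnitary : Matrix ι ι ℂ)
  set d := hHerm.eigenvalues
  have hUmem : U ∈ unitary (Matrix ι ι ℂ) := hHerm.eigenvectorUnitary.2
  have hUU : star U * U = 1 := Unitary.star_mul_self_of_mem hUmem
  have hspec : H = U * diagonal (fun k => (d k : ℂ)) * star U := by
    conv_lhs => rw [hHerm.spectral_theorem, Unitary.conjStarAlgAut_apply]
    rfl
  have hmp := measurePreserving_vecMul_of_mem_unitary (Unitary.star_mem hUmem)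
  have hstar (v : ι → ℂ) : star (v ᵥ* star U) = U *ᵥ star v := by
    rw [star_vecMul, ← star_eq_conjTranspose, star_star]
  have hexp (v : ι → ℂ) :
      Complex.exp (-((t : ℂ)⁻¹ * ((v ᵥ* star U) ⬝ᵥ star (v ᵥ* star U))
        + Complex.I * ((v ᵥ* star U) ᵥ* H ⬝ᵥ star (v ᵥ* star U))))
      = ∏ k, Complex.exp (-(((t : ℂ)⁻¹ + Complex.I * d k) * (v k * star (v k)))) := by
    have h₁ : (v ᵥ* star U) ⬝ᵥ star (v ᵥ* star U) = v ⬝ᵥ star v := by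
      rw [hstar, dotProduct_mulVec, vecMul_vecMul, hUU, vecMul_one]
    have h₂ : (v ᵥ* star U) ᵥ* H ⬝ᵥ star (v ᵥ* star U)
        = v ᵥ* diagonal (fun k => (d k : ℂ)) ⬝ᵥ star v := by
      have h : star U * H * U = diagonal (fun k => (d k : ℂ)) := by
        rw [hspec]
        calc _ = (star U * U) * diagonal (fun k => (d k : ℂ)) * (star U * U) := by
              simp only [mul_assoc]
          _ = _ := by rw [hUU, one_mul, mul_one]
      rw [hstar, dotProduct_mulVec, vecMul_vecMul, vecMul_vecMul, ← mul_assoc, h]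
    rw [h₁, h₂, ← Complex.exp_sum]
    congr 1
    simp only [dotProduct, vecMul_diagonal, Pi.star_apply, Finset.mul_sum,
      ← Finset.sum_add_distrib, ← Finset.sum_neg_distrib]
    exact Finset.sum_congr rfl fun k _ => by ring
  have hre (k : ι) : 0 < ((t : ℂ)⁻¹ + Complex.I * d k).re := by
    simpa [← Complex.ofReal_inv] using ht
  rw [← hmp.map_eq, integral_map hmp.measurable.aemeasurable
    (by refine Continuous.aestronglyMeasurable ?_; fun_prop)]
  simp_rw [hexp]
  rw [integral_fintype_prod_volume_eq_prod
    fun k (z : ℂ) => Complex.exp (-(((t : ℂ)⁻¹ + Complex.I * d k) * (z * star z)))]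
  have ht' : (t : ℂ) ≠ 0 := Complex.ofReal_ne_zero.mpr ht.ne'
  rw [hHerm.det_one_add_smul, ← Finset.prod_inv_distrib, ← Finset.card_univ,
    ← Finset.prod_const, ← Finset.prod_mul_distrib]
  refine Finset.prod_congr rfl fun k _ => ?_
  rw [Complex.integral_cexp_neg_mul_mul_star (hre k)]
  have h : (t : ℂ)⁻¹ + Complex.I * d k = (t : ℂ)⁻¹ * (1 + Complex.I * t * d k) := by
    field_simp
  rw [h, div_eq_mul_inv, mul_inv, inv_inv, ← mul_assoc]

/-- Gaussian average of `exp(-i tr(W H Wᵀᶜ))` over the complex Wishart ensemble: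
for `Λ = diag(Λ₁,…,Λ_p)` with `Λ_j > 0` and `H` complex Hermitian positive semidefinite,
`∫ (π^p det Λ)^{-n} exp(-tr(W† Λ⁻¹ W)) exp(-i tr(W H W†)) dW
  = ∏_j det(1 + i Λ_j H)⁻¹`.
Complex `p × n` matrices are identified with the pi type `Fin p → Fin n → ℂ`
carrying Lebesgue measure. -/
theorem complex_wishart_gaussian_average
    (p n : ℕ) (hp : 0 < p) (hpn : p ≤ n)
    (Λ : Fin p → ℝ) (hΛ : ∀ j, 0 < Λ j)
    (H : Matrix (Fin n) (Fin n) ℂ) (hH : H.PosSemidef) :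
    (∫ W : Fin p → Fin n → ℂ,
        (((Real.pi ^ p * ∏ j, Λ j) ^ n)⁻¹ : ℂ) *
          Complex.exp (-((Matrix.of W)ᴴ *
              (Matrix.diagonal fun j => (Λ j : ℂ))⁻¹ * Matrix.of W).trace) *
          Complex.exp (-(Complex.I * (Matrix.of W * H * (Matrix.of W)ᴴ).trace)))
      = ∏ j, ((1 : Matrix (Fin n) (Fin n) ℂ) + (Complex.I * (Λ j : ℂ)) • H).det⁻¹ := by
  have hexp (W : Fin p → Fin n → ℂ) :
      (((Real.pi ^ p * ∏ j, Λ j) ^ n)⁻¹ : ℂ) *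
          Complex.exp (-((Matrix.of W)ᴴ *
              (Matrix.diagonal fun j => (Λ j : ℂ))⁻¹ * Matrix.of W).trace) *
          Complex.exp (-(Complex.I * (Matrix.of W * H * (Matrix.of W)ᴴ).trace))
      = (((Real.pi ^ p * ∏ j, Λ j) ^ n)⁻¹ : ℂ) * ∏ j, Complex.exp
          (-((Λ j : ℂ)⁻¹ * (W j ⬝ᵥ star (W j)) + Complex.I * (W j ᵥ* H ⬝ᵥ star (W j)))) := by
    have hinv : (Matrix.diagonal fun j => (Λ j : ℂ))⁻¹
        = Matrix.diagonal fun j => (Λ j : ℂ)⁻¹ := by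
      refine Matrix.inv_eq_right_inv ?_
      rw [diagonal_mul_diagonal, ← diagonal_one]
      congr 1
      ext j
      exact mul_inv_cancel₀ (Complex.ofReal_ne_zero.mpr (hΛ j).ne')
    have h₁ : ((Matrix.of W)ᴴ * (Matrix.diagonal fun j => (Λ j : ℂ))⁻¹ * Matrix.of W).trace
        = ∑ j, (Λ j : ℂ)⁻¹ * (W j ⬝ᵥ star (W j)) := by
      rw [hinv, Matrix.mul_assoc, trace_mul_comm, Matrix.mul_assoc]
      simp only [trace, diag_apply, diagonal_mul]
      rfl
    have h₂ : (Matrix.of W * H * (Matrix.of W)ᴴ).trace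
        = ∑ j, (W j ᵥ* H ⬝ᵥ star (W j)) := rfl
    rw [mul_assoc, ← Complex.exp_add, ← Complex.exp_sum, h₁, h₂, Finset.mul_sum,
      Finset.sum_neg_distrib, Finset.sum_add_distrib, neg_add]
  simp_rw [hexp]
  rw [integral_const_mul, integral_fintype_prod_volume_eq_prod fun j (w : Fin n → ℂ) =>
    Complex.exp (-((Λ j : ℂ)⁻¹ * (w ⬝ᵥ star w) + Complex.I * (w ᵥ* H ⬝ᵥ star w)))]
  simp_rw [fun j => hH.integral_cexp_neg_add_I_mul (hΛ j), Fintype.card_fin]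
  rw [Finset.prod_mul_distrib, Finset.prod_pow, Finset.prod_mul_distrib, Finset.prod_const,
    Finset.card_univ, Fintype.card_fin, Complex.ofReal_prod,
    ← mul_assoc, inv_mul_cancel₀, one_mul]
  have hprod : ∏ j, (Λ j : ℂ) ≠ 0 :=
    Finset.prod_ne_zero_iff.mpr fun j _ => Complex.ofReal_ne_zero.mpr (hΛ j).ne'
  exact pow_ne_zero _
    (mul_ne_zero (pow_ne_zero _ (Complex.ofReal_ne_zero.mpr Real.pi_ne_zero)) hprod)
end

section
/- Let n ≥ 1 be an integer, let 0 < r < q be reals, and let f be a complex-analytic function on an open set containing the closed disc {s ∈ ℂ : |s| ≤ q}, with Taylor expansion f(s) = Σ_{k≥0} a_k s^k at s = 0. Then (1/(2πi)) ∮_{|s|=q} f(s)/(sⁿ (r−s)) ds = −r^{−n} · ( f(r) − Σ_{k=0}^{n−1} a_k r^k ). -/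
open MeasureTheory

/-- For `n ≥ 1`, `0 < r < q`, and `f` complex-analytic on an open set containing the
closed disc of radius `q`, with Taylor coefficients `a_k = f⁽ᵏ⁾(0)/k!` at `0`:
`(1/(2πi)) ∮_{|s|=q} f(s)/(sⁿ(r−s)) ds = −r^{−n}·(f(r) − Σ_{k<n} a_k r^k)`. -/
theorem circleIntegral_taylor_tail
    (n : ℕ) (hn : 1 ≤ n) (r q : ℝ) (hr : 0 < r) (hrq : r < q)
    (f : ℂ → ℂ) (U : Set ℂ) (hU : IsOpen U) (hUq : Metric.closedBall (0 : ℂ) q ⊆ U)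
    (hf : DifferentiableOn ℂ f U)
    (a : ℕ → ℂ) (ha : ∀ k, a k = iteratedDeriv k f 0 / (Nat.factorial k)) :
    (2 * Real.pi * Complex.I)⁻¹ *
        (∮ s in C(0, q), f s / (s ^ n * ((r : ℂ) - s)))
      = -((r : ℂ) ^ n)⁻¹ * (f r - ∑ k ∈ Finset.range n, a k * (r : ℂ) ^ k) := by
  have hq : 0 < q := hr.trans hrq
  have hr0 : (r : ℂ) ≠ 0 := by exact_mod_cast hr.ne'
  have hd : DifferentiableOn ℂ f (Metric.closedBall 0 q) := hf.mono hUq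
  have hs0 : ∀ s ∈ Metric.sphere (0 : ℂ) q, s ≠ 0 := fun s hs =>
    ne_zero_of_mem_sphere hq.ne' ⟨s, hs⟩
  have hsr : ∀ s ∈ Metric.sphere (0 : ℂ) q, (r : ℂ) - s ≠ 0 := by
    intro s hs h
    rw [mem_sphere_zero_iff_norm, ← sub_eq_zero.mp h, Complex.norm_real,
      Real.norm_of_nonneg hr.le] at hs
    exact hrq.ne hs
  have hfc : ContinuousOn f (Metric.sphere 0 q) :=
    hd.continuousOn.mono Metric.sphere_subset_closedBall
  have hcoeff (k : ℕ) :
      (2 * Real.pi * Complex.I)⁻¹ * (∮ s in C(0, q), f s / s ^ (k + 1)) = a k := by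
    have h := hd.circleIntegral_one_div_sub_center_pow_smul hq k
    simp only [sub_zero, smul_eq_mul, one_div_mul_eq_div] at h
    rw [h, ha]
    field_simp
  clear hn
  induction n with
  | zero =>
    have hmem : (r : ℂ) ∈ Metric.ball (0 : ℂ) q := by
      simpa [abs_of_pos hr] using hrq
    have h := hd.circleIntegral_sub_inv_smul hmem
    have hneg : (∮ s in C(0, q), f s / (s ^ 0 * ((r : ℂ) - s)))
        = ∮ s in C(0, q), (-1 : ℂ) * ((s - r)⁻¹ • f s) := by
      congr 1
      funext s
      rw [← neg_sub (s : ℂ) r, pow_zero, one_mul, div_neg, smul_eq_mul]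
      ring
    rw [hneg, circleIntegral.integral_const_mul, h]
    simp only [smul_eq_mul, pow_zero, Finset.range_zero, Finset.sum_empty]
    field_simp
    ring
  | succ n ih =>
    have hsplit : (∮ s in C(0, q), f s / (s ^ (n + 1) * ((r : ℂ) - s)))
        = (r : ℂ)⁻¹ * ((∮ s in C(0, q), f s / (s ^ n * ((r : ℂ) - s)))
          + ∮ s in C(0, q), f s / s ^ (n + 1)) := by
      rw [← circleIntegral.integral_add, ← circleIntegral.integral_const_mul]
      · refine circleIntegral.integral_congr hq.le fun s hs => ?_
        have h0 := hs0 s hs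
        have h1 := hsr s hs
        field_simp
        ring
      · exact (hfc.div (by fun_prop) fun s hs =>
          mul_ne_zero (pow_ne_zero _ (hs0 s hs)) (hsr s hs)).circleIntegrable hq.le
      · exact (hfc.div (by fun_prop) fun s hs =>
          pow_ne_zero _ (hs0 s hs)).circleIntegrable hq.le
    rw [hsplit, mul_left_comm, mul_add, ih, hcoeff, Finset.sum_range_succ]
    field_simp
    ring
end

section
/- Let n ≥ 1 be an integer, let 0 < q < r be reals, and let f be a complex-analytic function on an open set containing the closed disc {s ∈ ℂ : |s| ≤ q}, with Taylor coefficients a_k = f^{(k)}(0)/k!. Then (1/(2πi)) ∮_{|s|=q} f(s)/(sⁿ (r−s)) ds = r^{−n} · Σ_{k=0}^{n−1} a_k r^k. -/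
open MeasureTheory

/-- The circle integral of `f(s) / (s ^ n * (w - s))` around the origin, for `w` outside the disc. -/
lemma circleIntegral_div_pow_mul_sub {f : ℂ → ℂ} {q : ℝ} (hq : 0 < q)
    (hf : DiffContOnCl ℂ f (Metric.ball 0 q)) {w : ℂ} (hw : q < ‖w‖) (n : ℕ) :
    (∮ s in C(0, q), f s / (s ^ n * (w - s))) =
      2 * Real.pi * Complex.I * ((w ^ n)⁻¹ *
        ∑ k ∈ Finset.range n, iteratedDeriv k f 0 / (Nat.factorial k) * w ^ k) := by
  have hw0 : w ≠ 0 := norm_pos_iff.mp (hq.trans hw)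
  have hsub : ∀ s ∈ Metric.closedBall (0 : ℂ) q, w - s ≠ 0 := by
    rintro s hs h
    rw [mem_closedBall_zero_iff, ← sub_eq_zero.mp h] at hs
    exact hs.not_gt hw
  have hs0 : ∀ s ∈ Metric.sphere (0 : ℂ) q, s ≠ 0 := fun s hs =>
    ne_zero_of_mem_sphere hq.ne' ⟨s, hs⟩
  have hcont : ContinuousOn f (Metric.sphere 0 q) :=
    hf.continuousOn_ball.mono Metric.sphere_subset_closedBall
  induction n with
  | zero =>
    have hd : DiffContOnCl ℂ (fun s => (w - s)⁻¹) (Metric.ball 0 q) :=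
      (diffContOnCl_const.sub differentiable_id.diffContOnCl).inv fun s hs =>
        hsub s (Metric.closure_ball_subset_closedBall hs)
    simpa [div_eq_inv_mul] using (hd.smul hf).circleIntegral_eq_zero hq.le
  | succ n ih =>
    have hpow : CircleIntegrable (fun s => (1 / (s - 0) ^ (n + 1)) • f s) 0 q := by
      refine ContinuousOn.circleIntegrable hq.le (ContinuousOn.fun_smul ?_ hcont)
      refine continuousOn_const.div (by fun_prop) fun s hs => ?_
      simpa using hs0 s hs
    have hprev : CircleIntegrable (fun s => f s / (s ^ n * (w - s))) 0 q := by
      refine ContinuousOn.circleIntegrable hq.le (hcont.div (by fun_prop) fun s hs => ?_)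
      exact mul_ne_zero (pow_ne_zero _ (hs0 s hs)) (hsub s (Metric.sphere_subset_closedBall hs))
    have hsplit : (∮ s in C(0, q), f s / (s ^ (n + 1) * (w - s))) =
        ∮ s in C(0, q), w⁻¹ * ((1 / (s - 0) ^ (n + 1)) • f s + f s / (s ^ n * (w - s))) := by
      refine circleIntegral.integral_congr hq.le fun s hs => ?_
      have h1 := hs0 s hs
      have h2 := hsub s (Metric.sphere_subset_closedBall hs)
      simp only [sub_zero, smul_eq_mul]
      field_simp
      ring
    rw [hsplit, circleIntegral.integral_const_mul, circleIntegral.integral_add hpow hprev, ih,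
      hf.circleIntegral_one_div_sub_center_pow_smul hq n, Finset.sum_range_succ, smul_eq_mul]
    field_simp
    ring

/-- For `n ≥ 1`, `0 < q < r`, and `f` complex-analytic on an open set containing the
closed disc of radius `q`, with Taylor coefficients `a_k = f⁽ᵏ⁾(0)/k!` at `0`:
`(1/(2πi)) ∮_{|s|=q} f(s)/(sⁿ(r−s)) ds = r^{−n}·Σ_{k<n} a_k r^k`. -/
theorem circleIntegral_taylor_partial_sum
    (n : ℕ) (hn : 1 ≤ n) (r q : ℝ) (hq : 0 < q) (hqr : q < r)
    (f : ℂ → ℂ) (U : Set ℂ) (hU : IsOpen U) (hUq : Metric.closedBall (0 : ℂ) q ⊆ U)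
    (hf : DifferentiableOn ℂ f U)
    (a : ℕ → ℂ) (ha : ∀ k, a k = iteratedDeriv k f 0 / (Nat.factorial k)) :
    (2 * Real.pi * Complex.I)⁻¹ *
        (∮ s in C(0, q), f s / (s ^ n * ((r : ℂ) - s)))
      = ((r : ℂ) ^ n)⁻¹ * ∑ k ∈ Finset.range n, a k * (r : ℂ) ^ k := by
  have hd : DiffContOnCl ℂ f (Metric.ball 0 q) :=
    (hf.mono (Metric.closure_ball_subset_closedBall.trans hUq)).diffContOnCl
  have hr : q < ‖(r : ℂ)‖ := by
    rw [Complex.norm_real]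
    exact hqr.trans_le (Real.le_norm_self r)
  rw [circleIntegral_div_pow_mul_sub hq hd hr, inv_mul_cancel_left₀ Complex.two_pi_I_ne_zero]
  simp only [ha]
end

section
/- Let 1 ≤ p ≤ n be integers and let Λ₁,…,Λ_p be positive reals. Then for every x ∈ ℂ and every j ∈ {1,…,p}: g_Λ^{[<n]}(x; i/Λ_j) = Λ_j^{1−n} · Σ_{k=1}^{p} x^{n−k} E_{k−1}(−Λ^ĵ)/(n−k)!. Equivalently, since g_Λ(x; i/Λ_j) = 0, the Taylor tail satisfies g_Λ^{[≥n]}(x; i/Λ_j) = −Λ_j^{1−n} Σ_{k=1}^{p} x^{n−k} E_{k−1}(−Λ^ĵ)/(n−k)!. -/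
open MeasureTheory

/-- `g_Λ(x;s) = e^{−ixs} ∏_j (1 + i s Λ_j)`, an entire function of `s`. -/
noncomputable def gFun {p : ℕ} (Λ : Fin p → ℝ) (x s : ℂ) : ℂ :=
  Complex.exp (-(Complex.I * x * s)) * ∏ j, (1 + Complex.I * s * (Λ j : ℂ))

/-- Taylor coefficient `c_k(x) = (∂ₛᵏ g_Λ)(x;0)/k!` of `g_Λ(x;·)` at `s = 0`. -/
noncomputable def gCoeff {p : ℕ} (Λ : Fin p → ℝ) (x : ℂ) (k : ℕ) : ℂ :=
  iteratedDeriv k (gFun Λ x) 0 / (Nat.factorial k)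

/-- Truncated Taylor series `g_Λ^{[<m]}(x;s) = Σ_{k<m} c_k(x) s^k`. -/
noncomputable def gLower {p : ℕ} (Λ : Fin p → ℝ) (m : ℕ) (x s : ℂ) : ℂ :=
  ∑ k ∈ Finset.range m, gCoeff Λ x k * s ^ k

/-- Taylor tail `g_Λ^{[≥m]}(x;s) = g_Λ(x;s) − g_Λ^{[<m]}(x;s)`. -/
noncomputable def gUpper {p : ℕ} (Λ : Fin p → ℝ) (m : ℕ) (x s : ℂ) : ℂ :=
  gFun Λ x s - gLower Λ m x s

/-- The `k`-th elementary symmetric function of `(v i)_{i ∈ s}`. -/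
noncomputable def esymm {p : ℕ} (s : Finset (Fin p)) (v : Fin p → ℂ) (k : ℕ) : ℂ :=
  ∑ t ∈ s.powersetCard k, ∏ i ∈ t, v i

/-- The formal Taylor series of `f` at `0`. -/
noncomputable def taylorSeriesZero (f : ℂ → ℂ) : PowerSeries ℂ :=
  PowerSeries.mk fun k => iteratedDeriv k f 0 / (Nat.factorial k)

theorem taylorSeriesZero_mul {f g : ℂ → ℂ} (hf : ContDiff ℂ ⊤ f) (hg : ContDiff ℂ ⊤ g) :
    taylorSeriesZero (fun s => f s * g s) = taylorSeriesZero f * taylorSeriesZero g := by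
  ext k
  rw [PowerSeries.coeff_mul, Finset.Nat.sum_antidiagonal_eq_sum_range_succ_mk]
  simp only [taylorSeriesZero, PowerSeries.coeff_mk]
  rw [iteratedDeriv_fun_mul (hf.contDiffAt.of_le le_top) (hg.contDiffAt.of_le le_top),
    Finset.sum_div]
  refine Finset.sum_congr rfl fun i hi => ?_
  rw [Nat.cast_choose ℂ (Finset.mem_range_succ_iff.mp hi)]
  have hk : (Nat.factorial k : ℂ) ≠ 0 := by exact_mod_cast k.factorial_ne_zero
  field_simp

theorem taylorSeriesZero_one_add_mul (a : ℂ) :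
    taylorSeriesZero (fun s => 1 + Complex.I * s * a) =
      1 + PowerSeries.C (Complex.I * a) * PowerSeries.X := by
  ext k
  have hd : deriv (fun s : ℂ => 1 + Complex.I * s * a) = fun _ => Complex.I * a := by
    funext s
    simp
  rcases k with _ | _ | k
  · simp [taylorSeriesZero]
  · simp [taylorSeriesZero, hd, PowerSeries.coeff_one]
  · simp [taylorSeriesZero, iteratedDeriv_succ', hd, PowerSeries.coeff_one]

theorem taylorSeriesZero_prod_one_add_mul {ι : Type*} (S : Finset ι) (a : ι → ℂ) :
    taylorSeriesZero (fun s => ∏ i ∈ S, (1 + Complex.I * s * a i)) =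
      ∏ i ∈ S, (1 + PowerSeries.C (Complex.I * a i) * PowerSeries.X) := by
  classical
  induction S using Finset.induction_on with
  | empty =>
    ext k
    simp only [Finset.prod_empty, taylorSeriesZero, PowerSeries.coeff_mk, iteratedDeriv_const,
      PowerSeries.coeff_one]
    split_ifs with h <;> simp [h]
  | insert i S hi ih =>
    simp only [Finset.prod_insert hi]
    rw [taylorSeriesZero_mul (by fun_prop) (by fun_prop), ih, taylorSeriesZero_one_add_mul]

theorem coeff_taylorSeriesZero_exp (x : ℂ) (k : ℕ) :
    PowerSeries.coeff k (taylorSeriesZero fun s => Complex.exp (-(Complex.I * x * s))) =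
      (-Complex.I * x) ^ k / (Nat.factorial k) := by
  have h := congrFun (iteratedDeriv_cexp_const_mul k (-Complex.I * x)) 0
  simp only [neg_mul] at h
  simp [taylorSeriesZero, h]

theorem coeff_prod_one_add_C_mul_X {p : ℕ} (S : Finset (Fin p)) (a : Fin p → ℂ) (m : ℕ) :
    PowerSeries.coeff m
        (∏ i ∈ S, (1 + PowerSeries.C (Complex.I * a i) * PowerSeries.X)) =
      (-Complex.I) ^ m * esymm S (fun i => -a i) m := by
  classical
  simp only [Finset.prod_one_add, Finset.prod_mul_distrib, Finset.prod_const, ← map_prod,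
    map_sum, PowerSeries.coeff_C_mul_X_pow, esymm, Finset.mul_sum]
  rw [← Finset.sum_filter, Finset.powersetCard_eq_filter]
  refine Finset.sum_congr (by simp only [eq_comm]) fun t ht => ?_
  rw [← (Finset.mem_filter.mp ht).2, ← Finset.prod_const (-Complex.I),
    ← Finset.prod_const Complex.I, ← Finset.prod_mul_distrib, ← Finset.prod_mul_distrib]
  simp

theorem esymm_eq_zero_of_card_lt {p : ℕ} {S : Finset (Fin p)} (v : Fin p → ℂ) {k : ℕ}
    (h : S.card < k) : esymm S v k = 0 := by
  simp [esymm, Finset.powersetCard_eq_empty.mpr h]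

theorem sum_range_coeff_mul_one_add_C_mul_X (P : PowerSeries ℂ) {b s : ℂ} (hbs : b * s = -1)
    (n : ℕ) :
    ∑ k ∈ Finset.range (n + 1),
        PowerSeries.coeff k (P * (1 + PowerSeries.C b * PowerSeries.X)) * s ^ k =
      PowerSeries.coeff n P * s ^ n := by
  have hP : P * (1 + PowerSeries.C b * PowerSeries.X) =
      P + PowerSeries.C b * (P * PowerSeries.X) := by ring
  rw [hP]
  induction n with
  | zero => simp
  | succ n ih =>
    rw [Finset.sum_range_succ, ih, map_add, PowerSeries.coeff_C_mul,
      PowerSeries.coeff_succ_mul_X]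
    linear_combination PowerSeries.coeff n P * s ^ n * hbs

theorem gCoeff_eq_coeff {p : ℕ} (Λ : Fin p → ℝ) (x : ℂ) (k : ℕ) :
    gCoeff Λ x k = PowerSeries.coeff k
      ((taylorSeriesZero fun s => Complex.exp (-(Complex.I * x * s))) *
        ∏ i, (1 + PowerSeries.C (Complex.I * (Λ i : ℂ)) * PowerSeries.X)) := by
  rw [← taylorSeriesZero_prod_one_add_mul,
    ← taylorSeriesZero_mul (by fun_prop) (by fun_prop)]
  simp only [taylorSeriesZero, PowerSeries.coeff_mk]
  rfl

theorem gFun_inverse_eigenvalue {p : ℕ} (Λ : Fin p → ℝ) (x : ℂ) {j : Fin p} (hj : Λ j ≠ 0) :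
    gFun Λ x (Complex.I / (Λ j : ℂ)) = 0 := by
  have hj' : (Λ j : ℂ) ≠ 0 := by exact_mod_cast hj
  refine mul_eq_zero_of_right _ (Finset.prod_eq_zero (Finset.mem_univ j) ?_)
  field_simp
  simp

theorem gLower_succ_inverse_eigenvalue {p : ℕ} (Λ : Fin p → ℝ) (x : ℂ) {j : Fin p}
    (hj : Λ j ≠ 0) (n : ℕ) :
    gLower Λ (n + 1) x (Complex.I / (Λ j : ℂ)) =
      ((Λ j : ℂ) ^ n)⁻¹ * ∑ m ∈ Finset.range (n + 1), x ^ (n - m) *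
        esymm (Finset.univ.erase j) (fun l => -(Λ l : ℂ)) m / (Nat.factorial (n - m)) := by
  have hj' : (Λ j : ℂ) ≠ 0 := by exact_mod_cast hj
  have hs : Complex.I * (Λ j : ℂ) * (Complex.I / (Λ j : ℂ)) = -1 := by
    field_simp
    simp
  simp only [gLower, gCoeff_eq_coeff]
  rw [← Finset.prod_erase_mul _ _ (Finset.mem_univ j), ← mul_assoc,
    sum_range_coeff_mul_one_add_C_mul_X _ hs, mul_comm (taylorSeriesZero _),
    PowerSeries.coeff_mul, Finset.Nat.sum_antidiagonal_eq_sum_range_succ_mk, Finset.sum_mul,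
    Finset.mul_sum]
  refine Finset.sum_congr rfl fun m hm => ?_
  have hI : (-Complex.I) ^ m * (-Complex.I) ^ (n - m) * Complex.I ^ n = 1 := by
    rw [← pow_add, Nat.add_sub_cancel' (Finset.mem_range_succ_iff.mp hm), ← mul_pow]
    simp
  rw [coeff_prod_one_add_C_mul_X, coeff_taylorSeriesZero_exp, mul_pow, div_pow]
  linear_combination (x ^ (n - m) * esymm (Finset.univ.erase j) (fun l => -(Λ l : ℂ)) m /
    (Nat.factorial (n - m)) / (Λ j : ℂ) ^ n) * hI

/-- For `1 ≤ p ≤ n` and positive `Λ₁,…,Λ_p`, for every `x ∈ ℂ` and every `j`: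
`g_Λ^{[<n]}(x; i/Λ_j) = Λ_j^{1−n} Σ_{k=1}^p x^{n−k} E_{k−1}(−Λ^ĵ)/(n−k)!`; equivalently,
since `g_Λ(x; i/Λ_j) = 0`, the Taylor tail satisfies
`g_Λ^{[≥n]}(x; i/Λ_j) = −Λ_j^{1−n} Σ_{k=1}^p x^{n−k} E_{k−1}(−Λ^ĵ)/(n−k)!`. -/
theorem gLower_at_inverse_eigenvalue
    (p n : ℕ) (hp : 1 ≤ p) (hpn : p ≤ n)
    (Λ : Fin p → ℝ) (hΛ : ∀ j, 0 < Λ j) (x : ℂ) (j : Fin p) :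
    gLower Λ n x (Complex.I / (Λ j : ℂ))
        = (Λ j : ℂ) ^ ((1 : ℤ) - n) *
            ∑ k ∈ Finset.Icc 1 p, x ^ (n - k) *
              esymm (Finset.univ.erase j) (fun l => -(Λ l : ℂ)) (k - 1) /
                (Nat.factorial (n - k)) ∧
    gUpper Λ n x (Complex.I / (Λ j : ℂ))
        = -((Λ j : ℂ) ^ ((1 : ℤ) - n) *
            ∑ k ∈ Finset.Icc 1 p, x ^ (n - k) *
              esymm (Finset.univ.erase j) (fun l => -(Λ l : ℂ)) (k - 1) /
                (Nat.factorial (n - k))) := by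
  have hlow : gLower Λ n x (Complex.I / (Λ j : ℂ))
      = (Λ j : ℂ) ^ ((1 : ℤ) - n) *
          ∑ k ∈ Finset.Icc 1 p, x ^ (n - k) *
            esymm (Finset.univ.erase j) (fun l => -(Λ l : ℂ)) (k - 1) /
              (Nat.factorial (n - k)) := by
    obtain ⟨n, rfl⟩ := Nat.exists_eq_add_of_le' (hp.trans hpn)
    rw [gLower_succ_inverse_eigenvalue Λ x (hΛ j).ne']
    congr 1
    · rw [← zpow_natCast, ← zpow_neg]
      congr 1
      push_cast
      ring
    · rw [← Finset.sum_subset (Finset.range_mono hpn), ← Finset.Ico_succ_right_eq_Icc,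
        Finset.sum_Ico_eq_sum_range]
      · refine Finset.sum_congr rfl fun m _ => ?_
        rw [Nat.add_sub_cancel_left, add_comm 1 m, Nat.add_sub_add_right]
      · intro m _ hm
        rw [esymm_eq_zero_of_card_lt]
        · simp
        · rw [Finset.card_erase_of_mem (Finset.mem_univ j), Finset.card_fin]
          rw [Finset.mem_range] at hm
          omega
  refine ⟨hlow, ?_⟩
  rw [gUpper, gFun_inverse_eigenvalue Λ x (hΛ j).ne', hlow, zero_sub]
end

section
/- Let 1 ≤ p ≤ n be integers and let Λ₁,…,Λ_p be pairwise distinct positive reals. Let R > max_j (1/Λ_j). Then for every x ∈ ℂ: (1/(2π)) ∮_{|r|=R} g_Λ^{[<n]}(x;r)/g_Λ(x;r) dr = Σ_{j=1}^{p} [ e^{−x/Λ_j} Λ_j^{−n} / ∏_{l≠j} (1 − Λ_l/Λ_j) ] · Σ_{k=1}^{p} x^{n−k} E_{k−1}(−Λ^ĵ)/(n−k)!. (The only zeros of r ↦ g_Λ(x;r) are the simple zeros r = i/Λ_j, all lying inside the circle |r| = R.) -/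
open MeasureTheory

/-- The Taylor series at `0` of a function, as a formal power series. -/
noncomputable def taylorPowerSeries (f : ℂ → ℂ) : PowerSeries ℂ :=
  PowerSeries.mk fun k => iteratedDeriv k f 0 / (Nat.factorial k)

lemma taylorPowerSeries_mul {f g : ℂ → ℂ} (hf : ContDiff ℂ ⊤ f) (hg : ContDiff ℂ ⊤ g) :
    taylorPowerSeries (fun s => f s * g s) = taylorPowerSeries f * taylorPowerSeries g := by
  ext k
  rw [PowerSeries.coeff_mul, taylorPowerSeries, PowerSeries.coeff_mk,
    show (fun s => f s * g s) = f * g from rfl,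
    iteratedDeriv_mul (hf.contDiffAt.of_le le_top) (hg.contDiffAt.of_le le_top),
    Finset.Nat.sum_antidiagonal_eq_sum_range_succ
      (fun i j => (PowerSeries.coeff i) (taylorPowerSeries f) *
        (PowerSeries.coeff j) (taylorPowerSeries g)), Finset.sum_div]
  refine Finset.sum_congr rfl fun i hi => ?_
  have hik : i ≤ k := Nat.lt_succ_iff.mp (Finset.mem_range.mp hi)
  simp only [taylorPowerSeries, PowerSeries.coeff_mk]
  rw [Nat.cast_choose ℂ hik]
  have h1 : (Nat.factorial k : ℂ) ≠ 0 := Nat.cast_ne_zero.mpr k.factorial_ne_zero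
  field_simp

lemma coeff_taylorPowerSeries_exp (c : ℂ) (k : ℕ) :
    (taylorPowerSeries fun s => Complex.exp (c * s)).coeff k = c ^ k / (Nat.factorial k) := by
  simp [taylorPowerSeries, iteratedDeriv_cexp_const_mul]

lemma taylorPowerSeries_one : taylorPowerSeries (fun _ => 1) = 1 := by
  ext k
  rcases k with _ | k
  · simp [taylorPowerSeries]
  · simp [taylorPowerSeries, iteratedDeriv_const, PowerSeries.coeff_one]

lemma taylorPowerSeries_one_add_mul (a : ℂ) :
    taylorPowerSeries (fun s => 1 + a * s) = 1 + PowerSeries.C a * PowerSeries.X := by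
  have hd : deriv (fun s : ℂ => 1 + a * s) = fun _ => a := by
    ext s
    simp
  ext k
  rcases k with _ | _ | k
  · simp [taylorPowerSeries]
  · simp [taylorPowerSeries, hd]
  · rw [taylorPowerSeries, PowerSeries.coeff_mk, iteratedDeriv_succ', hd]
    simp [iteratedDeriv_const, PowerSeries.coeff_one]

lemma taylorPowerSeries_prod {ι : Type*} (s : Finset ι) {f : ι → ℂ → ℂ}
    (hf : ∀ i, ContDiff ℂ ⊤ (f i)) :
    taylorPowerSeries (fun z => ∏ i ∈ s, f i z) = ∏ i ∈ s, taylorPowerSeries (f i) := by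
  classical
  induction s using Finset.induction_on with
  | empty => simpa using taylorPowerSeries_one
  | insert i s hi ih =>
    simp only [Finset.prod_insert hi]
    rw [taylorPowerSeries_mul (hf i) (contDiff_prod fun j _ => hf j), ih]

/-- The formal power series `e^{cX} ∏_{i ∈ s} (1 + a_i X)`. -/
noncomputable def expProdSeries {ι : Type*} (s : Finset ι) (a : ι → ℂ) (c : ℂ) : PowerSeries ℂ :=
  (taylorPowerSeries fun z => Complex.exp (c * z)) *
    ∏ i ∈ s, (1 + PowerSeries.C (a i) * PowerSeries.X)

lemma gCoeff_eq_coeff_s7 {p : ℕ} (Λ : Fin p → ℝ) (x : ℂ) (k : ℕ) :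
    gCoeff Λ x k =
      (expProdSeries Finset.univ (fun j => Complex.I * (Λ j : ℂ)) (-(Complex.I * x))).coeff k := by
  have h : gFun Λ x = fun s => Complex.exp (-(Complex.I * x) * s) *
      ∏ j, (1 + Complex.I * (Λ j : ℂ) * s) := by
    ext s
    simp only [gFun, neg_mul, mul_right_comm]
  have hj : ∀ j : Fin p, ContDiff ℂ ⊤ fun s : ℂ => 1 + Complex.I * (Λ j : ℂ) * s :=
    fun j => by fun_prop
  rw [expProdSeries, ← Finset.prod_congr rfl fun j _ =>
      taylorPowerSeries_one_add_mul (Complex.I * (Λ j : ℂ)),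
    ← taylorPowerSeries_prod _ hj,
    ← taylorPowerSeries_mul (by fun_prop) (contDiff_prod fun j _ => hj j), ← h]
  simp [taylorPowerSeries, gCoeff]

lemma coeff_expProdSeries {ι : Type*} (s : Finset ι) (a : ι → ℂ) (c : ℂ) (m : ℕ)
    (hm : s.card ≤ m) :
    (expProdSeries s a c).coeff m = ∑ k ∈ Finset.range (s.card + 1),
      ∑ t ∈ s.powersetCard k, (∏ i ∈ t, a i) * (c ^ (m - k) / (Nat.factorial (m - k))) := by
  classical
  rw [expProdSeries, Finset.prod_one_add, Finset.sum_powerset, Finset.mul_sum, map_sum]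
  refine Finset.sum_congr rfl fun k hk => ?_
  rw [Finset.mul_sum, map_sum]
  refine Finset.sum_congr rfl fun t ht => ?_
  have hkm : k ≤ m := (Nat.lt_succ_iff.mp (Finset.mem_range.mp hk)).trans hm
  rw [Finset.prod_mul_distrib, Finset.prod_const, (Finset.mem_powersetCard.mp ht).2,
    ← map_prod, mul_left_comm, PowerSeries.coeff_C_mul, PowerSeries.coeff_mul_X_pow',
    if_pos hkm, coeff_taylorPowerSeries_exp]

/-- Truncating `(1 + aX) H` and evaluating at the root of `1 + aX` leaves only the top
coefficient of `H`. -/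
lemma sum_range_coeff_one_add_mul (H : PowerSeries ℂ) {a r : ℂ} (hr : 1 + a * r = 0) (n : ℕ) :
    ∑ k ∈ Finset.range (n + 1), ((1 + PowerSeries.C a * PowerSeries.X) * H).coeff k * r ^ k
      = H.coeff n * r ^ n := by
  induction n with
  | zero => simp
  | succ n ih =>
    rw [Finset.sum_range_succ, ih, add_mul, one_mul, mul_assoc, map_add, PowerSeries.coeff_C_mul,
      PowerSeries.coeff_succ_X_mul]
    linear_combination H.coeff n * r ^ n * hr

lemma esymm_const_mul {p : ℕ} (s : Finset (Fin p)) (a : ℂ) (v : Fin p → ℂ) (k : ℕ) :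
    esymm s (fun i => a * v i) k = a ^ k * esymm s v k := by
  rw [esymm, esymm, Finset.mul_sum]
  refine Finset.sum_congr rfl fun t ht => ?_
  rw [Finset.prod_mul_distrib, Finset.prod_const, (Finset.mem_powersetCard.mp ht).2]

lemma gLower_at_zero_of_gFun {p n : ℕ} (hpn : p ≤ n) (Λ : Fin p → ℝ) (x : ℂ) (j : Fin p)
    (hj : (Λ j : ℂ) ≠ 0) :
    gLower Λ n x (Complex.I / Λ j) = (Λ j : ℂ) * ((Λ j : ℂ) ^ n)⁻¹ *
      ∑ k ∈ Finset.Icc 1 p, x ^ (n - k) *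
        esymm (Finset.univ.erase j) (fun l => -(Λ l : ℂ)) (k - 1) / (Nat.factorial (n - k)) := by
  obtain ⟨q, rfl⟩ : ∃ q, p = q + 1 := ⟨p - 1, by have := j.pos; omega⟩
  obtain ⟨m, rfl⟩ : ∃ m, n = m + 1 := ⟨n - 1, by omega⟩
  have hcard : (Finset.univ.erase j).card = q := by simp
  have hsplit : expProdSeries Finset.univ (fun l => Complex.I * (Λ l : ℂ)) (-(Complex.I * x)) =
      (1 + PowerSeries.C (Complex.I * (Λ j : ℂ)) * PowerSeries.X) *
        expProdSeries (Finset.univ.erase j) (fun l => Complex.I * (Λ l : ℂ))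
          (-(Complex.I * x)) := by
    rw [expProdSeries, expProdSeries, ← Finset.mul_prod_erase _ _ (Finset.mem_univ j)]
    ring
  have hr : 1 + Complex.I * (Λ j : ℂ) * (Complex.I / Λ j) = 0 := by
    field_simp
    simp
  simp only [gLower, gCoeff_eq_coeff_s7, hsplit]
  rw [sum_range_coeff_one_add_mul _ hr, coeff_expProdSeries _ _ _ _ (by omega), hcard,
    Finset.sum_mul, Finset.mul_sum, ← Finset.Ico_add_one_right_eq_Icc, Finset.sum_Ico_eq_sum_range]
  refine Finset.sum_congr rfl fun k hk => ?_
  have hkm : k ≤ m := by have := Finset.mem_range.mp hk; omega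
  obtain ⟨d, rfl⟩ := Nat.exists_eq_add_of_le hkm
  rw [show k + d + 1 - (1 + k) = d by omega, show 1 + k - 1 = k by omega,
    show k + d - k = d by omega, esymm, ← Finset.sum_mul]
  have hI := esymm_const_mul (Finset.univ.erase j) Complex.I (fun l => (Λ l : ℂ)) k
  have hneg := esymm_const_mul (Finset.univ.erase j) (-1) (fun l => (Λ l : ℂ)) k
  simp only [esymm, neg_one_mul] at hI hneg
  rw [hI, hneg]
  have h1 : Complex.I ^ k * Complex.I ^ k = (-1) ^ k := by rw [← mul_pow, Complex.I_mul_I]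
  have h2 : (-(Complex.I * x)) ^ d * Complex.I ^ d = x ^ d := by
    rw [← mul_pow]
    congr 1
    linear_combination (-x) * Complex.I_mul_I
  rw [div_pow, pow_add, pow_succ (Λ j : ℂ), ← h1, ← h2]
  field_simp

/-- Partial fractions for the reciprocal of `∏ (1 + i r Λ_j)`. -/
lemma inv_prod_eq_sum {p : ℕ} (hp : 1 ≤ p) {Λ : Fin p → ℝ} (hΛ : ∀ j, (Λ j : ℂ) ≠ 0)
    (hdist : Function.Injective Λ) {r : ℂ} (hr : ∀ j, 1 + Complex.I * r * (Λ j : ℂ) ≠ 0) :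
    (∏ j, (1 + Complex.I * r * (Λ j : ℂ)))⁻¹ =
      ∑ j, (∏ l ∈ Finset.univ.erase j, (1 - (Λ l : ℂ) / (Λ j : ℂ)))⁻¹ *
        (1 + Complex.I * r * (Λ j : ℂ))⁻¹ := by
  have hinj : Set.InjOn (fun j => Complex.I / (Λ j : ℂ)) (Finset.univ : Finset (Fin p)) := by
    intro i _ j _ hij
    have h : (Λ i : ℂ) = Λ j := by simpa [div_eq_mul_inv] using hij
    exact hdist (by exact_mod_cast h)
  have hsum := congrArg (Polynomial.eval r)
    (Lagrange.sum_basis hinj ⟨⟨0, hp⟩, Finset.mem_univ _⟩)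
  rw [Polynomial.eval_finsetSum, Polynomial.eval_one] at hsum
  have hmul := congrArg ((∏ j, (1 + Complex.I * r * (Λ j : ℂ)))⁻¹ * ·) hsum
  simp only [mul_one, Finset.mul_sum] at hmul
  rw [← hmul]
  refine Finset.sum_congr rfl fun j _ => ?_
  have hbasis : Polynomial.eval r (Lagrange.basis Finset.univ (fun j => Complex.I / (Λ j : ℂ)) j) =
      (∏ l ∈ Finset.univ.erase j, (1 - (Λ l : ℂ) / (Λ j : ℂ)))⁻¹ *
        ∏ l ∈ Finset.univ.erase j, (1 + Complex.I * r * (Λ l : ℂ)) := by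
    rw [Lagrange.basis, Polynomial.eval_prod, ← Finset.prod_inv_distrib,
      ← Finset.prod_mul_distrib]
    refine Finset.prod_congr rfl fun l hl => ?_
    have hne : (Λ l : ℂ) ≠ Λ j := fun h =>
      (Finset.ne_of_mem_erase hl) (hdist (by exact_mod_cast h))
    have h1 : 1 - (Λ l : ℂ) / (Λ j : ℂ) ≠ 0 := by
      rw [sub_ne_zero]
      exact fun h => hne (by rw [eq_div_iff (hΛ j), one_mul] at h; exact h.symm)
    have h2 : Complex.I / (Λ j : ℂ) - Complex.I / (Λ l : ℂ) =
        -Complex.I * (1 - (Λ l : ℂ) / (Λ j : ℂ)) / Λ l := by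
      have := hΛ j
      have := hΛ l
      field_simp
      ring
    have h3 : r - Complex.I / (Λ l : ℂ) =
        -Complex.I * (1 + Complex.I * r * (Λ l : ℂ)) / Λ l := by
      have := hΛ l
      field_simp
      linear_combination (r * (Λ l : ℂ)) * Complex.I_sq
    simp only [Lagrange.basisDivisor, Polynomial.eval_mul, Polynomial.eval_C, Polynomial.eval_sub,
      Polynomial.eval_X]
    rw [h2, h3]
    have := hΛ l
    field_simp [Complex.I_ne_zero]
  rw [hbasis, ← Finset.mul_prod_erase _ _ (Finset.mem_univ j)]
  have h4 : ∏ l ∈ Finset.univ.erase j, (1 + Complex.I * r * (Λ l : ℂ)) ≠ 0 :=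
    Finset.prod_ne_zero_iff.mpr fun l _ => hr l
  rw [mul_inv, mul_left_comm, mul_assoc, inv_mul_cancel₀ h4, mul_one]

lemma one_add_I_mul_eq {a : ℂ} (ha : a ≠ 0) (r : ℂ) :
    1 + Complex.I * r * a = Complex.I * a * (r - Complex.I / a) := by
  field_simp
  linear_combination Complex.I_sq

/-- For `1 ≤ p ≤ n`, pairwise distinct positive `Λ₁,…,Λ_p`, and `R > max_j (1/Λ_j)`,
for every `x ∈ ℂ`:
`(1/(2π)) ∮_{|r|=R} g_Λ^{[<n]}(x;r)/g_Λ(x;r) dr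
  = Σ_j [e^{−x/Λ_j} Λ_j^{−n} / ∏_{l≠j}(1−Λ_l/Λ_j)] Σ_{k=1}^p x^{n−k} E_{k−1}(−Λ^ĵ)/(n−k)!`. -/
theorem circleIntegral_gLower_div_gFun
    (p n : ℕ) (hp : 1 ≤ p) (hpn : p ≤ n)
    (Λ : Fin p → ℝ) (hΛ : ∀ j, 0 < Λ j) (hdist : Function.Injective Λ)
    (R : ℝ) (hR : ∀ j, 1 / Λ j < R) (x : ℂ) :
    (2 * (Real.pi : ℂ))⁻¹ * (∮ r in C(0, R), gLower Λ n x r / gFun Λ x r)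
      = ∑ j, (Complex.exp (-(x / (Λ j : ℂ))) * ((Λ j : ℂ) ^ n)⁻¹ /
            ∏ l ∈ Finset.univ.erase j, (1 - (Λ l : ℂ) / (Λ j : ℂ))) *
          ∑ k ∈ Finset.Icc 1 p, x ^ (n - k) *
            esymm (Finset.univ.erase j) (fun l => -(Λ l : ℂ)) (k - 1) /
              (Nat.factorial (n - k)) := by
  have hΛ0 : ∀ j, (Λ j : ℂ) ≠ 0 := fun j => Complex.ofReal_ne_zero.mpr (hΛ j).ne'
  have hR0 : 0 < R := (one_div_pos.mpr (hΛ ⟨0, hp⟩)).trans (hR ⟨0, hp⟩)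
  have hnorm : ∀ j, ‖Complex.I / (Λ j : ℂ)‖ < R := fun j => by
    simpa [abs_of_pos (hΛ j)] using hR j
  have hsub : ∀ j, ∀ r ∈ Metric.sphere (0 : ℂ) R, r - Complex.I / (Λ j : ℂ) ≠ 0 := by
    intro j r hr h
    have h1 := hnorm j
    rw [← sub_eq_zero.mp h, mem_sphere_zero_iff_norm.mp hr] at h1
    exact lt_irrefl _ h1
  set F : ℂ → ℂ := fun r => gLower Λ n x r * Complex.exp (Complex.I * x * r) with hF
  have hFd : Differentiable ℂ F := by
    unfold F gLower
    fun_prop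
  set w : Fin p → ℂ := fun j =>
    (∏ l ∈ Finset.univ.erase j, (1 - (Λ l : ℂ) / (Λ j : ℂ)))⁻¹ * (Complex.I * Λ j)⁻¹ with hw
  have hint : (∮ r in C(0, R), gLower Λ n x r / gFun Λ x r) =
      ∮ r in C(0, R), ∑ j, w j * ((r - Complex.I / (Λ j : ℂ))⁻¹ • F r) := by
    refine circleIntegral.integral_congr hR0.le fun r hr => ?_
    have hne : ∀ j, 1 + Complex.I * r * (Λ j : ℂ) ≠ 0 := fun j => by
      rw [one_add_I_mul_eq (hΛ0 j)]
      exact mul_ne_zero (mul_ne_zero Complex.I_ne_zero (hΛ0 j)) (hsub j r hr)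
    simp only [gFun]
    rw [div_eq_mul_inv, mul_inv, ← Complex.exp_neg, neg_neg, inv_prod_eq_sum hp hΛ0 hdist hne,
      ← mul_assoc, Finset.mul_sum]
    refine Finset.sum_congr rfl fun j _ => ?_
    rw [one_add_I_mul_eq (hΛ0 j), mul_inv, hw, hF, smul_eq_mul]
    ring
  have hci : ∀ j ∈ (Finset.univ : Finset (Fin p)), CircleIntegrable
      (fun r => w j * ((r - Complex.I / (Λ j : ℂ))⁻¹ • F r)) 0 R := fun j _ =>
    ContinuousOn.circleIntegrable hR0.le (continuousOn_const.mul
      ((ContinuousOn.inv₀ (by fun_prop) (hsub j)).smul hFd.continuous.continuousOn))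
  rw [hint, circleIntegral.integral_fun_sum hci, Finset.mul_sum]
  refine Finset.sum_congr rfl fun j _ => ?_
  rw [circleIntegral.integral_const_mul,
    hFd.diffContOnCl.circleIntegral_sub_inv_smul (mem_ball_zero_iff.mpr (hnorm j)), hF, hw]
  simp only [gLower_at_zero_of_gFun hpn Λ x j (hΛ0 j), smul_eq_mul]
  have hexp : Complex.I * x * (Complex.I / (Λ j : ℂ)) = -(x / (Λ j : ℂ)) := by
    linear_combination x / (Λ j : ℂ) * Complex.I_sq
  rw [hexp]
  have hpi : (Real.pi : ℂ) ≠ 0 := Complex.ofReal_ne_zero.mpr Real.pi_ne_zero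
  have := hΛ0 j
  field_simp [Complex.I_ne_zero]
end

section
/- Let 1 ≤ p ≤ n be integers and let Λ₁,…,Λ_p be positive reals with Λ = diag(Λ₁,…,Λ_p). Let x₀, x₁ ∈ ℂ with Im x₀ > 0, Im x₀ > Im x₁, and x₁ ≠ 0. Then the generating function Z₂(x₀,x₁) := ∫ det(x₁·1_p − WW†)/det(x₀·1_p − WW†) dμ₂(W), where the integral is over all complex p×n matrices W, satisfies Z₂(x₀,x₁) = −i (x₀ − x₁) (x₀/x₁)^{n−p} ∫₀^∞ g_Λ^{[≥n]}(x₁;r)/g_Λ(x₀;r) dr, and this improper integral converges absolutely. -/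
open MeasureTheory Matrix

/-- The complex Wishart measure with parameter `Λ = diag(Λ₁,…,Λ_p)`: the probability
measure on complex `p × n` matrices (identified with the pi type `Fin p → Fin n → ℂ`
carrying Lebesgue measure) with density `P₂(W) = (π^p det Λ)^{-n} exp(-tr(W† Λ⁻¹ W))`. -/
noncomputable def wishartMeasureComplex (p n : ℕ) (Λ : Fin p → ℝ) :
    Measure (Fin p → Fin n → ℂ) :=
  volume.withDensity fun W =>
    ENNReal.ofReal (((Real.pi ^ p * ∏ j, Λ j) ^ n)⁻¹ *
      Real.exp (-((Matrix.of W)ᴴ *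
          (Matrix.diagonal fun j => (Λ j : ℂ))⁻¹ * Matrix.of W).trace.re))

lemma integrable_cexp_neg_mul_normSq {b : ℂ} (hb : 0 < b.re) :
    Integrable fun z : ℂ => Complex.exp (-b * (‖z‖ : ℂ) ^ 2) := by
  simpa using GaussianFourier.integrable_cexp_neg_mul_sq_norm_add (V := ℂ) hb 0 0

lemma norm_cexp_neg_mul_normSq (b z : ℂ) :
    ‖Complex.exp (-b * (‖z‖ : ℂ) ^ 2)‖ = Real.exp (-b.re * ‖z‖ ^ 2) := by
  rw [Complex.norm_exp]
  norm_cast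
  simp only [Complex.mul_re, Complex.neg_re, Complex.ofReal_re, Complex.ofReal_im]
  simp

lemma integral_cexp_neg_mul_normSq {b : ℂ} (hb : 0 < b.re) :
    ∫ z : ℂ, Complex.exp (-b * (‖z‖ : ℂ) ^ 2) = Real.pi / b := by
  have := GaussianFourier.integral_cexp_neg_mul_sq_norm (V := ℂ) hb
  rw [this, Complex.finrank_real_complex]
  simp

/-- Powers are absorbed by a decaying exponential. -/
lemma exists_pow_le_mul_exp (d : ℕ) {c : ℝ} (hc : 0 < c) :
    ∃ K : ℝ, 0 ≤ K ∧ ∀ t : ℝ, 0 ≤ t → (1 + t) ^ d ≤ K * Real.exp (c * t) := by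
  refine ⟨(d.factorial : ℝ) / c ^ d * Real.exp c, by positivity, fun t ht => ?_⟩
  have h := Real.pow_div_factorial_le_exp (c * (1 + t)) (by positivity) d
  rw [div_le_iff₀ (by positivity), mul_pow] at h
  have h2 : Real.exp (c * (1 + t)) = Real.exp c * Real.exp (c * t) := by
    rw [← Real.exp_add]; ring_nf
  rw [h2] at h
  have hcd : (0 : ℝ) < c ^ d := by positivity
  calc (1 + t) ^ d = c ^ d * (1 + t) ^ d / c ^ d := by field_simp
    _ ≤ Real.exp c * Real.exp (c * t) * d.factorial / c ^ d := by gcongr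
    _ = _ := by ring

lemma integrable_of_normSq_mul_exp {f : ℂ → ℂ} {b : ℂ} (hb : 0 < b.re) (hf : Continuous f)
    (hle : ∀ z, ‖f z‖ ≤ 1 + ‖z‖ ^ 2) :
    Integrable fun z : ℂ => f z * Complex.exp (-b * (‖z‖ : ℂ) ^ 2) := by
  obtain ⟨K, hK, h⟩ := exists_pow_le_mul_exp 1 (half_pos hb)
  have hb' : 0 < (b / 2).re := by simpa using hb
  refine (((integrable_cexp_neg_mul_normSq hb').norm).const_mul K).mono'
    (by fun_prop) (.of_forall fun z => ?_)
  rw [norm_mul, norm_cexp_neg_mul_normSq, norm_cexp_neg_mul_normSq]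
  have h1 := h (‖z‖ ^ 2) (by positivity)
  rw [pow_one] at h1
  calc ‖f z‖ * Real.exp (-b.re * ‖z‖ ^ 2)
      ≤ (K * Real.exp (b.re / 2 * ‖z‖ ^ 2)) * Real.exp (-b.re * ‖z‖ ^ 2) := by
        gcongr; exact (hle z).trans h1
    _ = K * Real.exp (-(b / 2).re * ‖z‖ ^ 2) := by
        rw [mul_assoc, ← Real.exp_add]; congr 2
        simp; ring

lemma integral_normSq_mul_cexp {b : ℂ} (hb : 0 < b.re) :
    ∫ z : ℂ, (‖z‖ : ℂ) ^ 2 * Complex.exp (-b * (‖z‖ : ℂ) ^ 2) = Real.pi / b ^ 2 := by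
  have hb2 : 0 < (b / 2).re := by simpa using hb
  have hmeas : ∀ x : ℂ, AEStronglyMeasurable
      (fun z : ℂ => Complex.exp (-x * (‖z‖ : ℂ) ^ 2)) volume := fun x =>
    Continuous.aestronglyMeasurable (by fun_prop)
  have hint := (integrable_of_normSq_mul_exp (f := fun z => (‖z‖ : ℂ) ^ 2) hb2 (by fun_prop)
    (fun z => by simp)).norm
  have hs : {x : ℂ | (b / 2).re < x.re} ∈ nhds b :=
    (isOpen_lt continuous_const Complex.continuous_re).mem_nhds (by simp; linarith)
  have key := hasDerivAt_integral_of_dominated_loc_of_deriv_le (μ := (volume : Measure ℂ))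
    (F := fun (x z : ℂ) => Complex.exp (-x * (‖z‖ : ℂ) ^ 2)) (x₀ := b)
    (F' := fun (x z : ℂ) => -((‖z‖ : ℂ) ^ 2 * Complex.exp (-x * (‖z‖ : ℂ) ^ 2)))
    hs (.of_forall hmeas) (integrable_cexp_neg_mul_normSq hb)
    (Continuous.aestronglyMeasurable (by fun_prop)) (.of_forall fun z x hx => ?_) hint
    (.of_forall fun z x _ => ?_)
  · have h1 : HasDerivAt (fun x : ℂ => (Real.pi : ℂ) / x) (-(Real.pi / b ^ 2)) b := by
      have hb0 : b ≠ 0 := fun h => by simp [h] at hb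
      simp only [div_eq_mul_inv]
      exact ((hasDerivAt_inv hb0).const_mul (Real.pi : ℂ)).congr_deriv (by ring)
    have h2 : (fun x : ℂ => ∫ z : ℂ, Complex.exp (-x * (‖z‖ : ℂ) ^ 2)) =ᶠ[nhds b]
        fun x => Real.pi / x := by
      filter_upwards [hs] with x hx
      exact integral_cexp_neg_mul_normSq (hb2.trans hx)
    have h3 := (key.2.congr_of_eventuallyEq h2.symm).unique h1
    rw [integral_neg] at h3
    exact neg_injective h3
  · rw [norm_neg, norm_mul, norm_mul, norm_cexp_neg_mul_normSq, norm_cexp_neg_mul_normSq]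
    have : (b / 2).re < x.re := hx
    gcongr
  · have : HasDerivAt (fun x : ℂ => -x * (‖z‖ : ℂ) ^ 2) (-(‖z‖ : ℂ) ^ 2) x := by
      simpa using (hasDerivAt_neg x).mul_const ((‖z‖ : ℂ) ^ 2)
    exact this.cexp.congr_deriv (by ring)

lemma integral_eq_zero_of_odd {f : ℂ → ℂ} (hf : ∀ z, f (-z) = -f z) : ∫ z, f z = 0 := by
  have h := integral_neg_eq_self f volume
  simp only [hf, integral_neg] at h
  exact self_eq_neg.mp h.symm

section Product
variable {ι : Type*} [Fintype ι]

lemma cexp_neg_sum (b : ι → ℂ) (w : ι → ℂ) :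
    Complex.exp (-∑ m, b m * (‖w m‖ : ℂ) ^ 2) =
      ∏ m, Complex.exp (-b m * (‖w m‖ : ℂ) ^ 2) := by
  rw [← Complex.exp_sum]; congr 1; simp

lemma integrable_cexp_neg_sum {b : ι → ℂ} (hb : ∀ m, 0 < (b m).re) :
    Integrable fun w : ι → ℂ => Complex.exp (-∑ m, b m * (‖w m‖ : ℂ) ^ 2) := by
  simp_rw [cexp_neg_sum]
  exact Integrable.fintype_prod fun m => integrable_cexp_neg_mul_normSq (hb m)

lemma integral_cexp_neg_sum {b : ι → ℂ} (hb : ∀ m, 0 < (b m).re) :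
    ∫ w : ι → ℂ, Complex.exp (-∑ m, b m * (‖w m‖ : ℂ) ^ 2) = ∏ m, (Real.pi / b m : ℂ) := by
  simp_rw [cexp_neg_sum]
  rw [integral_fintype_prod_volume_eq_prod
    (fun m (z : ℂ) => Complex.exp (-b m * (‖z‖ : ℂ) ^ 2))]
  exact Finset.prod_congr rfl fun m _ => integral_cexp_neg_mul_normSq (hb m)

variable [DecidableEq ι]

lemma mul_conj_mul_cexp_neg_sum (b : ι → ℂ) (k l : ι) (w : ι → ℂ) :
    w k * star (w l) * Complex.exp (-∑ m, b m * (‖w m‖ : ℂ) ^ 2) =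
      ∏ m, ((if m = k then w m else 1) * (if m = l then star (w m) else 1)) *
        Complex.exp (-b m * (‖w m‖ : ℂ) ^ 2) := by
  rw [cexp_neg_sum, Finset.prod_mul_distrib, Finset.prod_mul_distrib]
  simp

lemma integrable_mul_conj_mul_cexp_neg_sum {b : ι → ℂ} (hb : ∀ m, 0 < (b m).re) (k l : ι) :
    Integrable fun w : ι → ℂ =>
      w k * star (w l) * Complex.exp (-∑ m, b m * (‖w m‖ : ℂ) ^ 2) := by
  simp_rw [mul_conj_mul_cexp_neg_sum]
  refine Integrable.fintype_prod (f := fun m z => ((if m = k then z else 1) *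
    (if m = l then star z else 1)) * Complex.exp (-b m * (‖z‖ : ℂ) ^ 2)) fun m => ?_
  refine integrable_of_normSq_mul_exp (f := fun z => (if m = k then z else 1) *
    (if m = l then star z else 1)) (hb m) ?_ fun z => ?_
  · split_ifs <;> fun_prop
  · split_ifs <;> simp <;> nlinarith [sq_nonneg (‖z‖ - 1), norm_nonneg z]

lemma integral_mul_conj_mul_cexp_neg_sum {b : ι → ℂ} (hb : ∀ m, 0 < (b m).re) (k l : ι) :
    ∫ w : ι → ℂ, w k * star (w l) * Complex.exp (-∑ m, b m * (‖w m‖ : ℂ) ^ 2) =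
      if k = l then (∏ m, (Real.pi / b m : ℂ)) / b k else 0 := by
  simp_rw [mul_conj_mul_cexp_neg_sum]
  rw [integral_fintype_prod_volume_eq_prod (fun m (z : ℂ) => ((if m = k then z else 1) *
    (if m = l then star z else 1)) * Complex.exp (-b m * (‖z‖ : ℂ) ^ 2))]
  split_ifs with hkl
  · subst hkl
    rw [← Finset.mul_prod_erase _ _ (Finset.mem_univ k),
      ← Finset.mul_prod_erase _ (fun m => (Real.pi / b m : ℂ)) (Finset.mem_univ k)]
    have h1 : ∀ z : ℂ, z * star z = (‖z‖ : ℂ) ^ 2 := fun z => by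
      simpa using Complex.mul_conj' z
    have hk : b k ≠ 0 := fun h => by simpa [h] using hb k
    simp only [if_true, h1, integral_normSq_mul_cexp (hb k)]
    rw [Finset.prod_congr rfl (g := fun m => (Real.pi / b m : ℂ)) fun m hm => ?_]
    · field_simp
    · simp only [Finset.ne_of_mem_erase hm, if_false, one_mul]
      exact integral_cexp_neg_mul_normSq (hb m)
  · refine Finset.prod_eq_zero (Finset.mem_univ k) (integral_eq_zero_of_odd fun z => ?_)
    simp [hkl]

end Product

/-- Up to a constant factor, linear changes of variables preserve integrals. -/
lemma exists_integral_comp_continuousLinearEquiv {E F : Type*}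
    [NormedAddCommGroup E] [NormedSpace ℝ E] [MeasureSpace E] [BorelSpace E]
    [NormedAddCommGroup F] [NormedSpace ℝ F] [MeasureSpace F] [BorelSpace F]
    [FiniteDimensional ℝ F] [(volume : Measure E).IsAddHaarMeasure]
    [(volume : Measure F).IsAddHaarMeasure] (e : E ≃L[ℝ] F) :
    ∃ c : ℝ, (∀ f : F → ℂ, ∫ w, f (e w) = c * ∫ w, f w) ∧
      ∀ f : F → ℂ, Integrable f → Integrable fun w => f (e w) := by
  have : SecondCountableTopology F := inferInstance
  have h1 : (Measure.map e (volume : Measure E)).IsAddHaarMeasure :=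
    e.isAddHaarMeasure_map _
  have h2 := Measure.isAddLeftInvariant_eq_smul (Measure.map e (volume : Measure E))
    (volume : Measure F)
  have hemb : MeasurableEmbedding e := e.toHomeomorph.measurableEmbedding
  obtain ⟨c, hc⟩ : ∃ c : NNReal, Measure.map e (volume : Measure E) = c • volume := ⟨_, h2⟩
  refine ⟨c, fun f => ?_, fun f hf => ?_⟩
  · rw [← hemb.integral_map, hc, integral_smul_nnreal_measure, NNReal.smul_def, Complex.real_smul]
  · have : Integrable f (Measure.map e volume) := by
      rw [hc]; exact hf.smul_measure_nnreal
    exact (hemb.integrable_map_iff (f := e) (g := f)).1 this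

section Unitary
variable {ι : Type*} [Fintype ι]

lemma sum_normSq_eq (w : ι → ℂ) : ∑ m, (‖w m‖ : ℂ) ^ 2 = star w ⬝ᵥ w := by
  simp [dotProduct, Complex.conj_mul']

lemma star_mulVec_dotProduct (A : Matrix ι ι ℂ) (v w : ι → ℂ) :
    star (A *ᵥ v) ⬝ᵥ w = star v ⬝ᵥ (Aᴴ *ᵥ w) := by
  rw [star_mulVec, dotProduct_mulVec]

variable [DecidableEq ι]

lemma exists_integral_comp_mulVec {T S : Matrix ι ι ℂ} (h : T * S = 1) :
    ∃ c : ℝ, (∀ f : (ι → ℂ) → ℂ, ∫ w, f (T *ᵥ w) = c * ∫ w, f w) ∧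
      ∀ f : (ι → ℂ) → ℂ, Integrable f → Integrable fun w => f (T *ᵥ w) := by
  have h' : S * T = 1 := mul_eq_one_comm.1 h
  let e := (Matrix.toLin'OfInv h' h).toContinuousLinearEquiv.restrictScalars ℝ
  exact exists_integral_comp_continuousLinearEquiv e

lemma integral_comp_unitary {U : Matrix ι ι ℂ} (hU : Uᴴ * U = 1) :
    (∀ f : (ι → ℂ) → ℂ, ∫ w, f (U *ᵥ w) = ∫ w, f w) ∧
      ∀ f : (ι → ℂ) → ℂ, Integrable f → Integrable fun w => f (U *ᵥ w) := by
  obtain ⟨c, hc, hi⟩ := exists_integral_comp_mulVec (mul_eq_one_comm.1 hU)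
  refine ⟨fun f => ?_, hi⟩
  have h1 := hc fun w => Complex.exp (-∑ m, (1 : ℂ) * (‖w m‖ : ℂ) ^ 2)
  have h2 : ∀ w : ι → ℂ, ∑ m, (1 : ℂ) * (‖(U *ᵥ w) m‖ : ℂ) ^ 2
      = ∑ m, (1 : ℂ) * (‖w m‖ : ℂ) ^ 2 := fun w => by
    simp only [one_mul, sum_normSq_eq, star_mulVec_dotProduct, mulVec_mulVec, hU, one_mulVec]
  simp only [h2] at h1
  have h3 : ∫ w : ι → ℂ, Complex.exp (-∑ m, (1 : ℂ) * (‖w m‖ : ℂ) ^ 2) ≠ 0 := by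
    rw [integral_cexp_neg_sum (b := fun _ => 1) (by simp)]
    exact Finset.prod_ne_zero_iff.2 fun _ _ => by simp [Real.pi_ne_zero]
  have h4 : (c : ℂ) = 1 := by
    have := mul_right_cancel₀ h3 ((one_mul _).trans h1)
    exact this.symm
  rw [hc, h4, one_mul]

/-- The Gaussian weight `exp(-y|w|² - i w†Hw)`. -/
noncomputable def hermGauss (y : ℂ) (H : Matrix ι ι ℂ) (w : ι → ℂ) : ℂ :=
  Complex.exp (-(y * ∑ m, (‖w m‖ : ℂ) ^ 2) - Complex.I * (star w ⬝ᵥ H *ᵥ w))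

lemma Matrix.IsHermitian.exists_diagonalization {H : Matrix ι ι ℂ} (hH : H.IsHermitian) :
    ∃ (U : Matrix ι ι ℂ) (l : ι → ℝ), Uᴴ * U = 1 ∧ U * Uᴴ = 1 ∧
      H = U * diagonal (fun m => (l m : ℂ)) * Uᴴ := by
  refine ⟨hH.eigenvectorUnitary, hH.eigenvalues, ?_, ?_, ?_⟩
  · exact Unitary.coe_star_mul_self hH.eigenvectorUnitary
  · exact Unitary.coe_mul_star_self hH.eigenvectorUnitary
  · conv_lhs => rw [hH.spectral_theorem, Unitary.conjStarAlgAut_apply]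
    rfl

variable {y : ℂ} {H : Matrix ι ι ℂ}

lemma hermGauss_mulVec {U : Matrix ι ι ℂ} {l : ι → ℝ} (hU : Uᴴ * U = 1)
    (hH : H = U * diagonal (fun m => (l m : ℂ)) * Uᴴ) (y : ℂ) (w : ι → ℂ) :
    hermGauss y H (U *ᵥ w) =
      Complex.exp (-∑ m, (y + Complex.I * l m) * (‖w m‖ : ℂ) ^ 2) := by
  have h1 : star (U *ᵥ w) ⬝ᵥ H *ᵥ (U *ᵥ w) = ∑ m, (l m : ℂ) * (‖w m‖ : ℂ) ^ 2 := by
    rw [star_mulVec_dotProduct, hH, mulVec_mulVec, mulVec_mulVec]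
    have : Uᴴ * (U * diagonal (fun m => (l m : ℂ)) * Uᴴ) * U =
        diagonal (fun m => (l m : ℂ)) := by
      calc _ = (Uᴴ * U) * diagonal (fun m => (l m : ℂ)) * (Uᴴ * U) := by
            simp only [Matrix.mul_assoc]
        _ = _ := by rw [hU]; simp
    rw [this]
    simp only [dotProduct, mulVec_diagonal, Pi.star_apply]
    refine Finset.sum_congr rfl fun m _ => ?_
    rw [← Complex.conj_mul', ← Complex.star_def]
    ring
  rw [hermGauss, h1, sum_normSq_eq, star_mulVec_dotProduct, mulVec_mulVec, hU, one_mulVec,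
    ← sum_normSq_eq]
  congr 1
  rw [Finset.mul_sum, Finset.mul_sum, ← Finset.sum_neg_distrib, ← Finset.sum_neg_distrib,
    ← Finset.sum_sub_distrib]
  exact Finset.sum_congr rfl fun m _ => by ring

lemma smul_one_add_diagonalization {U : Matrix ι ι ℂ} {l : ι → ℝ} (hU' : U * Uᴴ = 1)
    (hH : H = U * diagonal (fun m => (l m : ℂ)) * Uᴴ) (y : ℂ) :
    y • (1 : Matrix ι ι ℂ) + Complex.I • H =
      U * diagonal (fun m => y + Complex.I * l m) * Uᴴ := by
  have h1 : (diagonal (fun m => y + Complex.I * l m) : Matrix ι ι ℂ) =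
      y • 1 + Complex.I • diagonal (fun m => (l m : ℂ)) := by
    ext i j
    by_cases h : i = j <;> simp [h, diagonal]
  rw [h1, hH, Matrix.mul_add, Matrix.add_mul]
  simp [hU']

lemma add_I_mul_ofReal_re (hy : 0 < y.re) (t : ℝ) : 0 < (y + Complex.I * t).re := by
  simpa using hy

lemma det_smul_one_add_ne_zero (hy : 0 < y.re) (hH : H.IsHermitian) :
    (y • (1 : Matrix ι ι ℂ) + Complex.I • H).det ≠ 0 := by
  obtain ⟨U, l, hU, hU', h⟩ := hH.exists_diagonalization
  have hd : U.det * Uᴴ.det = 1 := by rw [← det_mul, hU', det_one]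
  rw [smul_one_add_diagonalization hU' h, det_mul, det_mul, det_diagonal, mul_right_comm, hd,
    one_mul]
  exact Finset.prod_ne_zero_iff.2 fun m _ h0 => by
    have := add_I_mul_ofReal_re hy (l m)
    rw [h0] at this; simp at this

lemma integrable_hermGauss (hy : 0 < y.re) (hH : H.IsHermitian) :
    Integrable (hermGauss y H) := by
  obtain ⟨U, l, hU, hU', h⟩ := hH.exists_diagonalization
  have hV : (Uᴴ)ᴴ * Uᴴ = 1 := by rw [conjTranspose_conjTranspose, hU']
  have := (integral_comp_unitary hV).2 _ (integrable_cexp_neg_sum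
    (b := fun m => y + Complex.I * l m) fun m => add_I_mul_ofReal_re hy (l m))
  refine this.congr (.of_forall fun w => ?_)
  simp only
  rw [← hermGauss_mulVec hU h, mulVec_mulVec, hU', one_mulVec]

lemma integral_hermGauss (hy : 0 < y.re) (hH : H.IsHermitian) :
    ∫ w, hermGauss y H w =
      (Real.pi : ℂ) ^ Fintype.card ι / (y • (1 : Matrix ι ι ℂ) + Complex.I • H).det := by
  obtain ⟨U, l, hU, hU', h⟩ := hH.exists_diagonalization
  have hd : U.det * Uᴴ.det = 1 := by rw [← det_mul, hU', det_one]
  rw [← (integral_comp_unitary hU).1]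
  simp_rw [hermGauss_mulVec hU h]
  rw [integral_cexp_neg_sum fun m => add_I_mul_ofReal_re hy (l m),
    smul_one_add_diagonalization hU' h, det_mul, det_mul, det_diagonal, mul_right_comm, hd,
    one_mul, Finset.prod_div_distrib]
  simp

/-- Second moments of the Gaussian weight; `S` is the inverse of `y + iH`. -/
lemma integral_mul_conj_mul_hermGauss (hy : 0 < y.re) (hH : H.IsHermitian)
    {S : Matrix ι ι ℂ} (hS : (y • (1 : Matrix ι ι ℂ) + Complex.I • H) * S = 1) (i j : ι) :
    Integrable (fun w => w i * star (w j) * hermGauss y H w) ∧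
    ∫ w, w i * star (w j) * hermGauss y H w =
      (∫ w, hermGauss y H w) * S i j := by
  obtain ⟨U, l, hU, hU', h⟩ := hH.exists_diagonalization
  have hb : ∀ m, 0 < (y + Complex.I * l m).re := fun m => add_I_mul_ofReal_re hy (l m)
  have hb0 : ∀ m, y + Complex.I * l m ≠ 0 := fun m h0 => by
    have := hb m
    rw [h0] at this; simp at this
  have hV : (Uᴴ)ᴴ * Uᴴ = 1 := by rw [conjTranspose_conjTranspose, hU']
  have hS' : S = U * diagonal (fun m => (y + Complex.I * l m)⁻¹) * Uᴴ := by
    rw [smul_one_add_diagonalization hU' h] at hS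
    have h1 : (U * diagonal (fun m => (y + Complex.I * l m)⁻¹) * Uᴴ) *
        (U * diagonal (fun m => (y + Complex.I * l m)) * Uᴴ) = 1 := by
      calc _ = U * (diagonal (fun m => (y + Complex.I * l m)⁻¹) * (Uᴴ * U) *
            diagonal (fun m => (y + Complex.I * l m))) * Uᴴ := by
            simp only [Matrix.mul_assoc]
        _ = 1 := by
            rw [hU, Matrix.mul_one, diagonal_mul_diagonal]
            simp [inv_mul_cancel₀ (hb0 _), hU']
    calc S = _ * S := (Matrix.one_mul S).symm
      _ = _ := by rw [← h1, Matrix.mul_assoc, hS, Matrix.mul_one]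
  have hexp : ∀ w : ι → ℂ, (U *ᵥ w) i * star ((U *ᵥ w) j) * hermGauss y H (U *ᵥ w) =
      ∑ k, ∑ m, U i k * star (U j m) * (w k * star (w m) *
        Complex.exp (-∑ m, (y + Complex.I * l m) * (‖w m‖ : ℂ) ^ 2)) := fun w => by
    rw [hermGauss_mulVec hU h]
    simp only [mulVec, dotProduct, star_sum, Finset.sum_mul_sum]
    simp only [Finset.sum_mul]
    refine Finset.sum_congr rfl fun k _ => Finset.sum_congr rfl fun m _ => ?_
    rw [star_mul]; ring
  have hint := fun k m => (integrable_mul_conj_mul_cexp_neg_sum hb k m).const_mul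
    (U i k * star (U j m))
  constructor
  · have := (integral_comp_unitary hV).2 _ (integrable_finsetSum Finset.univ fun k _ =>
      integrable_finsetSum Finset.univ fun m _ => hint k m)
    refine this.congr (.of_forall fun w => ?_)
    simp only
    rw [← hexp, mulVec_mulVec, hU', one_mulVec]
  · rw [← (integral_comp_unitary hU).1, ← (integral_comp_unitary hU).1 (hermGauss y H)]
    simp_rw [hexp, hermGauss_mulVec hU h]
    rw [integral_finsetSum _ fun k _ => integrable_finsetSum _ fun m _ => hint k m]
    simp_rw [integral_finsetSum Finset.univ fun m _ => hint _ m, integral_const_mul,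
      integral_mul_conj_mul_cexp_neg_sum hb, integral_cexp_neg_sum hb]
    rw [hS', Matrix.mul_apply, Finset.mul_sum]
    refine Finset.sum_congr rfl fun k _ => ?_
    simp [mul_diagonal, div_eq_mul_inv]
    ring

end Unitary

section Det
variable {ι : Type*} [Fintype ι] [DecidableEq ι]

lemma trace_adjugate_mul (A N : Matrix ι ι ℂ) :
    (A.adjugate * N).trace = ∑ i, (A.updateCol i fun j => N j i).det := by
  simp only [trace, diag_apply]
  refine Finset.sum_congr rfl fun i _ => ?_
  rw [← cramer_apply, cramer_eq_adjugate_mulVec]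
  rfl

/-- Jacobi's formula along a line. -/
lemma hasDerivAt_det_add_smul (A N : Matrix ι ι ℂ) (s : ℂ) :
    HasDerivAt (fun s : ℂ => (A + s • N).det) ((A + s • N).adjugate * N).trace s := by
  have h1 : ∀ σ : Equiv.Perm ι, HasDerivAt
      (fun s : ℂ => ((Equiv.Perm.sign σ : ℤ) : ℂ) * ∏ i, (A + s • N) (σ i) i)
      (((Equiv.Perm.sign σ : ℤ) : ℂ) *
        ∑ i, (∏ j ∈ Finset.univ.erase i, (A + s • N) (σ j) j) * N (σ i) i) s := fun σ => by
    refine HasDerivAt.const_mul _ ?_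
    have := HasDerivAt.fun_finsetProd (u := Finset.univ) (x := s)
      (f := fun i (s : ℂ) => (A + s • N) (σ i) i)
      (f' := fun i => N (σ i) i) fun i _ => by
        simp only [Matrix.add_apply, Matrix.smul_apply, smul_eq_mul]
        simpa using ((hasDerivAt_id s).mul_const (N (σ i) i)).const_add (A (σ i) i)
    simpa only [smul_eq_mul] using this
  have h2 := HasDerivAt.fun_sum (u := Finset.univ) fun σ _ => h1 σ
  simp only [← det_apply'] at h2
  refine h2.congr_deriv ?_
  rw [trace_adjugate_mul]
  simp only [det_apply', Finset.mul_sum]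
  rw [Finset.sum_comm]
  refine Finset.sum_congr rfl fun i _ => Finset.sum_congr rfl fun σ _ => ?_
  rw [← Finset.mul_prod_erase Finset.univ _ (Finset.mem_univ i), updateCol_self, mul_comm (N _ _)]
  congr 2
  refine Finset.prod_congr rfl fun j hj => ?_
  rw [updateCol_ne (Finset.ne_of_mem_erase hj)]

/-- The rank-one update formula for determinants. -/
lemma det_add_vecMulVec (A : Matrix ι ι ℂ) (u v : ι → ℂ) :
    (A + vecMulVec u v).det = A.det + v ⬝ᵥ A.adjugate *ᵥ u := by
  have h1 : ∀ B : Matrix ι ι ℂ, B.det ≠ 0 →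
      (B + vecMulVec u v).det = B.det + v ⬝ᵥ B.adjugate *ᵥ u := fun B hB => by
    rw [vecMulVec_eq Unit, det_add_replicateCol_mul_replicateRow (isUnit_iff_ne_zero.2 hB),
      det_unique (n := Unit), Matrix.add_apply, one_apply_eq, Matrix.mul_assoc, ← replicateCol_mulVec,
      replicateRow_mul_replicateCol_apply, inv_def, Ring.inverse_eq_inv', smul_mulVec,
      dotProduct_smul, smul_eq_mul, mul_add, mul_one, mul_inv_cancel_left₀ hB]
  have h2 : ∀ᶠ z : ℂ in nhdsWithin 0 {0}ᶜ, (A + z • (1 : Matrix ι ι ℂ)).det ≠ 0 := by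
    have hfin := (-A).charpoly.rootSet_finite ℂ
    have : {z : ℂ | (A + z • (1 : Matrix ι ι ℂ)).det = 0} ⊆ (-A).charpoly.rootSet ℂ := fun z hz => by
      rw [Polynomial.mem_rootSet]
      refine ⟨(-A).charpoly_monic.ne_zero, ?_⟩
      rw [Polynomial.coe_aeval_eq_eval, eval_charpoly, sub_neg_eq_add, scalar_apply,
        ← smul_one_eq_diagonal, add_comm]
      exact hz
    have hf := (hfin.subset this)
    have h3 := (hf.subset Set.sdiff_subset : ({z : ℂ | (A + z • (1 : Matrix ι ι ℂ)).det = 0} \ {0}).Finite)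
    have h4 := h3.isClosed.isOpen_compl.mem_nhds (x := (0 : ℂ)) (by simp)
    filter_upwards [nhdsWithin_le_nhds h4, self_mem_nhdsWithin] with z hz hz0 h
    exact hz ⟨h, hz0⟩
  have hc1 : Continuous fun z : ℂ => (A + z • (1 : Matrix ι ι ℂ) + vecMulVec u v).det := by
    fun_prop
  have hc2 : Continuous fun z : ℂ => (A + z • (1 : Matrix ι ι ℂ)).det +
      v ⬝ᵥ (A + z • (1 : Matrix ι ι ℂ)).adjugate *ᵥ u := by
    fun_prop
  have := tendsto_nhds_unique_of_eventuallyEq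
    ((hc1.tendsto 0).mono_left (nhdsWithin_le_nhds (s := {0}ᶜ)))
    ((hc2.tendsto 0).mono_left nhdsWithin_le_nhds)
    (h2.mono fun z hz => h1 _ hz)
  simpa using this

end Det

section Column
variable {ι : Type*} [Fintype ι]

/-- The weight `exp(-w†Λ⁻¹w - i|v†w|²)` of a single column. -/
noncomputable def colWeight (Λ : ι → ℝ) (v w : ι → ℂ) : ℂ :=
  Complex.exp (-∑ m, ((Λ m)⁻¹ : ℂ) * (‖w m‖ : ℂ) ^ 2 -
    Complex.I * (‖star v ⬝ᵥ w‖ : ℂ) ^ 2)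

/-- The quadratic form `v†Λv`. -/
noncomputable def quadForm (Λ : ι → ℝ) (v : ι → ℂ) : ℝ := ∑ m, Λ m * ‖v m‖ ^ 2

lemma one_add_I_mul_ofReal_ne_zero (q : ℝ) : 1 + Complex.I * (q : ℂ) ≠ 0 := fun h => by
  have := congrArg Complex.re h
  simp at this

variable [DecidableEq ι]

/-- The covariance `(Λ⁻¹ + i vv†)⁻¹` of the column weight. -/
noncomputable def colCov (Λ : ι → ℝ) (v : ι → ℂ) : Matrix ι ι ℂ :=
  diagonal (fun m => (Λ m : ℂ)) - (Complex.I / (1 + Complex.I * quadForm Λ v)) •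
    vecMulVec (fun m => (Λ m : ℂ) * v m) (fun m => (Λ m : ℂ) * star (v m))

variable {Λ : ι → ℝ} (hΛ : ∀ j, 0 < Λ j) (v : ι → ℂ)

include hΛ

lemma exists_sqrt_diagonal_integral :
    (∀ f : (ι → ℂ) → ℂ, ∫ w, f w =
      (∏ m, (Λ m : ℂ)) * ∫ w : ι → ℂ, f (fun m => (Real.sqrt (Λ m) : ℂ) * w m)) ∧
    ∀ f : (ι → ℂ) → ℂ,
      Integrable (fun w : ι → ℂ => f (fun m => (Real.sqrt (Λ m) : ℂ) * w m)) →
      Integrable f := by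
  have hs : ∀ m, (Real.sqrt (Λ m) : ℂ) ≠ 0 := fun m =>
    Complex.ofReal_ne_zero.2 (Real.sqrt_pos.2 (hΛ m)).ne'
  set D : Matrix ι ι ℂ := diagonal fun m => (Real.sqrt (Λ m) : ℂ) with hD
  set D' : Matrix ι ι ℂ := diagonal fun m => (Real.sqrt (Λ m) : ℂ)⁻¹ with hD'
  have hDD : D * D' = 1 := by
    rw [hD, hD', diagonal_mul_diagonal]; simp [hs]
  have hDm : ∀ w : ι → ℂ, D *ᵥ w = fun m => (Real.sqrt (Λ m) : ℂ) * w m := fun w => by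
    ext m; simp [hD, mulVec_diagonal]
  obtain ⟨c, hc, -⟩ := exists_integral_comp_mulVec hDD
  obtain ⟨-, -, hi⟩ := exists_integral_comp_mulVec (mul_eq_one_comm.1 hDD)
  simp only [hDm] at hc
  have h1 := hc fun w => Complex.exp (-∑ m, ((Λ m)⁻¹ : ℂ) * (‖w m‖ : ℂ) ^ 2)
  have h2 : ∀ w : ι → ℂ,
      ∑ m, ((Λ m)⁻¹ : ℂ) * (‖(Real.sqrt (Λ m) : ℂ) * w m‖ : ℂ) ^ 2 =
      ∑ m, (1 : ℂ) * (‖w m‖ : ℂ) ^ 2 := fun w => by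
    refine Finset.sum_congr rfl fun m _ => ?_
    rw [norm_mul, Complex.norm_real, Real.norm_of_nonneg (Real.sqrt_nonneg _), Complex.ofReal_mul,
      mul_pow, ← Complex.ofReal_pow, Real.sq_sqrt (hΛ m).le, ← mul_assoc, inv_mul_cancel₀]
    exact_mod_cast (hΛ m).ne'
  simp only [h2] at h1
  have hp : (∏ _m : ι, (Real.pi : ℂ)) ≠ 0 :=
    Finset.prod_ne_zero_iff.2 fun _ _ => by simp [Real.pi_ne_zero]
  rw [integral_cexp_neg_sum (b := fun _ => 1) (by simp),
    integral_cexp_neg_sum (b := fun m => ((Λ m)⁻¹ : ℂ))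
      (fun m => by simpa using inv_pos.2 (hΛ m))] at h1
  simp only [div_one, div_inv_eq_mul, Finset.prod_mul_distrib] at h1
  have h3 : (∏ m, (Λ m : ℂ)) * c = 1 := by
    apply mul_right_cancel₀ hp
    calc _ = c * ((∏ _m : ι, (Real.pi : ℂ)) * ∏ m, (Λ m : ℂ)) := by ring
      _ = _ := by rw [← h1, one_mul]
  refine ⟨fun f => ?_, fun f hf => ?_⟩
  · rw [hc, ← mul_assoc, h3, one_mul]
  · refine (hi _ hf).congr (.of_forall fun w => ?_)
    simp only
    rw [← hDm, mulVec_mulVec, hDD, one_mulVec]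

omit [DecidableEq ι] in
lemma colWeight_sqrt_mul (w : ι → ℂ) :
    colWeight Λ v (fun m => (Real.sqrt (Λ m) : ℂ) * w m) =
      hermGauss 1 (vecMulVec (fun m => (Real.sqrt (Λ m) : ℂ) * v m)
        (star fun m => (Real.sqrt (Λ m) : ℂ) * v m)) w := by
  rw [colWeight, hermGauss]
  congr 2
  · congr 1
    rw [one_mul]
    refine Finset.sum_congr rfl fun m _ => ?_
    rw [norm_mul, Complex.norm_real, Real.norm_of_nonneg (Real.sqrt_nonneg _), Complex.ofReal_mul,
      mul_pow, ← Complex.ofReal_pow, Real.sq_sqrt (hΛ m).le, ← mul_assoc, inv_mul_cancel₀, one_mul]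
    exact_mod_cast (hΛ m).ne'
  · congr 1
    set u : ι → ℂ := fun m => (Real.sqrt (Λ m) : ℂ) * v m
    have h1 : (star v ⬝ᵥ fun m => (Real.sqrt (Λ m) : ℂ) * w m) = star u ⬝ᵥ w := by
      simp [dotProduct, u, mul_comm, mul_assoc]
    rw [h1, vecMulVec_mulVec, ← Complex.conj_mul']
    have h2 : (starRingEnd ℂ) (star u ⬝ᵥ w) = star w ⬝ᵥ u := by
      rw [← Complex.star_def, star_dotProduct, star_star]
    rw [h2]
    simp [dotProduct_smul, mul_comm]

omit hΛ [Fintype ι] [DecidableEq ι] in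
lemma isHermitian_vecMulVec_star (u : ι → ℂ) : (vecMulVec u (star u)).IsHermitian := by
  rw [Matrix.IsHermitian, conjTranspose_vecMulVec, star_star]

omit [DecidableEq ι] in
lemma star_sqrt_mul_dotProduct :
    star (fun m => (Real.sqrt (Λ m) : ℂ) * v m) ⬝ᵥ (fun m => (Real.sqrt (Λ m) : ℂ) * v m) =
      quadForm Λ v := by
  rw [← sum_normSq_eq, quadForm]
  push_cast
  refine Finset.sum_congr rfl fun m _ => ?_
  rw [norm_mul, Complex.norm_real, Real.norm_of_nonneg (Real.sqrt_nonneg _), Complex.ofReal_mul,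
      mul_pow, ← Complex.ofReal_pow, Real.sq_sqrt (hΛ m).le]

lemma integrable_colWeight : Integrable (colWeight Λ v) := by
  refine (exists_sqrt_diagonal_integral hΛ).2 _ ?_
  simp_rw [colWeight_sqrt_mul hΛ]
  exact integrable_hermGauss (by simp) (isHermitian_vecMulVec_star _)

lemma integral_colWeight :
    ∫ w, colWeight Λ v w =
      (Real.pi : ℂ) ^ Fintype.card ι * (∏ m, (Λ m : ℂ)) / (1 + Complex.I * quadForm Λ v) := by
  rw [(exists_sqrt_diagonal_integral hΛ).1]
  simp_rw [colWeight_sqrt_mul hΛ]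
  rw [integral_hermGauss (by simp) (isHermitian_vecMulVec_star _), one_smul,
    ← smul_vecMulVec, det_add_vecMulVec, det_one, adjugate_one, one_mulVec, dotProduct_smul, star_sqrt_mul_dotProduct hΛ, smul_eq_mul]
  ring

lemma integral_mul_conj_mul_colWeight (i j : ι) :
    Integrable (fun w => w i * star (w j) * colWeight Λ v w) ∧
    ∫ w, w i * star (w j) * colWeight Λ v w = (∫ w, colWeight Λ v w) * colCov Λ v i j := by
  set u : ι → ℂ := fun m => (Real.sqrt (Λ m) : ℂ) * v m with hu
  have hq : star u ⬝ᵥ u = quadForm Λ v := star_sqrt_mul_dotProduct hΛ v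
  have hq0 := one_add_I_mul_ofReal_ne_zero (quadForm Λ v)
  have hS : ((1 : ℂ) • (1 : Matrix ι ι ℂ) + Complex.I • vecMulVec u (star u)) *
      (1 - (Complex.I / (1 + Complex.I * quadForm Λ v)) • vecMulVec u (star u)) = 1 := by
    rw [one_smul, Matrix.mul_sub, Matrix.mul_one, Matrix.mul_smul, Matrix.add_mul, Matrix.one_mul,
      Matrix.smul_mul, vecMulVec_mul_vecMulVec, hq]
    ext a b
    simp only [Matrix.sub_apply, Matrix.add_apply, Matrix.smul_apply, vecMulVec_apply,
      smul_eq_mul, Pi.smul_apply]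
    field_simp
    ring
  have key := integral_mul_conj_mul_hermGauss (y := 1) (by simp) (isHermitian_vecMulVec_star u)
    hS i j
  have hfun : ∀ w : ι → ℂ, ((Real.sqrt (Λ i) : ℂ) * w i) * star ((Real.sqrt (Λ j) : ℂ) * w j) *
      colWeight Λ v (fun m => (Real.sqrt (Λ m) : ℂ) * w m) =
      (Real.sqrt (Λ i) * Real.sqrt (Λ j) : ℂ) *
        (w i * star (w j) * hermGauss 1 (vecMulVec u (star u)) w) := fun w => by
    rw [colWeight_sqrt_mul hΛ, star_mul]
    simp only [Complex.star_def, Complex.conj_ofReal]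
    ring
  have hsq : ∀ m, (Real.sqrt (Λ m) : ℂ) * Real.sqrt (Λ m) = Λ m := fun m => by
    rw [← Complex.ofReal_mul, Real.mul_self_sqrt (hΛ m).le]
  constructor
  · refine (exists_sqrt_diagonal_integral hΛ).2 _ ?_
    simp_rw [hfun]
    exact key.1.const_mul _
  · rw [(exists_sqrt_diagonal_integral hΛ).1, (exists_sqrt_diagonal_integral hΛ).1 (colWeight Λ v)]
    simp_rw [hfun, colWeight_sqrt_mul hΛ]
    rw [integral_const_mul, key.2]
    have : colCov Λ v i j = (Real.sqrt (Λ i) * Real.sqrt (Λ j) : ℂ) * 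
        (1 - (Complex.I / (1 + Complex.I * quadForm Λ v)) • vecMulVec u (star u)) i j := by
      simp only [colCov, Matrix.sub_apply, Matrix.smul_apply, vecMulVec_apply, smul_eq_mul, hu,
        Pi.star_apply, star_mul, Complex.star_def, Complex.conj_ofReal]
      rw [← hsq i, ← hsq j]
      by_cases h : i = j
      · subst h; simp only [diagonal_apply_eq, one_apply_eq]; rw [← hsq i]; ring
      · simp only [diagonal_apply_ne _ h, one_apply_ne h]; ring
    rw [this]; ring

omit hΛ [DecidableEq ι] in
lemma norm_colWeight (w : ι → ℂ) :
    ‖colWeight Λ v w‖ = Real.exp (-∑ m, (Λ m)⁻¹ * ‖w m‖ ^ 2) := by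
  rw [colWeight, Complex.norm_exp]
  congr 1
  have h1 : (-∑ m, ((Λ m)⁻¹ : ℂ) * (‖w m‖ : ℂ) ^ 2 - Complex.I * (‖star v ⬝ᵥ w‖ : ℂ) ^ 2) =
    ((-∑ m, (Λ m)⁻¹ * ‖w m‖ ^ 2 : ℝ) : ℂ) - Complex.I * ((‖star v ⬝ᵥ w‖ ^ 2 : ℝ) : ℂ) := by
    push_cast; rfl
  rw [h1]
  simp only [Complex.sub_re, Complex.ofReal_re, Complex.mul_re, Complex.I_re, Complex.I_im,
    Complex.ofReal_im]
  ring

end Column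

/-- Differentiation under the integral sign for integrands that are holomorphic in the
parameter. -/
lemma hasDerivAt_integral_of_differentiableOn {α : Type*} [MeasurableSpace α] {μ : Measure α}
    {F : ℂ → α → ℂ} {z₀ : ℂ} {r : ℝ} (hr : 0 < r) {bound : α → ℝ}
    (hd : ∀ᵐ t ∂μ, DifferentiableOn ℂ (fun z => F z t) (Metric.ball z₀ r))
    (hm : ∀ z ∈ Metric.ball z₀ r, AEStronglyMeasurable (F z) μ)
    (hb : ∀ᵐ t ∂μ, ∀ z ∈ Metric.ball z₀ r, ‖F z t‖ ≤ bound t) (hbi : Integrable bound μ) :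
    HasDerivAt (fun z => ∫ t, F z t ∂μ) (∫ t, deriv (fun z => F z t) z₀ ∂μ) z₀ := by
  have hr2 : 0 < r / 2 := half_pos hr
  have hmem : z₀ ∈ Metric.ball z₀ r := Metric.mem_ball_self hr
  have hsub : ∀ z ∈ Metric.ball z₀ (r / 2), Metric.ball z (r / 2) ⊆ Metric.ball z₀ r :=
    fun z hz => Metric.ball_subset_ball' (by rw [Metric.mem_ball] at hz; linarith)
  have hderiv : ∀ᵐ t ∂μ, ∀ z ∈ Metric.ball z₀ r,
      HasDerivAt (fun z => F z t) (deriv (fun z => F z t) z) z := by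
    filter_upwards [hd] with t ht z hz
    exact (ht.differentiableAt (Metric.isOpen_ball.mem_nhds hz)).hasDerivAt
  refine (hasDerivAt_integral_of_dominated_loc_of_deriv_le (F' := fun z t => deriv (fun z => F z t) z)
    (bound := fun t => bound t / (r / 4)) (Metric.ball_mem_nhds z₀ hr2) ?_ ?_ ?_ ?_ ?_ ?_).2
  · filter_upwards [Metric.ball_mem_nhds z₀ hr] with z hz using hm z hz
  · exact hbi.mono' (hm z₀ hmem) (hb.mono fun t ht => ht z₀ hmem)
  · obtain ⟨u, hu0, hu⟩ : ∃ u : ℕ → ℂ, (∀ k, u k ≠ 0 ∧ z₀ + u k ∈ Metric.ball z₀ r) ∧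
        Filter.Tendsto u Filter.atTop (nhds 0) := by
      refine ⟨fun k => ((r / 2 * (1 / ((k : ℝ) + 1)) : ℝ) : ℂ), fun k => ⟨?_, ?_⟩, ?_⟩
      · exact Complex.ofReal_ne_zero.2 (by positivity)
      · rw [Metric.mem_ball, dist_eq_norm, add_sub_cancel_left, Complex.norm_real,
          Real.norm_of_nonneg (by positivity)]
        have : 1 / ((k : ℝ) + 1) ≤ 1 := by
          rw [div_le_one (by positivity)]; linarith [(Nat.cast_nonneg k : (0 : ℝ) ≤ k)]
        nlinarith
      · have := (tendsto_one_div_add_atTop_nhds_zero_nat (𝕜 := ℝ)).const_mul (r / 2)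
        rw [mul_zero] at this
        exact_mod_cast (Complex.continuous_ofReal.tendsto 0).comp this
    refine aestronglyMeasurable_of_tendsto_ae Filter.atTop
      (f := fun k t => (u k)⁻¹ • (F (z₀ + u k) t - F z₀ t)) (fun k => ?_) ?_
    · exact ((hm _ (hu0 k).2).sub (hm _ hmem)).const_smul (u k)⁻¹
    · filter_upwards [hderiv] with t ht
      refine (ht z₀ hmem).tendsto_slope_zero.comp ?_
      exact tendsto_nhdsWithin_of_tendsto_nhds_of_eventually_within _ hu
        (.of_forall fun k => (hu0 k).1)
  · filter_upwards [hd, hb] with t ht hbt z hz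
    refine Complex.norm_deriv_le_of_forall_mem_sphere_norm_le (by positivity) ?_ fun w hw =>
      hbt w (hsub z hz (Metric.mem_ball.2 (by
        rw [Metric.mem_sphere] at hw; rw [hw]; linarith)))
    refine DifferentiableOn.diffContOnCl (ht.mono fun w hw => hsub z hz ?_)
    rw [closure_ball _ (by positivity), Metric.mem_closedBall] at hw
    exact Metric.mem_ball.2 (by linarith)
  · exact hbi.div_const _
  · filter_upwards [hderiv] with t ht z hz
    exact ht z (hsub z₀ (Metric.mem_ball_self hr2) hz)

section Bound
variable {ι : Type*} [Fintype ι] [DecidableEq ι]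

omit [DecidableEq ι] in
lemma norm_vecMulVec_star_apply_le (w : ι → ℂ) (i j : ι) :
    ‖vecMulVec w (star w) i j‖ ≤ ∑ m, ‖w m‖ ^ 2 := by
  rw [vecMulVec_apply, norm_mul, Pi.star_apply, norm_star]
  have hi := Finset.single_le_sum (f := fun m => ‖w m‖ ^ 2) (fun m _ => by positivity)
    (Finset.mem_univ i)
  have hj := Finset.single_le_sum (f := fun m => ‖w m‖ ^ 2) (fun m _ => by positivity)
    (Finset.mem_univ j)
  nlinarith [sq_nonneg (‖w i‖ - ‖w j‖)]

/-- Polynomial growth of the determinant of a sample covariance matrix. -/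
lemma exists_norm_det_le (M N : Matrix ι ι ℂ) (b : ℂ) (R : ℝ) (n : ℕ) {c : ℝ} (hc : 0 < c) :
    ∃ K : ℝ, 0 ≤ K ∧ ∀ s : ℂ, ‖s‖ ≤ R → ∀ W : Fin n → ι → ℂ,
      ‖(M - b • ∑ a, vecMulVec (W a) (star (W a)) + s • N).det‖ ≤
        K * Real.exp (c * ∑ a, ∑ m, ‖W a m‖ ^ 2) := by
  obtain ⟨K, hK, h⟩ := exists_pow_le_mul_exp (Fintype.card ι) hc
  set C : ℝ := (∑ i, ∑ j, ‖M i j‖) + |R| * (∑ i, ∑ j, ‖N i j‖) + ‖b‖ with hC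
  have hC0 : 0 ≤ C := by positivity
  refine ⟨(Fintype.card ι).factorial * C ^ Fintype.card ι * K, by positivity, fun s hs W => ?_⟩
  set S := ∑ a, ∑ m, ‖W a m‖ ^ 2 with hS
  have hS0 : 0 ≤ S := by positivity
  have hent : ∀ (A : Matrix ι ι ℂ) i j, ‖A i j‖ ≤ ∑ i, ∑ j, ‖A i j‖ := fun A i j =>
    (Finset.single_le_sum (f := fun j => ‖A i j‖) (fun _ _ => norm_nonneg _)
      (Finset.mem_univ j)).trans
      (Finset.single_le_sum (f := fun i => ∑ j, ‖A i j‖) (fun _ _ => by positivity)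
        (Finset.mem_univ i))
  have hle : ∀ i j, ‖(M - b • ∑ a, vecMulVec (W a) (star (W a)) + s • N) i j‖ ≤ C * (1 + S) :=
      fun i j => by
    have h1 : ‖(∑ a, vecMulVec (W a) (star (W a))) i j‖ ≤ S := by
      rw [Matrix.sum_apply]
      exact (norm_sum_le _ _).trans (Finset.sum_le_sum fun a _ => norm_vecMulVec_star_apply_le _ _ _)
    have h2 := hent M i j
    have h3 := hent N i j
    have h4 : ‖s‖ * ‖N i j‖ ≤ |R| * ∑ i, ∑ j, ‖N i j‖ := by
      gcongr
      exact hs.trans (le_abs_self R)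
    have h5 : ‖b‖ * ‖(∑ a, vecMulVec (W a) (star (W a))) i j‖ ≤ ‖b‖ * S := by gcongr
    calc _ ≤ ‖M i j‖ + ‖b‖ * ‖(∑ a, vecMulVec (W a) (star (W a))) i j‖ + ‖s‖ * ‖N i j‖ := by
          rw [Matrix.add_apply, Matrix.sub_apply, Matrix.smul_apply, Matrix.smul_apply,
            smul_eq_mul, smul_eq_mul, ← norm_mul, ← norm_mul]
          exact (norm_add_le _ _).trans (by gcongr; exact norm_sub_le _ _)
      _ ≤ (∑ i, ∑ j, ‖M i j‖) + ‖b‖ * S + |R| * (∑ i, ∑ j, ‖N i j‖) := by gcongr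
      _ ≤ C * (1 + S) := by
        have : 0 ≤ ∑ i, ∑ j, ‖M i j‖ := by positivity
        have : 0 ≤ |R| * ∑ i, ∑ j, ‖N i j‖ := by positivity
        rw [hC]
        nlinarith [norm_nonneg b]
  have h6 : ‖(M - b • ∑ a, vecMulVec (W a) (star (W a)) + s • N).det‖ ≤
      (Fintype.card ι).factorial • (C * (1 + S)) ^ Fintype.card ι :=
    Matrix.det_le (abv := IsAbsoluteValue.toAbsoluteValue (norm : ℂ → ℝ)) hle
  refine h6.trans ?_
  rw [nsmul_eq_mul, mul_pow]
  have := h S hS0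
  calc _ ≤ ((Fintype.card ι).factorial : ℝ) * (C ^ Fintype.card ι * (K * Real.exp (c * S))) := by
        gcongr
    _ = _ := by ring

end Bound

section Wishart
variable {ι : Type*} [Fintype ι] [DecidableEq ι]

/-- The entire function `e^{-ixs} det(M + sN)`. -/
noncomputable def detExp (x : ℂ) (N M : Matrix ι ι ℂ) (s : ℂ) : ℂ :=
  Complex.exp (-(Complex.I * x * s)) * (M + s • N).det

lemma hasDerivAt_detExp (x : ℂ) (N M : Matrix ι ι ℂ) (s : ℂ) :
    HasDerivAt (detExp x N M) (Complex.exp (-(Complex.I * x * s)) *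
      (-(Complex.I * x) * (M + s • N).det + ((M + s • N).adjugate * N).trace)) s := by
  have h1 : HasDerivAt (fun s : ℂ => -(Complex.I * x * s)) (-(Complex.I * x)) s := by
    simpa using ((hasDerivAt_id s).const_mul (-(Complex.I * x)))
  refine (h1.cexp.mul (hasDerivAt_det_add_smul M N s)).congr_deriv ?_
  ring

lemma differentiable_detExp (x : ℂ) (N M : Matrix ι ι ℂ) : Differentiable ℂ (detExp x N M) :=
  fun s => (hasDerivAt_detExp x N M s).differentiableAt

variable {k : (ι → ℂ) → ℂ} {Z : ℂ} {Sg : Matrix ι ι ℂ} {c : ℝ} {x b : ℂ}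

omit [DecidableEq ι] in
lemma integrable_exp_neg_sum_sum (n : ℕ) (hc : 0 < c) :
    Integrable fun W : Fin n → ι → ℂ => Real.exp (-(c * ∑ a, ∑ m, ‖W a m‖ ^ 2)) := by
  have h1 : Integrable fun w : ι → ℂ => Real.exp (-(c * ∑ m, ‖w m‖ ^ 2)) := by
    refine (integrable_cexp_neg_sum (b := fun _ : ι => (c : ℂ)) (fun _ => by simpa using hc)).norm.congr
      (.of_forall fun w => ?_)
    simp only
    rw [← Finset.mul_sum, Complex.norm_exp]
    norm_cast
  have h2 := Integrable.fintype_prod (ι := Fin n)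
    (f := fun _ (w : ι → ℂ) => Real.exp (-(c * ∑ m, ‖w m‖ ^ 2))) fun _ => h1
  refine h2.congr (.of_forall fun W => ?_)
  simp only
  rw [← Real.exp_sum, Finset.sum_neg_distrib, Finset.mul_sum]

omit [DecidableEq ι] in
lemma norm_prod_le_exp_neg {n : ℕ} (hle : ∀ w, ‖k w‖ ≤ Real.exp (-((c + c) * ∑ m, ‖w m‖ ^ 2)))
    (W : Fin n → ι → ℂ) :
    ‖∏ a, k (W a)‖ ≤ Real.exp (-((c + c) * ∑ a, ∑ m, ‖W a m‖ ^ 2)) := by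
  rw [norm_prod]
  refine (Finset.prod_le_prod (fun _ _ => norm_nonneg _) fun a _ => hle (W a)).trans_eq ?_
  rw [← Real.exp_sum, Finset.sum_neg_distrib, Finset.mul_sum]

lemma exists_norm_detExp_mul_le (hc : 0 < c)
    (hle : ∀ w, ‖k w‖ ≤ Real.exp (-((c + c) * ∑ m, ‖w m‖ ^ 2)))
    (n : ℕ) (x b : ℂ) (N M : Matrix ι ι ℂ) (R : ℝ) :
    ∃ bound : (Fin n → ι → ℂ) → ℝ, Integrable bound ∧ ∀ s : ℂ, ‖s‖ ≤ R → ∀ W,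
      ‖detExp x N (M - b • ∑ a, vecMulVec (W a) (star (W a))) s * ∏ a, k (W a)‖ ≤ bound W := by
  obtain ⟨K, hK, h⟩ := exists_norm_det_le M N b R n hc
  refine ⟨fun W => Real.exp (‖x‖ * R) * K * Real.exp (-(c * ∑ a, ∑ m, ‖W a m‖ ^ 2)),
    (integrable_exp_neg_sum_sum n hc).const_mul _, fun s hs W => ?_⟩
  have h1 : ‖Complex.exp (-(Complex.I * x * s))‖ ≤ Real.exp (‖x‖ * R) := by
    rw [Complex.norm_exp, Real.exp_le_exp]
    refine (Complex.re_le_norm _).trans ?_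
    rw [norm_neg, norm_mul, norm_mul, Complex.norm_I, one_mul]
    gcongr
  have h2 := h s hs W
  have h3 := norm_prod_le_exp_neg (n := n) hle W
  rw [detExp, norm_mul, norm_mul]
  calc _ ≤ Real.exp (‖x‖ * R) * (K * Real.exp (c * ∑ a, ∑ m, ‖W a m‖ ^ 2)) *
        Real.exp (-((c + c) * ∑ a, ∑ m, ‖W a m‖ ^ 2)) := by gcongr
    _ = Real.exp (‖x‖ * R) * K * (Real.exp (c * ∑ a, ∑ m, ‖W a m‖ ^ 2) *
        Real.exp (-((c + c) * ∑ a, ∑ m, ‖W a m‖ ^ 2))) := by ring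
    _ = _ := by rw [← Real.exp_add]; congr 2; ring

lemma aestronglyMeasurable_detExp_mul (hk : Continuous k) (n : ℕ) (x b : ℂ) (N M : Matrix ι ι ℂ)
    (s : ℂ) : AEStronglyMeasurable fun W : Fin n → ι → ℂ =>
      detExp x N (M - b • ∑ a, vecMulVec (W a) (star (W a))) s * ∏ a, k (W a) := by
  refine Continuous.aestronglyMeasurable ?_
  unfold detExp
  fun_prop

lemma integrable_detExp_mul (hc : 0 < c) (hk : Continuous k)
    (hle : ∀ w, ‖k w‖ ≤ Real.exp (-((c + c) * ∑ m, ‖w m‖ ^ 2)))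
    (n : ℕ) (x b : ℂ) (N M : Matrix ι ι ℂ) (s : ℂ) :
    Integrable fun W : Fin n → ι → ℂ =>
      detExp x N (M - b • ∑ a, vecMulVec (W a) (star (W a))) s * ∏ a, k (W a) := by
  obtain ⟨B, hB, h⟩ := exists_norm_detExp_mul_le hc hle n x b N M ‖s‖
  exact hB.mono' (aestronglyMeasurable_detExp_mul hk n x b N M s) (.of_forall (h s le_rfl))

lemma integral_detExp_mul_column (hki : Integrable k) (hZ : ∫ w, k w = Z)
    (hmom : ∀ i j, Integrable (fun w => w i * star (w j) * k w) ∧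
      ∫ w, w i * star (w j) * k w = Z * Sg i j)
    (hbx : b * x = 1) (M : Matrix ι ι ℂ) (s : ℂ) :
    ∫ w, detExp x (Complex.I • Sg) (M - b • vecMulVec w (star w)) s * k w =
      Z * Complex.I * b * deriv (detExp x (Complex.I • Sg) M) s := by
  set A := M + s • (Complex.I • Sg) with hA
  set E := Complex.exp (-(Complex.I * x * s)) with hE
  have h1 : ∀ w : ι → ℂ, detExp x (Complex.I • Sg) (M - b • vecMulVec w (star w)) s * k w =
      E * A.det * k w - E * b * ∑ i, ∑ j, A.adjugate i j * (w j * star (w i) * k w) := fun w => by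
    have h2 : M - b • vecMulVec w (star w) + s • (Complex.I • Sg) =
        A + vecMulVec (-b • w) (star w) := by
      rw [smul_vecMulVec, neg_smul, hA]; abel
    rw [detExp, h2, det_add_vecMulVec, mulVec_smul, dotProduct_smul, smul_eq_mul]
    have h3 : star w ⬝ᵥ A.adjugate *ᵥ w * k w =
        ∑ i, ∑ j, A.adjugate i j * (w j * star (w i) * k w) := by
      simp only [dotProduct, mulVec, Finset.sum_mul, Finset.mul_sum, Pi.star_apply]
      exact Finset.sum_congr rfl fun i _ => Finset.sum_congr rfl fun j _ => by ring
    rw [← h3]; ring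
  have hint : ∀ i j, Integrable fun w : ι → ℂ => A.adjugate i j * (w j * star (w i) * k w) :=
    fun i j => (hmom j i).1.const_mul _
  have hint2 := fun i => integrable_finsetSum Finset.univ fun j _ => hint i j
  simp_rw [h1]
  rw [integral_sub (hki.const_mul _) ((integrable_finsetSum _ fun i _ => hint2 i).const_mul _),
    integral_const_mul, integral_const_mul, integral_finsetSum _ fun i _ => hint2 i]
  simp_rw [integral_finsetSum Finset.univ fun j _ => hint _ j, integral_const_mul, (hmom _ _).2]
  rw [(hasDerivAt_detExp x (Complex.I • Sg) M s).deriv, hZ, ← hA, ← hE]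
  have h4 : (A.adjugate * (Complex.I • Sg)).trace =
      Complex.I * ∑ i, ∑ j, A.adjugate i j * Sg j i := by
    rw [Matrix.mul_smul, trace_smul, smul_eq_mul]
    simp only [trace, diag_apply, Matrix.mul_apply]
  have h5 : ∑ i, ∑ j, A.adjugate i j * (Z * Sg j i) = Z * ∑ i, ∑ j, A.adjugate i j * Sg j i := by
    simp only [Finset.mul_sum]
    exact Finset.sum_congr rfl fun i _ => Finset.sum_congr rfl fun j _ => by ring
  rw [h4, h5]
  have hI := Complex.I_mul_I
  linear_combination (-(E * Z * A.det)) * hbx + (E * Z * A.det * b * x -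
    E * Z * b * ∑ i, ∑ j, A.adjugate i j * Sg j i) * hI

lemma hasDerivAt_integral_detExp_mul (hc : 0 < c) (hk : Continuous k)
    (hle : ∀ w, ‖k w‖ ≤ Real.exp (-((c + c) * ∑ m, ‖w m‖ ^ 2)))
    (n : ℕ) (x b : ℂ) (N M : Matrix ι ι ℂ) (s : ℂ) :
    HasDerivAt (fun s => ∫ W : Fin n → ι → ℂ,
      detExp x N (M - b • ∑ a, vecMulVec (W a) (star (W a))) s * ∏ a, k (W a))
      (∫ W : Fin n → ι → ℂ, deriv (fun s =>
        detExp x N (M - b • ∑ a, vecMulVec (W a) (star (W a))) s * ∏ a, k (W a)) s) s := by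
  obtain ⟨B, hB, hB'⟩ := exists_norm_detExp_mul_le hc hle n x b N M (‖s‖ + 1)
  refine hasDerivAt_integral_of_differentiableOn one_pos (bound := B)
    (.of_forall fun W => ?_) (fun z _ => aestronglyMeasurable_detExp_mul hk n x b N M z)
    (.of_forall fun W z hz => hB' z ?_ W) hB
  · exact ((differentiable_detExp _ _ _).mul_const _).differentiableOn
  · rw [Metric.mem_ball, dist_eq_norm] at hz
    linarith [norm_le_norm_add_norm_sub' z s]

lemma integral_detExp_mul_prod (hc : 0 < c) (hk : Continuous k)
    (hle : ∀ w, ‖k w‖ ≤ Real.exp (-((c + c) * ∑ m, ‖w m‖ ^ 2)))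
    (hki : Integrable k) (hZ : ∫ w, k w = Z)
    (hmom : ∀ i j, Integrable (fun w => w i * star (w j) * k w) ∧
      ∫ w, w i * star (w j) * k w = Z * Sg i j)
    (hbx : b * x = 1) (M : Matrix ι ι ℂ) (n : ℕ) (s : ℂ) :
    ∫ W : Fin n → ι → ℂ, detExp x (Complex.I • Sg)
        (M - b • ∑ a, vecMulVec (W a) (star (W a))) s * ∏ a, k (W a) =
      (Z * Complex.I * b) ^ n * iteratedDeriv n (detExp x (Complex.I • Sg) M) s := by
  induction n generalizing s with
  | zero =>
    rw [volume_pi, Measure.pi_of_empty _ isEmptyElim, integral_dirac]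
    simp
  | succ n ih =>
    set N := Complex.I • Sg with hN
    have hmp := volume_preserving_piFinSuccAbove (fun _ : Fin (n + 1) => ι → ℂ) 0
    set G : (ι → ℂ) × (Fin n → ι → ℂ) → ℂ := fun q =>
      detExp x N (M - b • ∑ a, vecMulVec (q.2 a) (star (q.2 a)) -
        b • vecMulVec q.1 (star q.1)) s * k q.1 * ∏ a, k (q.2 a) with hG
    have hGe : ∀ W : Fin (n + 1) → ι → ℂ, detExp x N
        (M - b • ∑ a, vecMulVec (W a) (star (W a))) s * ∏ a, k (W a) =
        G (MeasurableEquiv.piFinSuccAbove (fun _ : Fin (n + 1) => ι → ℂ) 0 W) := fun W => by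
      simp only [hG, MeasurableEquiv.piFinSuccAbove_apply, Fin.insertNthEquiv_zero,
        Fin.consEquiv_symm_apply, Fin.sum_univ_succ, Fin.prod_univ_succ, Fin.tail]
      rw [smul_add, ← mul_assoc, sub_sub, add_comm (b • vecMulVec _ _)]
    have hGi : Integrable G := by
      have := integrable_detExp_mul hc hk hle (n + 1) x b N M s
      simp_rw [hGe] at this
      exact (hmp.integrable_comp_emb (MeasurableEquiv.measurableEmbedding _)).1 this
    simp_rw [hGe]
    rw [hmp.integral_comp', Measure.volume_eq_prod, integral_prod_symm _ hGi]
    have hcol : ∀ W : Fin n → ι → ℂ, ∫ w, G (w, W) = Z * Complex.I * b *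
        deriv (fun s => detExp x N (M - b • ∑ a, vecMulVec (W a) (star (W a))) s *
          ∏ a, k (W a)) s := fun W => by
      simp only [hG]
      rw [integral_mul_const, integral_detExp_mul_column hki hZ hmom hbx, deriv_mul_const
        (differentiable_detExp _ _ _ _)]
      ring
    simp_rw [hcol]
    rw [integral_const_mul]
    have hd := hasDerivAt_integral_detExp_mul hc hk hle n x b N M s
    simp_rw [ih] at hd
    rw [← hd.deriv, deriv_const_mul_field, iteratedDeriv_succ]
    ring

end Wishart

section Coeff
variable {p : ℕ} {Λ : Fin p → ℝ} {x : ℂ}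

/-- `g_Λ(x;·)` with the factor `1 + isΛ_j` removed. -/
noncomputable def gErase (Λ : Fin p → ℝ) (x : ℂ) (j : Fin p) (s : ℂ) : ℂ :=
  Complex.exp (-(Complex.I * x * s)) * ∏ l ∈ Finset.univ.erase j, (1 + Complex.I * s * (Λ l : ℂ))

/-- Taylor coefficients of `gErase` at `0`. -/
noncomputable def gEraseCoeff (Λ : Fin p → ℝ) (x : ℂ) (j : Fin p) (k : ℕ) : ℂ :=
  iteratedDeriv k (gErase Λ x j) 0 / (Nat.factorial k)

lemma contDiff_gErase (Λ : Fin p → ℝ) (x : ℂ) (j : Fin p) {m : ℕ} :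
    ContDiff ℂ m (gErase Λ x j) := by
  unfold gErase
  fun_prop

lemma contDiff_gFun (Λ : Fin p → ℝ) (x : ℂ) {m : ℕ} : ContDiff ℂ m (gFun Λ x) := by
  unfold gFun
  fun_prop

lemma gFun_eq_mul_gErase (Λ : Fin p → ℝ) (x : ℂ) (j : Fin p) (s : ℂ) :
    gFun Λ x s = (1 + Complex.I * s * Λ j) * gErase Λ x j s := by
  rw [gFun, gErase, ← Finset.mul_prod_erase Finset.univ _ (Finset.mem_univ j)]
  ring

lemma hasDerivAt_gFun (Λ : Fin p → ℝ) (x s : ℂ) :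
    HasDerivAt (gFun Λ x) (-(Complex.I * x) * gFun Λ x s +
      ∑ j, Complex.I * Λ j * gErase Λ x j s) s := by
  have h1 : HasDerivAt (fun s : ℂ => -(Complex.I * x * s)) (-(Complex.I * x)) s := by
    simpa using ((hasDerivAt_id s).const_mul (-(Complex.I * x)))
  have h2 : ∀ j ∈ Finset.univ, HasDerivAt (fun s : ℂ => 1 + Complex.I * s * (Λ j : ℂ))
      (Complex.I * Λ j) s := fun j _ => by
    simpa using (((hasDerivAt_id s).const_mul Complex.I).mul_const (Λ j : ℂ)).const_add 1
  refine (h1.cexp.mul (HasDerivAt.fun_finsetProd h2)).congr_deriv ?_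
  rw [gFun, Finset.mul_sum]
  congr 1
  · ring
  · refine Finset.sum_congr rfl fun j _ => ?_
    rw [gErase, smul_eq_mul]
    ring

lemma iteratedDeriv_succ_id_mul {f : ℂ → ℂ} {k : ℕ} (hf : ContDiff ℂ (k + 1 : ℕ) f) :
    iteratedDeriv (k + 1) (fun s => s * f s) 0 = (k + 1) * iteratedDeriv k f 0 := by
  rw [iteratedDeriv_fun_mul contDiff_fun_id.contDiffAt hf.contDiffAt,
    Finset.sum_eq_single 1]
  · rw [iteratedDeriv_fun_id_zero]
    simp
  · intro i _ hi
    simp [iteratedDeriv_fun_id_zero, hi]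
  · simp

lemma gCoeff_zero (Λ : Fin p → ℝ) (x : ℂ) : gCoeff Λ x 0 = 1 := by
  simp [gCoeff, gFun]

lemma gEraseCoeff_zero (Λ : Fin p → ℝ) (x : ℂ) (j : Fin p) : gEraseCoeff Λ x j 0 = 1 := by
  simp [gEraseCoeff, gErase]

lemma gCoeff_succ_eq (Λ : Fin p → ℝ) (x : ℂ) (j : Fin p) (k : ℕ) :
    gCoeff Λ x (k + 1) = gEraseCoeff Λ x j (k + 1) +
      Complex.I * Λ j * gEraseCoeff Λ x j k := by
  have h1 : gFun Λ x = fun s => gErase Λ x j s + Complex.I * Λ j * (s * gErase Λ x j s) := by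
    ext s; rw [gFun_eq_mul_gErase Λ x j]; ring
  have h2 : ContDiff ℂ (k + 1 : ℕ) (gErase Λ x j) := contDiff_gErase Λ x j
  rw [gCoeff, h1, iteratedDeriv_fun_add h2.contDiffAt
    (contDiff_const.mul (contDiff_fun_id.mul h2)).contDiffAt, iteratedDeriv_const_mul_field,
    iteratedDeriv_succ_id_mul h2, gEraseCoeff, gEraseCoeff, Nat.factorial_succ]
  have : (k.factorial : ℂ) ≠ 0 := by exact_mod_cast k.factorial_ne_zero
  have : (k : ℂ) + 1 ≠ 0 := by exact_mod_cast k.succ_ne_zero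
  push_cast
  field_simp

lemma succ_mul_gCoeff_succ (Λ : Fin p → ℝ) (x : ℂ) (k : ℕ) :
    (k + 1) * gCoeff Λ x (k + 1) = -(Complex.I * x) * gCoeff Λ x k +
      ∑ j, Complex.I * Λ j * gEraseCoeff Λ x j k := by
  have h1 : deriv (gFun Λ x) = fun s => -(Complex.I * x) * gFun Λ x s +
      ∑ j, Complex.I * Λ j * gErase Λ x j s := funext fun s => (hasDerivAt_gFun Λ x s).deriv
  have h2 : ContDiff ℂ k (gFun Λ x) := contDiff_gFun Λ x
  have h3 : ∀ j, ContDiff ℂ k (gErase Λ x j) := fun j => contDiff_gErase Λ x j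
  rw [gCoeff, iteratedDeriv_succ', h1, iteratedDeriv_fun_add
    (contDiff_const.mul h2).contDiffAt
    (ContDiff.sum fun j _ => contDiff_const.mul (h3 j)).contDiffAt,
    iteratedDeriv_const_mul_field,
    iteratedDeriv_fun_sum fun j _ => (contDiff_const.mul (h3 j)).contDiffAt]
  simp_rw [iteratedDeriv_const_mul_field]
  have : (k.factorial : ℂ) ≠ 0 := by exact_mod_cast k.factorial_ne_zero
  have : (k : ℂ) + 1 ≠ 0 := by exact_mod_cast k.succ_ne_zero
  simp only [gCoeff, gEraseCoeff, Nat.factorial_succ]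
  push_cast
  simp_rw [mul_div_assoc', ← Finset.sum_div]
  field_simp

lemma detExp_colCov (Λ : Fin p → ℝ) (v : Fin p → ℂ) (x s : ℂ) :
    detExp x (Complex.I • colCov Λ v) 1 s = gFun Λ x s +
      ∑ j, (Λ j : ℂ) ^ 2 * (‖v j‖ : ℂ) ^ 2 / (1 + Complex.I * quadForm Λ v) *
        (s * gErase Λ x j s) := by
  have h1 : (1 : Matrix (Fin p) (Fin p) ℂ) + s • (Complex.I • colCov Λ v) =
      diagonal (fun m => 1 + Complex.I * s * (Λ m : ℂ)) +
      vecMulVec ((s / (1 + Complex.I * quadForm Λ v)) • fun m => (Λ m : ℂ) * v m)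
        (fun m => (Λ m : ℂ) * star (v m)) := by
    ext i j
    simp only [colCov, Matrix.add_apply, Matrix.smul_apply, Matrix.sub_apply, smul_eq_mul,
      vecMulVec_apply, Pi.smul_apply]
    have hI := Complex.I_mul_I
    have hI' : Complex.I ^ 2 = -1 := Complex.I_sq
    by_cases h : i = j
    · subst h
      simp only [one_apply_eq, diagonal_apply_eq]
      linear_combination (-(s / (1 + Complex.I * quadForm Λ v) *
        ((Λ i : ℂ) * v i * ((Λ i : ℂ) * star (v i))))) * hI
    · simp only [one_apply_ne h, diagonal_apply_ne _ h]
      linear_combination (-(s / (1 + Complex.I * quadForm Λ v) *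
        ((Λ i : ℂ) * v i * ((Λ j : ℂ) * star (v j))))) * hI
  rw [detExp, h1, det_add_vecMulVec, det_diagonal, adjugate_diagonal, mul_add, gFun]
  congr 1
  simp only [dotProduct, mulVec_diagonal, Finset.mul_sum, Pi.smul_apply, smul_eq_mul, gErase]
  refine Finset.sum_congr rfl fun j _ => ?_
  rw [← Complex.conj_mul', Complex.star_def]
  ring

lemma iteratedDeriv_detExp_colCov (Λ : Fin p → ℝ) (v : Fin p → ℂ) (x : ℂ) (k : ℕ) :
    iteratedDeriv (k + 1) (detExp x (Complex.I • colCov Λ v) 1) 0 =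
      (k + 1).factorial * (gCoeff Λ x (k + 1) +
      ∑ j, (Λ j : ℂ) ^ 2 * (‖v j‖ : ℂ) ^ 2 / (1 + Complex.I * quadForm Λ v) *
        gEraseCoeff Λ x j k) := by
  have h1 := funext (detExp_colCov Λ v x)
  have h2 : ContDiff ℂ (k + 1 : ℕ) (gFun Λ x) := contDiff_gFun Λ x
  have h3 : ∀ j, ContDiff ℂ (k + 1 : ℕ) (gErase Λ x j) := fun j => contDiff_gErase Λ x j
  have h4 : ∀ j, ContDiff ℂ (k + 1 : ℕ) fun s => s * gErase Λ x j s :=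
    fun j => contDiff_id.mul (h3 j)
  rw [h1, iteratedDeriv_fun_add h2.contDiffAt
    (ContDiff.sum fun j _ => contDiff_const.mul (h4 j)).contDiffAt,
    iteratedDeriv_fun_sum fun j _ => (contDiff_const.mul (h4 j)).contDiffAt]
  simp_rw [iteratedDeriv_const_mul_field, iteratedDeriv_succ_id_mul (h3 _)]
  have : (k.factorial : ℂ) ≠ 0 := by exact_mod_cast k.factorial_ne_zero
  have : (k : ℂ) + 1 ≠ 0 := by exact_mod_cast k.succ_ne_zero
  simp only [gCoeff, gEraseCoeff, Nat.factorial_succ]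
  push_cast
  rw [mul_add, Finset.mul_sum]
  congr 1
  · field_simp
  · refine Finset.sum_congr rfl fun j _ => ?_
    field_simp

lemma continuous_colWeight (Λ : Fin p → ℝ) (v : Fin p → ℂ) : Continuous (colWeight Λ v) := by
  unfold colWeight
  fun_prop

lemma exists_norm_colWeight_le (hΛ : ∀ j, 0 < Λ j) : ∃ c : ℝ, 0 < c ∧ ∀ v w : Fin p → ℂ,
    ‖colWeight Λ v w‖ ≤ Real.exp (-((c + c) * ∑ m, ‖w m‖ ^ 2)) := by
  have h0 : 0 ≤ ∑ m, Λ m := Finset.sum_nonneg fun m _ => (hΛ m).le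
  refine ⟨(1 + ∑ m, Λ m)⁻¹ / 2, by positivity, fun v w => ?_⟩
  rw [norm_colWeight, Real.exp_le_exp, neg_le_neg_iff, add_halves, Finset.mul_sum]
  refine Finset.sum_le_sum fun m _ => ?_
  have := hΛ m
  have := Finset.single_le_sum (f := Λ) (fun m _ => (hΛ m).le) (Finset.mem_univ m)
  gcongr
  linarith

lemma integral_det_mul_prod_colWeight (hΛ : ∀ j, 0 < Λ j) (v : Fin p → ℂ) {b : ℂ}
    (hbx : b * x = 1) (k : ℕ) :
    ∫ W : Fin (k + 1) → Fin p → ℂ, (1 - b • ∑ a, vecMulVec (W a) (star (W a))).det *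
        ∏ a, colWeight Λ v (W a) =
      ((Real.pi : ℂ) ^ p * (∏ m, (Λ m : ℂ)) * Complex.I * b) ^ (k + 1) * (k + 1).factorial *
      ((1 + Complex.I * quadForm Λ v)⁻¹ ^ (k + 1) * gCoeff Λ x (k + 1) +
      ∑ j, (Λ j : ℂ) ^ 2 * gEraseCoeff Λ x j k *
        ((‖v j‖ : ℂ) ^ 2 * (1 + Complex.I * quadForm Λ v)⁻¹ ^ (k + 2))) := by
  obtain ⟨c, hc, hle⟩ := exists_norm_colWeight_le hΛ
  have h := integral_detExp_mul_prod hc (continuous_colWeight Λ v) (hle v)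
    (integrable_colWeight hΛ v) (integral_colWeight hΛ v)
    (fun i j => by rw [← integral_colWeight hΛ v]; exact integral_mul_conj_mul_colWeight hΛ v i j)
    hbx 1 (k + 1) 0
  simp only [detExp, mul_zero, neg_zero, Complex.exp_zero, one_mul, zero_smul, add_zero] at h
  rw [h]
  change _ * iteratedDeriv (k + 1) (detExp x (Complex.I • colCov Λ v) 1) 0 = _
  rw [iteratedDeriv_detExp_colCov, Fintype.card_fin, mul_add, mul_add, mul_add, Finset.mul_sum,
    Finset.mul_sum, Finset.mul_sum]
  congr 1
  · rw [div_eq_mul_inv]; ring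
  · refine Finset.sum_congr rfl fun j _ => ?_
    simp only [div_eq_mul_inv]; ring

end Coeff

lemma integrableOn_pow_mul_exp_neg (k : ℕ) {c : ℝ} (hc : 0 < c) :
    IntegrableOn (fun r : ℝ => r ^ k * Real.exp (-(c * r))) (Set.Ioi 0) := by
  refine (integrableOn_rpow_mul_exp_neg_mul_rpow (s := k) (p := 1) (by
    have : (0 : ℝ) ≤ k := k.cast_nonneg
    linarith) one_pos hc).congr_fun (fun r _ => ?_) measurableSet_Ioi
  simp

section Rotation
variable {ι : Type*} [Fintype ι] (μ : ι → ℝ) (k : ℕ)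

lemma re_le_norm_add_I_mul (y : ℂ) (t : ℝ) : y.re ≤ ‖y + Complex.I * t‖ := by
  refine le_trans (by simp) (Complex.re_le_norm _)

lemma differentiableAt_integral_prod_inv_add {y : ℂ} (hy : 0 < y.re) :
    DifferentiableAt ℂ (fun y : ℂ => ∫ t in Set.Ioi (0 : ℝ), (t : ℂ) ^ k * Complex.exp (-t) *
      ∏ j, (y + Complex.I * (t * μ j : ℝ))⁻¹) y := by
  have hy2 := half_pos hy
  have hre : ∀ z ∈ Metric.ball y (y.re / 2), y.re / 2 ≤ z.re := fun z hz => by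
    rw [Metric.mem_ball, dist_eq_norm] at hz
    have := (Complex.abs_re_le_norm (z - y)).trans hz.le
    rw [Complex.sub_re, abs_le] at this
    linarith
  have hne : ∀ z ∈ Metric.ball y (y.re / 2), ∀ t : ℝ, z + Complex.I * t ≠ 0 := fun z hz t h => by
    have := (hre z hz).trans (re_le_norm_add_I_mul z t)
    rw [h, norm_zero] at this
    linarith
  refine (hasDerivAt_integral_of_differentiableOn hy2
    (bound := fun t : ℝ => t ^ k * Real.exp (-(1 * t)) * (y.re / 2)⁻¹ ^ Fintype.card ι)
    (.of_forall fun t z hz => ?_) (fun z hz => ?_) ?_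
    ((integrableOn_pow_mul_exp_neg k one_pos).mul_const _)).differentiableAt
  · refine DifferentiableAt.differentiableWithinAt ?_
    refine (DifferentiableAt.fun_finsetProd fun j _ => ?_).const_mul _
    exact (differentiableAt_id.add_const _).inv (hne z hz _)
  · refine Continuous.aestronglyMeasurable ?_
    refine Continuous.mul (by fun_prop) (continuous_finsetProd _ fun j _ => ?_)
    exact Continuous.inv₀ (by fun_prop) fun t => hne z hz _
  · filter_upwards [ae_restrict_mem measurableSet_Ioi] with t ht z hz
    rw [Set.mem_Ioi] at ht
    rw [norm_mul, norm_mul, norm_pow, Complex.norm_real, Real.norm_of_nonneg ht.le, one_mul,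
      Complex.norm_exp, norm_prod, Complex.neg_re, Complex.ofReal_re]
    gcongr
    rw [← Finset.card_univ, ← Finset.prod_const]
    refine Finset.prod_le_prod (fun _ _ => norm_nonneg _) fun j _ => ?_
    rw [norm_inv]
    exact inv_anti₀ hy2 ((hre z hz).trans (re_le_norm_add_I_mul _ _))

lemma norm_prod_inv_one_add_le_one (r : ℝ) : ‖∏ j, (1 + Complex.I * (r * μ j : ℝ))⁻¹‖ ≤ 1 := by
  rw [norm_prod]
  refine Finset.prod_le_one (fun _ _ => norm_nonneg _) fun j _ => ?_
  rw [norm_inv]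
  exact inv_le_one_of_one_le₀ (re_le_norm_add_I_mul 1 _)

lemma continuous_prod_inv_one_add :
    Continuous fun r : ℝ => ∏ j, (1 + Complex.I * (r * μ j : ℝ))⁻¹ :=
  continuous_finsetProd _ fun _ _ =>
    Continuous.inv₀ (by fun_prop) fun _ => one_add_I_mul_ofReal_ne_zero _

lemma norm_pow_mul_cexp_mul_prod_inv_le {r : ℝ} (hr : 0 < r) (z : ℂ) :
    ‖(r : ℂ) ^ k * Complex.exp (-(z * r)) * ∏ j, (1 + Complex.I * (r * μ j : ℝ))⁻¹‖ ≤
      r ^ k * Real.exp (-(z.re * r)) := by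
  rw [norm_mul, norm_mul, norm_pow, Complex.norm_real, Real.norm_of_nonneg hr.le,
    Complex.norm_exp, Complex.neg_re, Complex.re_mul_ofReal]
  exact mul_le_of_le_one_right (by positivity) (norm_prod_inv_one_add_le_one μ r)

lemma aestronglyMeasurable_pow_mul_cexp_mul_prod_inv (z : ℂ) : AEStronglyMeasurable (fun r : ℝ =>
    (r : ℂ) ^ k * Complex.exp (-(z * r)) * ∏ j, (1 + Complex.I * (r * μ j : ℝ))⁻¹)
      (volume.restrict (Set.Ioi 0)) :=
  (Continuous.mul (by fun_prop) (continuous_prod_inv_one_add μ)).aestronglyMeasurable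

lemma integrableOn_pow_mul_cexp_mul_prod_inv {y : ℂ} (hy : 0 < y.re) :
    IntegrableOn (fun r : ℝ => (r : ℂ) ^ k * Complex.exp (-(y * r)) *
      ∏ j, (1 + Complex.I * (r * μ j : ℝ))⁻¹) (Set.Ioi 0) := by
  refine (integrableOn_pow_mul_exp_neg k hy).mono'
    (aestronglyMeasurable_pow_mul_cexp_mul_prod_inv μ k y) ?_
  filter_upwards [ae_restrict_mem measurableSet_Ioi] with r hr
  exact norm_pow_mul_cexp_mul_prod_inv_le μ k hr y

lemma differentiableAt_integral_cexp_mul_prod_inv {y : ℂ} (hy : 0 < y.re) :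
    DifferentiableAt ℂ (fun y : ℂ => ∫ r in Set.Ioi (0 : ℝ), (r : ℂ) ^ k *
      Complex.exp (-(y * r)) * ∏ j, (1 + Complex.I * (r * μ j : ℝ))⁻¹) y := by
  have hy2 := half_pos hy
  have hre : ∀ z ∈ Metric.ball y (y.re / 2), y.re / 2 ≤ z.re := fun z hz => by
    rw [Metric.mem_ball, dist_eq_norm] at hz
    have := (Complex.abs_re_le_norm (z - y)).trans hz.le
    rw [Complex.sub_re, abs_le] at this
    linarith
  refine (hasDerivAt_integral_of_differentiableOn hy2
    (bound := fun r : ℝ => r ^ k * Real.exp (-(y.re / 2 * r)))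
    (.of_forall fun t z hz => ?_)
    (fun z hz => aestronglyMeasurable_pow_mul_cexp_mul_prod_inv μ k z) ?_
    (integrableOn_pow_mul_exp_neg k hy2)).differentiableAt
  · refine DifferentiableAt.differentiableWithinAt ?_
    fun_prop
  · filter_upwards [ae_restrict_mem measurableSet_Ioi] with r hr z hz
    rw [Set.mem_Ioi] at hr
    refine (norm_pow_mul_cexp_mul_prod_inv_le μ k hr z).trans ?_
    have := hre z hz
    gcongr

/-- Rotation of the contour `t = yr`. -/
lemma pow_card_mul_integral_prod_inv_add {y : ℂ} (hy : 0 < y.re) :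
    y ^ Fintype.card ι * ∫ t in Set.Ioi (0 : ℝ), (t : ℂ) ^ k * Complex.exp (-t) *
      ∏ j, (y + Complex.I * (t * μ j : ℝ))⁻¹ =
    y ^ (k + 1) * ∫ r in Set.Ioi (0 : ℝ), (r : ℂ) ^ k *
      Complex.exp (-(y * r)) * ∏ j, (1 + Complex.I * (r * μ j : ℝ))⁻¹ := by
  set U : Set ℂ := {z | 0 < z.re} with hU
  have hUo : IsOpen U := isOpen_lt continuous_const Complex.continuous_re
  have hUc : IsPreconnected U := (convex_halfSpace_re_gt 0).isPreconnected
  have hreal : ∀ a : ℝ, 0 < a → (a : ℂ) ^ Fintype.card ι *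
      ∫ t in Set.Ioi (0 : ℝ), (t : ℂ) ^ k * Complex.exp (-t) *
        ∏ j, ((a : ℂ) + Complex.I * (t * μ j : ℝ))⁻¹ =
      (a : ℂ) ^ (k + 1) * ∫ r in Set.Ioi (0 : ℝ), (r : ℂ) ^ k *
        Complex.exp (-(a * r)) * ∏ j, (1 + Complex.I * (r * μ j : ℝ))⁻¹ := fun a ha => by
    have ha0 : (a : ℂ) ≠ 0 := Complex.ofReal_ne_zero.2 ha.ne'
    have h1 := integral_comp_mul_left_Ioi (fun t : ℝ => (t : ℂ) ^ k * Complex.exp (-t) *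
        ∏ j, ((a : ℂ) + Complex.I * (t * μ j : ℝ))⁻¹) 0 ha
    rw [mul_zero, Complex.real_smul] at h1
    have h2 : ∀ r : ℝ, ((a * r : ℝ) : ℂ) ^ k * Complex.exp (-(a * r : ℝ)) *
        ∏ j, ((a : ℂ) + Complex.I * (a * r * μ j : ℝ))⁻¹ =
        (a : ℂ) ^ k * (a : ℂ)⁻¹ ^ Fintype.card ι * ((r : ℂ) ^ k *
        Complex.exp (-(a * r)) * ∏ j, (1 + Complex.I * (r * μ j : ℝ))⁻¹) := fun r => by
      have h3 : ∀ j, ((a : ℂ) + Complex.I * (a * r * μ j : ℝ))⁻¹ =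
          (a : ℂ)⁻¹ * (1 + Complex.I * (r * μ j : ℝ))⁻¹ := fun j => by
        rw [← mul_inv]; congr 1; push_cast; ring
      simp_rw [h3, Finset.prod_mul_distrib]
      rw [Finset.prod_const, Finset.card_univ]
      push_cast
      ring
    simp_rw [h2] at h1
    rw [integral_const_mul] at h1
    have h5 : (a : ℂ) ^ Fintype.card ι ≠ 0 := pow_ne_zero _ ha0
    rw [Complex.ofReal_inv, eq_inv_mul_iff_mul_eq₀ ha0] at h1
    rw [← h1, inv_pow, pow_succ']
    generalize (∫ r in Set.Ioi (0 : ℝ), (r : ℂ) ^ k *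
        Complex.exp (-(a * r)) * ∏ j, (1 + Complex.I * (r * μ j : ℝ))⁻¹) = G
    field_simp

  have key := AnalyticOnNhd.eqOn_of_preconnected_of_frequently_eq (U := U) (z₀ := 1)
    (f := fun y => y ^ Fintype.card ι * ∫ t in Set.Ioi (0 : ℝ), (t : ℂ) ^ k * Complex.exp (-t) *
      ∏ j, (y + Complex.I * (t * μ j : ℝ))⁻¹)
    (g := fun y => y ^ (k + 1) * ∫ r in Set.Ioi (0 : ℝ), (r : ℂ) ^ k *
      Complex.exp (-(y * r)) * ∏ j, (1 + Complex.I * (r * μ j : ℝ))⁻¹)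
    (DifferentiableOn.analyticOnNhd (fun z hz => ((differentiableAt_id.pow _).mul
      (differentiableAt_integral_prod_inv_add μ k hz)).differentiableWithinAt) hUo)
    (DifferentiableOn.analyticOnNhd (fun z hz => ((differentiableAt_id.pow _).mul
      (differentiableAt_integral_cexp_mul_prod_inv μ k hz)).differentiableWithinAt) hUo)
    hUc (by simp [hU]) ?_
  · exact key hy
  · have ht : Filter.Tendsto (fun a : ℝ => (a : ℂ)) (nhdsWithin 1 (Set.Ioi 1))
        (nhdsWithin 1 {1}ᶜ) := by
      refine tendsto_nhdsWithin_of_tendsto_nhds_of_eventually_within _ ?_ ?_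
      · exact (Complex.continuous_ofReal.tendsto' 1 1 (by simp)).mono_left nhdsWithin_le_nhds
      · filter_upwards [self_mem_nhdsWithin] with a ha
        rw [Set.mem_Ioi] at ha
        simpa using ha.ne'
    refine ht.frequently (Filter.Eventually.frequently ?_)
    filter_upwards [self_mem_nhdsWithin] with a ha
    exact hreal a (zero_lt_one.trans ha)

end Rotation

/-- The Gamma integral with a complex rate. -/
lemma integral_pow_mul_cexp_neg_mul (k : ℕ) {z : ℂ} (hz : 0 < z.re) :
    ∫ t in Set.Ioi (0 : ℝ), (t : ℂ) ^ k * Complex.exp (-(z * t)) = k.factorial * z⁻¹ ^ (k + 1) := by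
  have hz0 : z ≠ 0 := fun h => by rw [h] at hz; simp at hz
  have h1 := pow_card_mul_integral_prod_inv_add (ι := Fin 0) (fun _ => 0) k hz
  have h2 := Complex.integral_cpow_mul_exp_neg_mul_Ioi (a := k + 1) (r := 1) (by
    simp only [Complex.add_re, Complex.natCast_re, Complex.one_re]
    positivity) one_pos
  simp only [add_sub_cancel_right, Complex.cpow_natCast, Complex.ofReal_one, one_mul, div_one,
    Complex.one_cpow, Complex.Gamma_nat_eq_factorial] at h2
  simp only [Fintype.card_fin, pow_zero, one_mul, Finset.univ_eq_empty, Finset.prod_empty,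
    mul_one, h2] at h1
  rw [h1, inv_pow, mul_comm (z ^ _), mul_assoc, mul_inv_cancel₀ (pow_ne_zero _ hz0), mul_one]

section Laplace
variable {ι : Type*} [Fintype ι] {Λ : ι → ℝ} {y : ℂ} {φ : (ι → ℂ) → ℂ}

lemma continuous_quadForm (Λ : ι → ℝ) : Continuous (quadForm Λ) := by
  unfold quadForm
  fun_prop

lemma cexp_mul_cexp_quadForm (Λ : ι → ℝ) (y : ℂ) (t : ℝ) (v : ι → ℂ) :
    Complex.exp (-(y * ∑ m, (‖v m‖ : ℂ) ^ 2)) * Complex.exp (-(Complex.I * quadForm Λ v * t)) =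
      Complex.exp (-∑ m, (y + Complex.I * (t * Λ m : ℝ)) * (‖v m‖ : ℂ) ^ 2) := by
  rw [← Complex.exp_add, quadForm]
  push_cast
  congr 1
  rw [← neg_add, Finset.mul_sum, Finset.mul_sum, Finset.sum_mul, ← Finset.sum_add_distrib]
  congr 1
  exact Finset.sum_congr rfl fun m _ => by ring

/-- Laplace representation of the powers of `(1 + i v†Λv)⁻¹` under a Gaussian integral. -/
lemma factorial_mul_integral_inv_pow (k : ℕ)
    (hφ : Integrable fun v => φ v * Complex.exp (-(y * ∑ m, (‖v m‖ : ℂ) ^ 2))) :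
    k.factorial * ∫ v, φ v * Complex.exp (-(y * ∑ m, (‖v m‖ : ℂ) ^ 2)) *
        (1 + Complex.I * quadForm Λ v)⁻¹ ^ (k + 1) =
      ∫ t in Set.Ioi (0 : ℝ), (t : ℂ) ^ k * Complex.exp (-t) *
        ∫ v, φ v * Complex.exp (-∑ m, (y + Complex.I * (t * Λ m : ℝ)) * (‖v m‖ : ℂ) ^ 2) := by
  have hg : IntegrableOn (fun t : ℝ => (t : ℂ) ^ k * Complex.exp (-t)) (Set.Ioi 0) := by
    simpa using integrableOn_pow_mul_cexp_mul_prod_inv (ι := Fin 0) (fun _ => 0) k (y := 1) (by simp)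
  have hprod := hφ.mul_prod hg
  have hint : Integrable (Function.uncurry fun (v : ι → ℂ) (t : ℝ) =>
      φ v * Complex.exp (-(y * ∑ m, (‖v m‖ : ℂ) ^ 2)) * ((t : ℂ) ^ k * Complex.exp (-t)) *
        Complex.exp (-(Complex.I * quadForm Λ v * t)))
      (volume.prod (volume.restrict (Set.Ioi (0 : ℝ)))) := by
    refine hprod.norm.mono' (hprod.aestronglyMeasurable.mul
      (Continuous.aestronglyMeasurable ?_)) (.of_forall fun q => ?_)
    · have := continuous_quadForm Λ
      fun_prop
    · simp only [Function.uncurry]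
      rw [norm_mul _ (Complex.exp (-(Complex.I * quadForm Λ q.1 * q.2))), Complex.norm_exp]
      simp
  calc _ = ∫ v, ∫ t in Set.Ioi (0 : ℝ), φ v * Complex.exp (-(y * ∑ m, (‖v m‖ : ℂ) ^ 2)) *
        ((t : ℂ) ^ k * Complex.exp (-t)) * Complex.exp (-(Complex.I * quadForm Λ v * t)) := by
        rw [← integral_const_mul]
        refine integral_congr_ae (.of_forall fun v => ?_)
        simp only
        rw [mul_left_comm, ← integral_pow_mul_cexp_neg_mul k (by simp), ← integral_const_mul]
        refine integral_congr_ae (.of_forall fun t => ?_)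
        simp only
        rw [mul_assoc (φ v * _), mul_assoc ((t : ℂ) ^ k), ← Complex.exp_add]
        congr 3
        ring
    _ = _ := by
        rw [integral_integral_swap hint]
        refine integral_congr_ae (.of_forall fun t => ?_)
        simp only
        rw [← integral_const_mul]
        refine integral_congr_ae (.of_forall fun v => ?_)
        simp only
        rw [← cexp_mul_cexp_quadForm]
        ring

end Laplace

section GaussianInverse
variable {p : ℕ} {Λ : Fin p → ℝ} {x : ℂ}

lemma cexp_mul_prod_inv_eq_inv_gFun (Λ : Fin p → ℝ) (x : ℂ) (r : ℝ) :
    Complex.exp (-(-Complex.I * x * r)) * ∏ j, (1 + Complex.I * (r * Λ j : ℝ))⁻¹ =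
      (gFun Λ x r)⁻¹ := by
  rw [gFun, mul_inv, ← Complex.exp_neg, Finset.prod_inv_distrib]
  congr 2
  · ring
  · exact Finset.prod_congr rfl fun j _ => by push_cast; ring

lemma pow_mul_integral_inv_pow (Λ : Fin p → ℝ) (hx : 0 < x.im) (k : ℕ) :
    (-Complex.I * x) ^ p * (k.factorial *
        ∫ v : Fin p → ℂ, Complex.exp (-(-Complex.I * x * ∑ m, (‖v m‖ : ℂ) ^ 2)) *
        (1 + Complex.I * quadForm Λ v)⁻¹ ^ (k + 1)) =
      (Real.pi : ℂ) ^ p * (-Complex.I * x) ^ (k + 1) *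
        ∫ r in Set.Ioi (0 : ℝ), (r : ℂ) ^ k * (gFun Λ x r)⁻¹ := by
  have hy : 0 < (-Complex.I * x).re := by simpa using hx
  have h1 := factorial_mul_integral_inv_pow (y := -Complex.I * x) (φ := fun _ => 1) (Λ := Λ) k
    ((integrable_cexp_neg_sum (b := fun _ : Fin p => -Complex.I * x) (fun _ => hy)).congr
      (.of_forall fun v => by simp only [Finset.mul_sum, one_mul]))
  simp only [one_mul] at h1
  simp_rw [integral_cexp_neg_sum fun m => add_I_mul_ofReal_re hy _] at h1
  have h2 : ∀ t : ℝ, (t : ℂ) ^ k * Complex.exp (-t) *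
      ∏ m, (Real.pi / (-Complex.I * x + Complex.I * (t * Λ m : ℝ)) : ℂ) = (Real.pi : ℂ) ^ p *
      ((t : ℂ) ^ k * Complex.exp (-t) *
        ∏ m, (-Complex.I * x + Complex.I * (t * Λ m : ℝ))⁻¹) := fun t => by
    simp_rw [div_eq_mul_inv, Finset.prod_mul_distrib]
    rw [Finset.prod_const, Finset.card_univ, Fintype.card_fin]
    ring
  simp_rw [h2] at h1
  have h3 := pow_card_mul_integral_prod_inv_add Λ k hy
  simp_rw [mul_assoc ((_ : ℂ) ^ k), cexp_mul_prod_inv_eq_inv_gFun] at h3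
  rw [h1, integral_const_mul, mul_left_comm]
  simp_rw [mul_assoc ((_ : ℂ) ^ k)]
  rw [Fintype.card_fin] at h3
  rw [h3]
  ring

lemma pow_mul_integral_normSq_mul_inv_pow (Λ : Fin p → ℝ) (hx : 0 < x.im) (k : ℕ) (j : Fin p) :
    (-Complex.I * x) ^ p * ((k + 1).factorial *
        ∫ v : Fin p → ℂ, (‖v j‖ : ℂ) ^ 2 *
        Complex.exp (-(-Complex.I * x * ∑ m, (‖v m‖ : ℂ) ^ 2)) *
        (1 + Complex.I * quadForm Λ v)⁻¹ ^ (k + 2)) =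
      (Real.pi : ℂ) ^ p * (-Complex.I * x) ^ (k + 1) *
        ∫ r in Set.Ioi (0 : ℝ), (r : ℂ) ^ (k + 1) *
          ((1 + Complex.I * r * Λ j)⁻¹ * (gFun Λ x r)⁻¹) := by
  have hy : 0 < (-Complex.I * x).re := by simpa using hx
  have hy0 : -Complex.I * x ≠ 0 := fun h => by rw [h] at hy; simp at hy
  have hsq : ∀ v : Fin p → ℂ, (‖v j‖ : ℂ) ^ 2 = v j * star (v j) := fun v => by
    rw [Complex.star_def, Complex.mul_conj']
  have h1 := factorial_mul_integral_inv_pow (y := -Complex.I * x) (φ := fun v => (‖v j‖ : ℂ) ^ 2) (Λ := Λ) (k + 1)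
    ((integrable_mul_conj_mul_cexp_neg_sum (b := fun _ : Fin p => -Complex.I * x)
      (fun _ => hy) j j).congr (.of_forall fun v => by simp only [Finset.mul_sum, hsq]))
  rw [h1]
  simp_rw [hsq, integral_mul_conj_mul_cexp_neg_sum fun m => add_I_mul_ofReal_re hy _, if_true]
  have h2 : ∀ t : ℝ, (t : ℂ) ^ (k + 1) * Complex.exp (-t) *
      ((∏ m, (Real.pi / (-Complex.I * x + Complex.I * (t * Λ m : ℝ)) : ℂ)) /
        (-Complex.I * x + Complex.I * (t * Λ j : ℝ))) = (Real.pi : ℂ) ^ p *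
      ((t : ℂ) ^ (k + 1) * Complex.exp (-t) *
        ∏ m : Option (Fin p), (-Complex.I * x + Complex.I * (t * m.elim (Λ j) Λ : ℝ))⁻¹) :=
    fun t => by
      simp only [Fintype.prod_option, div_eq_mul_inv, Finset.prod_mul_distrib, Option.elim_none,
        Option.elim_some]
      rw [Finset.prod_const, Finset.card_univ, Fintype.card_fin]
      ring
  simp_rw [h2]
  have h3 := pow_card_mul_integral_prod_inv_add (ι := Option (Fin p)) (fun m => m.elim (Λ j) Λ)
    (k + 1) hy
  have h4 : ∀ r : ℝ, (r : ℂ) ^ (k + 1) * Complex.exp (-(-Complex.I * x * r)) *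
      ∏ m : Option (Fin p), (1 + Complex.I * (r * m.elim (Λ j) Λ : ℝ))⁻¹ =
      (r : ℂ) ^ (k + 1) * ((1 + Complex.I * r * Λ j)⁻¹ * (gFun Λ x r)⁻¹) := fun r => by
    rw [Fintype.prod_option, ← cexp_mul_prod_inv_eq_inv_gFun]
    simp only [Option.elim]
    push_cast
    ring
  simp_rw [h4] at h3
  rw [integral_const_mul, mul_left_comm]
  rw [Fintype.card_option, Fintype.card_fin, pow_succ', pow_succ' _ (k + 1)] at h3
  have h5 := mul_left_cancel₀ hy0 ((mul_assoc _ _ _).symm.trans (h3.trans (mul_assoc _ _ _)))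
  rw [h5]
  ring

end GaussianInverse

section Wishart
variable {p n : ℕ} {Λ : Fin p → ℝ}

lemma integral_comp_transpose (f : (Fin n → Fin p → ℂ) → ℂ) :
    ∫ W : Fin p → Fin n → ℂ, f (fun a j => W j a) = ∫ W, f W := by
  let e : (Fin p → Fin n → ℂ) ≃L[ℝ] (Fin n → Fin p → ℂ) :=
    (LinearEquiv.toContinuousLinearEquiv
      { toFun := fun W a j => W j a
        invFun := fun W j a => W a j
        map_add' := fun _ _ => rfl
        map_smul' := fun _ _ => rfl
        left_inv := fun _ => rfl
        right_inv := fun _ => rfl })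
  have he : ∀ W, e W = fun a j => W j a := fun _ => rfl
  have hpi : ∀ q m : ℕ, (volume : Measure (Fin q → Fin m → ℂ)).IsAddHaarMeasure := fun q m =>
    Measure.pi.isAddHaarMeasure fun _ => volume
  have := hpi p n
  have := hpi n p
  obtain ⟨c, hc, -⟩ := exists_integral_comp_continuousLinearEquiv e
  have h1 := hc fun W => ∏ a, Complex.exp (-∑ m, (1 : ℂ) * (‖W a m‖ : ℂ) ^ 2)
  have h2 : ∀ q m : ℕ, ∫ W : Fin q → Fin m → ℂ,
      ∏ a, Complex.exp (-∑ m, (1 : ℂ) * (‖W a m‖ : ℂ) ^ 2) = ((Real.pi : ℂ) ^ m) ^ q := fun q m => by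
    rw [integral_fintype_prod_volume_eq_prod
      (fun (_ : Fin q) (w : Fin m → ℂ) => Complex.exp (-∑ m, (1 : ℂ) * (‖w m‖ : ℂ) ^ 2))]
    rw [integral_cexp_neg_sum (b := fun _ => 1) (by simp)]
    simp
  have h3 : ∀ W : Fin p → Fin n → ℂ,
      ∏ a, Complex.exp (-∑ m, (1 : ℂ) * (‖e W a m‖ : ℂ) ^ 2) =
      ∏ a, Complex.exp (-∑ m, (1 : ℂ) * (‖W a m‖ : ℂ) ^ 2) := fun W => by
    simp_rw [he, ← Complex.exp_sum, Finset.sum_neg_distrib]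
    rw [Finset.sum_comm]
  simp_rw [h3] at h1
  rw [h2, h2, ← pow_mul, ← pow_mul, mul_comm n p] at h1
  have h4 : (c : ℂ) = 1 :=
    (mul_right_cancel₀ (pow_ne_zero _ (by simp [Real.pi_ne_zero])) ((one_mul _).trans h1)).symm
  have h5 := hc f
  rw [h4, one_mul] at h5
  exact h5

lemma of_mul_conjTranspose_of (W : Fin p → Fin n → ℂ) : Matrix.of W * (Matrix.of W)ᴴ =
    ∑ a, vecMulVec (fun j => W j a) (star fun j => W j a) := by
  ext i j
  simp [Matrix.mul_apply, Matrix.sum_apply, vecMulVec_apply]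

lemma isHermitian_sum_vecMulVec_star (W : Fin n → Fin p → ℂ) :
    (∑ a, vecMulVec (W a) (star (W a))).IsHermitian := by
  rw [Matrix.IsHermitian, conjTranspose_sum]
  exact Finset.sum_congr rfl fun a _ => isHermitian_vecMulVec_star _

lemma trace_conjTranspose_mul_inv_diagonal_mul_re (hΛ : ∀ j, 0 < Λ j) (W : Fin p → Fin n → ℂ) :
    ((Matrix.of W)ᴴ * (Matrix.diagonal fun j => (Λ j : ℂ))⁻¹ * Matrix.of W).trace.re =
      ∑ a, ∑ j, (Λ j)⁻¹ * ‖W j a‖ ^ 2 := by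
  have h1 : (Matrix.diagonal fun j => (Λ j : ℂ))⁻¹ = Matrix.diagonal fun j => ((Λ j : ℂ))⁻¹ :=
    Matrix.inv_eq_right_inv (by
      rw [diagonal_mul_diagonal, ← diagonal_one]
      congr 1
      ext j
      exact mul_inv_cancel₀ (by exact_mod_cast (hΛ j).ne'))
  rw [h1, Matrix.trace, Complex.re_sum]
  refine Finset.sum_congr rfl fun a _ => ?_
  rw [Matrix.diag_apply, Matrix.mul_apply, Complex.re_sum]
  refine Finset.sum_congr rfl fun j _ => ?_
  rw [mul_diagonal, conjTranspose_apply, of_apply, mul_right_comm, Complex.star_def,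
    Complex.conj_mul']
  norm_cast
  ring

lemma star_dotProduct_sum_vecMulVec_mulVec (W : Fin n → Fin p → ℂ) (v : Fin p → ℂ) :
    star v ⬝ᵥ (∑ a, vecMulVec (W a) (star (W a))) *ᵥ v = ∑ a, (‖star v ⬝ᵥ W a‖ : ℂ) ^ 2 := by
  rw [sum_mulVec, dotProduct_sum]
  refine Finset.sum_congr rfl fun a _ => ?_
  rw [vecMulVec_mulVec, ← Complex.mul_conj', ← Complex.star_def, ← star_dotProduct,
    dotProduct_smul, op_smul_eq_mul]

lemma exp_mul_hermGauss (y : ℂ) (W : Fin n → Fin p → ℂ) (v : Fin p → ℂ) :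
    (Real.exp (-∑ a, ∑ j, (Λ j)⁻¹ * ‖W a j‖ ^ 2) : ℂ) *
        hermGauss y (∑ a, vecMulVec (W a) (star (W a))) v =
      Complex.exp (-(y * ∑ m, (‖v m‖ : ℂ) ^ 2)) * ∏ a, colWeight Λ v (W a) := by
  simp_rw [hermGauss, star_dotProduct_sum_vecMulVec_mulVec, colWeight, ← Complex.exp_sum]
  rw [Complex.ofReal_exp, ← Complex.exp_add, ← Complex.exp_add, Finset.sum_sub_distrib,
    Finset.mul_sum]
  push_cast
  rw [Finset.sum_neg_distrib, Finset.mul_sum]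
  congr 1
  ring

end Wishart

section WishartIntegral
variable {p n : ℕ} {Λ : Fin p → ℝ} {x x₀ b y : ℂ}

lemma det_div_det_eq_integral_hermGauss (hx₀ : 0 < x₀.im) (hbx : b * x = 1)
    {H : Matrix (Fin p) (Fin p) ℂ} (hH : H.IsHermitian) :
    (x • (1 : Matrix (Fin p) (Fin p) ℂ) - H).det / (x₀ • (1 : Matrix (Fin p) (Fin p) ℂ) - H).det =
      x ^ p * (Complex.I ^ p * (Real.pi : ℂ) ^ p)⁻¹ *
        ((1 - b • H).det * ∫ v, hermGauss (-Complex.I * x₀) H v) := by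
  have hy : 0 < (-Complex.I * x₀).re := by simpa using hx₀
  have h0 := det_smul_one_add_ne_zero hy hH
  have h1 : x • (1 : Matrix (Fin p) (Fin p) ℂ) - H = x • (1 - b • H) := by
    rw [smul_sub, smul_smul, mul_comm x, hbx, one_smul]
  have h2 : x₀ • (1 : Matrix (Fin p) (Fin p) ℂ) - H =
      Complex.I • ((-Complex.I * x₀) • (1 : Matrix (Fin p) (Fin p) ℂ) + Complex.I • H) := by
    rw [smul_add, smul_smul, smul_smul, ← mul_assoc, mul_neg, Complex.I_mul_I, neg_neg, one_mul,
      neg_one_smul, sub_eq_add_neg]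
  rw [integral_hermGauss hy hH, h1, h2, det_smul, det_smul, Fintype.card_fin]
  have hpi : (Real.pi : ℂ) ≠ 0 := by simp [Real.pi_ne_zero]
  have hI := Complex.I_ne_zero
  field_simp

lemma integral_wishartMeasureComplex (hΛ : ∀ j, 0 < Λ j) (F : (Fin n → Fin p → ℂ) → ℂ) :
    ∫ W, F (fun a j => W j a) ∂(wishartMeasureComplex p n Λ) =
      (((Real.pi : ℂ) ^ p * ∏ j, (Λ j : ℂ)) ^ n)⁻¹ *
        ∫ W, (Real.exp (-∑ a, ∑ j, (Λ j)⁻¹ * ‖W a j‖ ^ 2) : ℂ) * F W := by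
  have hpos : 0 ≤ ((Real.pi ^ p * ∏ j, Λ j) ^ n)⁻¹ := by
    have := Finset.prod_nonneg fun j (_ : j ∈ Finset.univ) => (hΛ j).le
    positivity
  rw [wishartMeasureComplex]
  simp_rw [trace_conjTranspose_mul_inv_diagonal_mul_re hΛ]
  rw [integral_withDensity_eq_integral_toReal_smul (by fun_prop) (by simp),
    ← integral_comp_transpose, ← integral_const_mul]
  refine integral_congr_ae (.of_forall fun W => ?_)
  simp only
  rw [ENNReal.toReal_ofReal (by positivity), Complex.real_smul]
  push_cast
  ring

lemma integrable_det_mul_cexp_mul_prod_colWeight (hΛ : ∀ j, 0 < Λ j) (b : ℂ) (hy : 0 < y.re) :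
    Integrable (Function.uncurry fun (W : Fin n → Fin p → ℂ) (v : Fin p → ℂ) =>
      (1 - b • ∑ a, vecMulVec (W a) (star (W a))).det *
        (Complex.exp (-(y * ∑ m, (‖v m‖ : ℂ) ^ 2)) * ∏ a, colWeight Λ v (W a)))
      (volume.prod volume) := by
  obtain ⟨c, hc, hle⟩ := exists_norm_colWeight_le hΛ
  obtain ⟨K, hK, hdet⟩ := exists_norm_det_le (1 : Matrix (Fin p) (Fin p) ℂ) 0 b 0 n hc
  have h1 := (integrable_exp_neg_sum_sum (ι := Fin p) n hc).const_mul K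
  have h2 := (integrable_cexp_neg_sum (b := fun _ : Fin p => y) fun _ => hy).norm
  refine (h1.mul_prod h2).mono' (Continuous.aestronglyMeasurable ?_) (.of_forall fun q => ?_)
  · unfold Function.uncurry colWeight
    refine Continuous.mul (Continuous.matrix_det ?_) (by fun_prop)
    have hS : Continuous fun q : (Fin n → Fin p → ℂ) × (Fin p → ℂ) =>
        ∑ a, vecMulVec (q.1 a) (star (q.1 a)) := continuous_finsetSum _ fun a _ =>
      Continuous.matrix_vecMulVec (by fun_prop) (by fun_prop)
    fun_prop
  · simp only [Function.uncurry]
    have h3 := hdet 0 (by simp) q.1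
    have h4 := norm_prod_le_exp_neg (hle q.2) q.1
    rw [zero_smul, add_zero] at h3
    rw [← Finset.mul_sum, norm_mul, norm_mul, mul_left_comm, mul_comm]
    refine mul_le_mul_of_nonneg_right ((mul_le_mul h3 h4 (norm_nonneg _) (by positivity)).trans_eq
      ?_) (norm_nonneg _)
    rw [mul_assoc, ← Real.exp_add]
    congr 2
    ring

lemma integral_det_div_det_eq_integral_integral (hΛ : ∀ j, 0 < Λ j) (hx₀ : 0 < x₀.im)
    (hbx : b * x = 1) :
    ∫ W, (x • (1 : Matrix (Fin p) (Fin p) ℂ) - Matrix.of W * (Matrix.of W)ᴴ).det /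
          (x₀ • (1 : Matrix (Fin p) (Fin p) ℂ) - Matrix.of W * (Matrix.of W)ᴴ).det
        ∂(wishartMeasureComplex p n Λ) =
      (((Real.pi : ℂ) ^ p * ∏ j, (Λ j : ℂ)) ^ n)⁻¹ * (x ^ p * (Complex.I ^ p * (Real.pi : ℂ) ^ p)⁻¹) *
      ∫ v : Fin p → ℂ, Complex.exp (-(-Complex.I * x₀ * ∑ m, (‖v m‖ : ℂ) ^ 2)) *
        ∫ W : Fin n → Fin p → ℂ, (1 - b • ∑ a, vecMulVec (W a) (star (W a))).det *
          ∏ a, colWeight Λ v (W a) := by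
  have hy : 0 < (-Complex.I * x₀).re := by simpa using hx₀
  simp_rw [of_mul_conjTranspose_of]
  rw [integral_wishartMeasureComplex hΛ fun W =>
    (x • (1 : Matrix (Fin p) (Fin p) ℂ) - ∑ a, vecMulVec (W a) (star (W a))).det /
      (x₀ • (1 : Matrix (Fin p) (Fin p) ℂ) - ∑ a, vecMulVec (W a) (star (W a))).det, mul_assoc]
  congr 1
  simp_rw [det_div_det_eq_integral_hermGauss hx₀ hbx (isHermitian_sum_vecMulVec_star _),
    mul_left_comm (Complex.ofReal _), ← integral_const_mul (Complex.ofReal _), exp_mul_hermGauss,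
    ← integral_const_mul (det _)]
  rw [integral_const_mul, integral_integral_swap
    (integrable_det_mul_cexp_mul_prod_colWeight hΛ b hy)]
  simp_rw [mul_left_comm (det _), integral_const_mul]

lemma integrable_mul_inv_one_add_pow {φ : (Fin p → ℂ) → ℂ} (Λ : Fin p → ℝ) (hφ : Integrable φ)
    (k : ℕ) : Integrable fun v => φ v * (1 + Complex.I * quadForm Λ v)⁻¹ ^ k := by
  refine hφ.norm.mono' (hφ.aestronglyMeasurable.mul (Continuous.aestronglyMeasurable ?_))
    (.of_forall fun v => ?_)
  · have := continuous_quadForm Λ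
    exact (Continuous.inv₀ (by fun_prop) fun _ => one_add_I_mul_ofReal_ne_zero _).pow _
  · rw [norm_mul, norm_pow, norm_inv]
    exact mul_le_of_le_one_right (norm_nonneg _) (pow_le_one₀ (by positivity)
      (inv_le_one_of_one_le₀ (re_le_norm_add_I_mul 1 _)))

lemma integrable_cexp_neg_mul_sum (hy : 0 < y.re) :
    Integrable fun v : Fin p → ℂ => Complex.exp (-(y * ∑ m, (‖v m‖ : ℂ) ^ 2)) :=
  (integrable_cexp_neg_sum (b := fun _ : Fin p => y) (fun _ => hy)).congr
    (.of_forall fun v => by simp only [Finset.mul_sum])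

lemma integrable_normSq_mul_cexp_neg_mul_sum (hy : 0 < y.re) (j : Fin p) :
    Integrable fun v : Fin p → ℂ =>
      (‖v j‖ : ℂ) ^ 2 * Complex.exp (-(y * ∑ m, (‖v m‖ : ℂ) ^ 2)) :=
  (integrable_mul_conj_mul_cexp_neg_sum (b := fun _ : Fin p => y) (fun _ => hy) j j).congr
    (.of_forall fun v => by simp only [Finset.mul_sum, Complex.star_def, Complex.mul_conj'])

lemma integral_cexp_mul_add_sum (Λ : Fin p → ℝ) (hy : 0 < y.re) (c : ℂ) (d : Fin p → ℂ) (k : ℕ) :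
    ∫ v : Fin p → ℂ, Complex.exp (-(y * ∑ m, (‖v m‖ : ℂ) ^ 2)) *
        ((1 + Complex.I * quadForm Λ v)⁻¹ ^ (k + 1) * c +
        ∑ j, d j * ((‖v j‖ : ℂ) ^ 2 * (1 + Complex.I * quadForm Λ v)⁻¹ ^ (k + 2))) =
      c * (∫ v : Fin p → ℂ, Complex.exp (-(y * ∑ m, (‖v m‖ : ℂ) ^ 2)) *
        (1 + Complex.I * quadForm Λ v)⁻¹ ^ (k + 1)) +
      ∑ j, d j * ∫ v : Fin p → ℂ, (‖v j‖ : ℂ) ^ 2 *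
        Complex.exp (-(y * ∑ m, (‖v m‖ : ℂ) ^ 2)) *
        (1 + Complex.I * quadForm Λ v)⁻¹ ^ (k + 2) := by
  have h1 := (integrable_mul_inv_one_add_pow Λ (integrable_cexp_neg_mul_sum hy) (k + 1)).const_mul c
  have h2 := fun j => (integrable_mul_inv_one_add_pow Λ
    (integrable_normSq_mul_cexp_neg_mul_sum hy j) (k + 2)).const_mul (d j)
  simp_rw [← integral_const_mul]
  rw [← integral_finsetSum _ fun j _ => h2 j, ← integral_add h1 (integrable_finsetSum _ fun j _ => h2 j)]
  refine integral_congr_ae (.of_forall fun v => ?_)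
  simp only
  generalize Complex.exp _ = E
  rw [mul_add, Finset.mul_sum]
  congr 1
  · ring
  · exact Finset.sum_congr rfl fun j _ => by ring

lemma integral_det_div_det_eq_integral_Ioi (hΛ : ∀ j, 0 < Λ j) (hx₀ : 0 < x₀.im) (hx : x ≠ 0)
    (k d : ℕ) (hk : k + 1 = p + d) :
    ∫ W, (x • (1 : Matrix (Fin p) (Fin p) ℂ) - Matrix.of W * (Matrix.of W)ᴴ).det /
          (x₀ • (1 : Matrix (Fin p) (Fin p) ℂ) - Matrix.of W * (Matrix.of W)ᴴ).det
        ∂(wishartMeasureComplex p (k + 1) Λ) =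
      (x₀ / x) ^ d * ((k + 1) * gCoeff Λ x (k + 1) *
          (∫ r in Set.Ioi (0 : ℝ), (r : ℂ) ^ k * (gFun Λ x₀ r)⁻¹) +
        ∑ j, (Λ j : ℂ) ^ 2 * gEraseCoeff Λ x j k * ∫ r in Set.Ioi (0 : ℝ), (r : ℂ) ^ (k + 1) *
          ((1 + Complex.I * r * Λ j)⁻¹ * (gFun Λ x₀ r)⁻¹)) := by
  have hy : 0 < (-Complex.I * x₀).re := by simpa using hx₀
  have hy0 : -Complex.I * x₀ ≠ 0 := fun h => by rw [h] at hy; simp at hy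
  have hpi : (Real.pi : ℂ) ≠ 0 := by simp [Real.pi_ne_zero]
  have hprod : (∏ j, (Λ j : ℂ)) ≠ 0 :=
    Finset.prod_ne_zero_iff.2 fun j _ => by exact_mod_cast (hΛ j).ne'
  have hbx := inv_mul_cancel₀ hx
  rw [integral_det_div_det_eq_integral_integral hΛ hx₀ hbx]
  simp_rw [integral_det_mul_prod_colWeight hΛ _ hbx, mul_left_comm (Complex.exp _)]
  rw [integral_const_mul, integral_cexp_mul_add_sum Λ hy]
  have h0 := pow_mul_integral_inv_pow Λ hx₀ k
  have hj := pow_mul_integral_normSq_mul_inv_pow Λ hx₀ k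
  set J := ∫ v : Fin p → ℂ, Complex.exp (-(-Complex.I * x₀ * ∑ m, (‖v m‖ : ℂ) ^ 2)) *
        (1 + Complex.I * quadForm Λ v)⁻¹ ^ (k + 1)
  set K := ∫ r in Set.Ioi (0 : ℝ), (r : ℂ) ^ k * (gFun Λ x₀ r)⁻¹
  have hrot : -Complex.I * x₀ * Complex.I = x₀ := by
    rw [mul_right_comm, neg_mul, Complex.I_mul_I, neg_neg, one_mul]
  generalize -Complex.I * x₀ = y at *
  have hcancel : ∀ A B, y ^ p * A = (Real.pi : ℂ) ^ p * y ^ (k + 1) * B →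
      A = (Real.pi : ℂ) ^ p * y ^ d * B := fun A B h => by
    refine mul_left_cancel₀ (pow_ne_zero p hy0) (h.trans ?_)
    rw [hk, pow_add]
    ring
  have h0' := hcancel _ _ h0
  have hj' := fun j => hcancel _ _ (hj j)
  have hsum : ((k + 1).factorial : ℂ) * (gCoeff Λ x (k + 1) * J + ∑ j, (Λ j : ℂ) ^ 2 *
      gEraseCoeff Λ x j k * ∫ v : Fin p → ℂ, (‖v j‖ : ℂ) ^ 2 *
        Complex.exp (-(y * ∑ m, (‖v m‖ : ℂ) ^ 2)) *
        (1 + Complex.I * quadForm Λ v)⁻¹ ^ (k + 2)) =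
      (Real.pi : ℂ) ^ p * y ^ d * ((k + 1) * gCoeff Λ x (k + 1) * K +
        ∑ j, (Λ j : ℂ) ^ 2 * gEraseCoeff Λ x j k * ∫ r in Set.Ioi (0 : ℝ), (r : ℂ) ^ (k + 1) *
          ((1 + Complex.I * r * Λ j)⁻¹ * (gFun Λ x₀ r)⁻¹)) := by
    rw [mul_add, mul_add, Finset.mul_sum, Finset.mul_sum]
    congr 1
    · rw [Nat.factorial_succ]
      push_cast
      linear_combination ((k : ℂ) + 1) * gCoeff Λ x (k + 1) * h0'
    · exact Finset.sum_congr rfl fun j _ => by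
        linear_combination (Λ j : ℂ) ^ 2 * gEraseCoeff Λ x j k * hj' j
  have hI := Complex.I_ne_zero
  rw [mul_assoc (_ ^ (k + 1)) ((k + 1).factorial : ℂ), hsum, ← hrot, hk]
  generalize (_ + _ : ℂ) = S
  simp only [mul_pow, div_pow, inv_pow, pow_add]
  field_simp

end WishartIntegral

section Truncation
variable {p : ℕ} (Λ : Fin p → ℝ) (x x₀ : ℂ)

lemma gLower_succ_eq (j : Fin p) (k : ℕ) (s : ℂ) :
    gLower Λ (k + 1) x s = (1 + Complex.I * s * Λ j) *
      (∑ m ∈ Finset.range (k + 1), gEraseCoeff Λ x j m * s ^ m) -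
        Complex.I * Λ j * gEraseCoeff Λ x j k * s ^ (k + 1) := by
  induction k with
  | zero =>
    simp only [gLower, zero_add, Finset.sum_range_one, gCoeff_zero, gEraseCoeff_zero]
    ring
  | succ k ih =>
    rw [gLower, Finset.sum_range_succ, ← gLower, ih, Finset.sum_range_succ _ (k + 1),
      gCoeff_succ_eq Λ x j]
    ring

lemma hasDerivAt_gLower_succ (k : ℕ) (s : ℂ) :
    HasDerivAt (gLower Λ (k + 1) x)
      (∑ m ∈ Finset.range k, (m + 1) * gCoeff Λ x (m + 1) * s ^ m) s := by
  have h1 : HasDerivAt (gLower Λ (k + 1) x)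
      (∑ m ∈ Finset.range (k + 1), gCoeff Λ x m * (m * s ^ (m - 1))) s :=
    HasDerivAt.fun_sum fun m _ => (hasDerivAt_pow m s).const_mul _
  refine h1.congr_deriv ?_
  rw [Finset.sum_range_succ']
  simp only [Nat.cast_zero, zero_mul, mul_zero, add_zero, Nat.add_sub_cancel]
  exact Finset.sum_congr rfl fun m _ => by push_cast; ring

lemma sum_gEraseCoeff_sub_deriv_gLower (k : ℕ) (s : ℂ) :
    ∑ j, Complex.I * Λ j * (∑ m ∈ Finset.range (k + 1), gEraseCoeff Λ x j m * s ^ m) -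
      (∑ m ∈ Finset.range k, (m + 1) * gCoeff Λ x (m + 1) * s ^ m) -
        Complex.I * x * gLower Λ (k + 1) x s = (k + 1) * gCoeff Λ x (k + 1) * s ^ k := by
  have h1 : ∑ m ∈ Finset.range (k + 1), (m + 1) * gCoeff Λ x (m + 1) * s ^ m =
      ∑ j, Complex.I * Λ j * (∑ m ∈ Finset.range (k + 1), gEraseCoeff Λ x j m * s ^ m) -
        Complex.I * x * gLower Λ (k + 1) x s := by
    simp_rw [gLower, Finset.mul_sum]
    rw [Finset.sum_comm, ← Finset.sum_sub_distrib]
    refine Finset.sum_congr rfl fun m _ => ?_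
    rw [succ_mul_gCoeff_succ, add_mul, Finset.sum_mul, add_comm, sub_eq_add_neg]
    congr 1
    · exact Finset.sum_congr rfl fun j _ => by ring
    · ring
  rw [sub_right_comm, ← h1, Finset.sum_range_succ, add_sub_cancel_left]

lemma one_add_I_mul_mul_ne_zero (r l : ℝ) : 1 + Complex.I * (r : ℂ) * l ≠ 0 := by
  have := one_add_I_mul_ofReal_ne_zero (r * l)
  rwa [Complex.ofReal_mul, ← mul_assoc] at this

lemma gFun_ofReal_ne_zero (r : ℝ) : gFun Λ x r ≠ 0 :=
  mul_ne_zero (Complex.exp_ne_zero _)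
    (Finset.prod_ne_zero_iff.2 fun j _ => one_add_I_mul_mul_ne_zero r (Λ j))

lemma sum_mul_gLower_sub_deriv_gLower (k : ℕ) (r : ℝ) :
    ∑ j, Complex.I * Λ j * (1 + Complex.I * r * Λ j)⁻¹ * gLower Λ (k + 1) x r -
      (∑ m ∈ Finset.range k, (m + 1) * gCoeff Λ x (m + 1) * (r : ℂ) ^ m) -
        Complex.I * x * gLower Λ (k + 1) x r =
      (k + 1) * gCoeff Λ x (k + 1) * (r : ℂ) ^ k + ∑ j, (Λ j : ℂ) ^ 2 * gEraseCoeff Λ x j k *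
        ((r : ℂ) ^ (k + 1) * (1 + Complex.I * r * Λ j)⁻¹) := by
  rw [← sum_gEraseCoeff_sub_deriv_gLower Λ x k r, sub_add_eq_add_sub, sub_add_eq_add_sub,
    ← Finset.sum_add_distrib]
  congr 2
  refine Finset.sum_congr rfl fun j _ => ?_
  rw [gLower_succ_eq Λ x j]
  have h := mul_inv_cancel₀ (one_add_I_mul_mul_ne_zero r (Λ j))
  linear_combination Complex.I * Λ j *
    (∑ m ∈ Finset.range (k + 1), gEraseCoeff Λ x j m * (r : ℂ) ^ m) * h -
    (Λ j : ℂ) ^ 2 * gEraseCoeff Λ x j k * (r : ℂ) ^ (k + 1) * (1 + Complex.I * r * Λ j)⁻¹ *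
      Complex.I_sq

lemma hasDerivAt_gLower_div_gFun (k : ℕ) (r : ℝ) :
    HasDerivAt (fun r : ℝ => gLower Λ (k + 1) x r * (gFun Λ x₀ r)⁻¹)
      (Complex.I * (x₀ - x) * (gLower Λ (k + 1) x r * (gFun Λ x₀ r)⁻¹) -
        ((k + 1) * gCoeff Λ x (k + 1) * ((r : ℂ) ^ k * (gFun Λ x₀ r)⁻¹) +
          ∑ j, (Λ j : ℂ) ^ 2 * gEraseCoeff Λ x j k * ((r : ℂ) ^ (k + 1) *
            ((1 + Complex.I * r * Λ j)⁻¹ * (gFun Λ x₀ r)⁻¹)))) r := by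
  have hg := gFun_ofReal_ne_zero Λ x₀ r
  have h1 := ((hasDerivAt_gLower_succ Λ x k r).mul
    ((hasDerivAt_gFun Λ x₀ r).inv hg)).comp_ofReal
  refine h1.congr_deriv ?_
  have h2 : ∑ j, Complex.I * Λ j * gErase Λ x₀ j r =
      (∑ j, Complex.I * Λ j * (1 + Complex.I * r * Λ j)⁻¹) * gFun Λ x₀ r := by
    rw [Finset.sum_mul]
    refine Finset.sum_congr rfl fun j _ => ?_
    have h := mul_inv_cancel₀ (one_add_I_mul_mul_ne_zero r (Λ j))
    rw [gFun_eq_mul_gErase Λ x₀ j]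
    linear_combination -(Complex.I * Λ j * gErase Λ x₀ j r) * h
  have h3 := sum_mul_gLower_sub_deriv_gLower Λ x k r
  rw [← Finset.sum_mul] at h3
  have h4 : ∑ j, (Λ j : ℂ) ^ 2 * gEraseCoeff Λ x j k * ((r : ℂ) ^ (k + 1) *
      ((1 + Complex.I * r * Λ j)⁻¹ * (gFun Λ x₀ r)⁻¹)) =
      (∑ j, (Λ j : ℂ) ^ 2 * gEraseCoeff Λ x j k *
        ((r : ℂ) ^ (k + 1) * (1 + Complex.I * r * Λ j)⁻¹)) * (gFun Λ x₀ r)⁻¹ := by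
    rw [Finset.sum_mul]
    exact Finset.sum_congr rfl fun j _ => by ring
  rw [h2, h4, Pi.inv_apply]
  generalize ∑ j, Complex.I * Λ j * (1 + Complex.I * r * Λ j)⁻¹ = S at h3 ⊢
  generalize ∑ j, (Λ j : ℂ) ^ 2 * gEraseCoeff Λ x j k *
    ((r : ℂ) ^ (k + 1) * (1 + Complex.I * r * Λ j)⁻¹) = T at h3 ⊢
  field_simp
  linear_combination -h3

lemma gUpper_div_gFun_eq (k : ℕ) (r : ℝ) : gUpper Λ k x r / gFun Λ x₀ r =
    Complex.exp (Complex.I * (x₀ - x) * r) - gLower Λ k x r * (gFun Λ x₀ r)⁻¹ := by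
  have hg := gFun_ofReal_ne_zero Λ x₀ r
  have h : gFun Λ x r = Complex.exp (Complex.I * (x₀ - x) * r) * gFun Λ x₀ r := by
    rw [gFun, gFun, ← mul_assoc, ← Complex.exp_add]
    congr 2
    ring
  rw [gUpper, h, sub_div, mul_div_cancel_right₀ _ hg, div_eq_mul_inv]

variable {x₀} (hx₀ : 0 < x₀.im)
include hx₀

lemma integrableOn_pow_mul_inv_gFun (k : ℕ) :
    IntegrableOn (fun r : ℝ => (r : ℂ) ^ k * (gFun Λ x₀ r)⁻¹) (Set.Ioi 0) := by
  have h := integrableOn_pow_mul_cexp_mul_prod_inv Λ k (y := -Complex.I * x₀) (by simpa using hx₀)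
  simpa only [mul_assoc ((_ : ℂ) ^ k), cexp_mul_prod_inv_eq_inv_gFun] using h

lemma integrableOn_pow_mul_inv_mul_inv_gFun (k : ℕ) (j : Fin p) :
    IntegrableOn (fun r : ℝ => (r : ℂ) ^ k * ((1 + Complex.I * r * Λ j)⁻¹ * (gFun Λ x₀ r)⁻¹))
      (Set.Ioi 0) := by
  have h := integrableOn_pow_mul_cexp_mul_prod_inv (ι := Option (Fin p)) (fun m => m.elim (Λ j) Λ) k
    (y := -Complex.I * x₀) (by simpa using hx₀)
  refine h.congr_fun (fun r _ => ?_) measurableSet_Ioi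
  rw [← cexp_mul_prod_inv_eq_inv_gFun]
  simp only [Fintype.prod_option, Option.elim_none, Option.elim_some]
  push_cast
  ring

lemma integrableOn_gLower_mul_inv_gFun (k : ℕ) :
    IntegrableOn (fun r : ℝ => gLower Λ k x r * (gFun Λ x₀ r)⁻¹) (Set.Ioi 0) := by
  simp_rw [gLower, Finset.sum_mul, mul_assoc]
  exact integrable_finsetSum _ fun m _ => (integrableOn_pow_mul_inv_gFun Λ hx₀ m).const_mul _

lemma integral_Ioi_eq_one_add_integral_gLower (k : ℕ) :
    (k + 1) * gCoeff Λ x (k + 1) *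
          (∫ r in Set.Ioi (0 : ℝ), (r : ℂ) ^ k * (gFun Λ x₀ r)⁻¹) +
        ∑ j, (Λ j : ℂ) ^ 2 * gEraseCoeff Λ x j k * ∫ r in Set.Ioi (0 : ℝ), (r : ℂ) ^ (k + 1) *
          ((1 + Complex.I * r * Λ j)⁻¹ * (gFun Λ x₀ r)⁻¹) =
      1 + Complex.I * (x₀ - x) *
        ∫ r in Set.Ioi (0 : ℝ), gLower Λ (k + 1) x r * (gFun Λ x₀ r)⁻¹ := by
  have hQ := integrableOn_gLower_mul_inv_gFun Λ x hx₀ (k + 1)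
  have hQ' := hQ.const_mul (Complex.I * (x₀ - x))
  have h0 := (integrableOn_pow_mul_inv_gFun Λ hx₀ k).const_mul ((k + 1) * gCoeff Λ x (k + 1))
  have hj := fun j => (integrableOn_pow_mul_inv_mul_inv_gFun Λ hx₀ (k + 1) j).const_mul
    ((Λ j : ℂ) ^ 2 * gEraseCoeff Λ x j k)
  have hT := h0.fun_add (integrable_finsetSum Finset.univ fun j _ => hj j)
  have hd := fun r (_ : r ∈ Set.Ici (0 : ℝ)) => hasDerivAt_gLower_div_gFun Λ x x₀ k r
  have hint := hQ'.sub hT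
  have h := integral_Ioi_of_hasDerivAt_of_tendsto' hd hint
    (tendsto_zero_of_hasDerivAt_of_integrableOn_Ioi (fun r hr => hd r (Set.Ioi_subset_Ici_self hr)) hint hQ)
  rw [integral_sub hQ' hT, integral_const_mul, integral_add h0
    (integrable_finsetSum Finset.univ fun j _ => hj j), integral_finsetSum _ fun j _ => hj j] at h
  simp_rw [integral_const_mul] at h
  have hzero : gLower Λ (k + 1) x ((0 : ℝ) : ℂ) * (gFun Λ x₀ ((0 : ℝ) : ℂ))⁻¹ = 1 := by
    simp [gLower, gFun, Finset.sum_range_succ', gCoeff_zero]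
  rw [hzero] at h
  linear_combination -h

lemma integrableOn_gUpper_div_gFun (hx : x.im < x₀.im) (k : ℕ) :
    IntegrableOn (fun r : ℝ => gUpper Λ k x r / gFun Λ x₀ r) (Set.Ioi 0) := by
  simp_rw [gUpper_div_gFun_eq]
  exact (integrableOn_exp_mul_complex_Ioi (by simpa using hx) 0).sub
    (integrableOn_gLower_mul_inv_gFun Λ x hx₀ k)

lemma neg_I_mul_integral_gUpper_div_gFun (hx : x.im < x₀.im) (k : ℕ) :
    -Complex.I * (x₀ - x) * ∫ r in Set.Ioi (0 : ℝ), gUpper Λ k x r / gFun Λ x₀ r =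
      1 + Complex.I * (x₀ - x) *
        ∫ r in Set.Ioi (0 : ℝ), gLower Λ k x r * (gFun Λ x₀ r)⁻¹ := by
  have ha : (Complex.I * (x₀ - x)).re < 0 := by simpa using hx
  have ha0 : Complex.I * (x₀ - x) ≠ 0 := fun h => by simp [h] at ha
  simp_rw [gUpper_div_gFun_eq]
  rw [integral_sub (integrableOn_exp_mul_complex_Ioi ha 0)
    (integrableOn_gLower_mul_inv_gFun Λ x hx₀ k), integral_exp_mul_complex_Ioi ha, neg_mul, neg_mul,
    mul_sub, Complex.ofReal_zero, mul_zero, Complex.exp_zero, mul_div_cancel₀ _ ha0]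
  ring

end Truncation

theorem generating_function_complex_wishart
    (p n : ℕ) (hp : 1 ≤ p) (hpn : p ≤ n)
    (Λ : Fin p → ℝ) (hΛ : ∀ j, 0 < Λ j)
    (x₀ x₁ : ℂ) (h₀ : 0 < x₀.im) (h₀₁ : x₁.im < x₀.im) (h₁ : x₁ ≠ 0) :
    IntegrableOn (fun r : ℝ => gUpper Λ n x₁ (r : ℂ) / gFun Λ x₀ (r : ℂ)) (Set.Ioi 0) ∧
    (∫ W, (x₁ • (1 : Matrix (Fin p) (Fin p) ℂ) - Matrix.of W * (Matrix.of W)ᴴ).det /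
          (x₀ • (1 : Matrix (Fin p) (Fin p) ℂ) - Matrix.of W * (Matrix.of W)ᴴ).det
        ∂(wishartMeasureComplex p n Λ))
      = -Complex.I * (x₀ - x₁) * (x₀ / x₁) ^ (n - p) *
          ∫ r in Set.Ioi (0 : ℝ), gUpper Λ n x₁ (r : ℂ) / gFun Λ x₀ (r : ℂ) := by
  refine ⟨integrableOn_gUpper_div_gFun Λ x₁ h₀ h₀₁ n, ?_⟩
  obtain ⟨k, rfl⟩ : ∃ k, n = k + 1 := ⟨n - 1, by omega⟩
  rw [integral_det_div_det_eq_integral_Ioi hΛ h₀ h₁ k (k + 1 - p) (by omega),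
    integral_Ioi_eq_one_add_integral_gLower Λ x₁ h₀ k,
    ← neg_I_mul_integral_gUpper_div_gFun Λ x₁ h₀ h₀₁ (k + 1)]
  ring
end

section
/- Fix a positive integer p and positive reals Λ₁,…,Λ_p with Λ = diag(Λ₁,…,Λ_p). For each integer n ≥ p, let μ₁^{(n)} be the real Wishart probability measure on real p×n matrices with parameter Λ, and define Z₁^{(n)}(a,b) := ∫ det(b·1_p − WWᵀ)/det(a·1_p − WWᵀ) dμ₁^{(n)}(W). Then for every x₀ ∈ ℂ \ [0,∞) and every x₁ ∈ ℂ: lim_{n→∞} Z₁^{(n)}(n·x₀, n·x₁) = ∏_{l=1}^{p} (x₁ − Λ_l)/(x₀ − Λ_l). (Note that for x₀ ∉ [0,∞), the matrix n x₀·1_p − WWᵀ is invertible for every W since WWᵀ is positive semidefinite, and x₀ ≠ Λ_l for every l.) -/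
open MeasureTheory Matrix Filter

/-- The real Wishart measure with parameter `Λ = diag(Λ₁,…,Λ_p)`: the probability
measure on real `p × n` matrices (identified with the pi type `Fin p → Fin n → ℝ`
carrying Lebesgue measure) with density
`P₁(W) = ((2π)^p det Λ)^{-n/2} exp(-(1/2) tr(Wᵀ Λ⁻¹ W))`. -/
noncomputable def wishartMeasureReal (p n : ℕ) (Λ : Fin p → ℝ) :
    Measure (Fin p → Fin n → ℝ) :=
  volume.withDensity fun W =>
    ENNReal.ofReal ((((2 * Real.pi) ^ p * ∏ j, Λ j) ^ (-(n : ℝ) / 2)) *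
      Real.exp (-(1 / 2) *
        ((Matrix.of W)ᵀ * (Matrix.diagonal Λ)⁻¹ * Matrix.of W).trace))

/-- The real Wishart generating function
`Z₁⁽ⁿ⁾(a,b) = ∫ det(b·1_p − WWᵀ)/det(a·1_p − WWᵀ) dμ₁⁽ⁿ⁾(W)`. -/
noncomputable def Z1 (p n : ℕ) (Λ : Fin p → ℝ) (a b : ℂ) : ℂ :=
  ∫ W, (b • (1 : Matrix (Fin p) (Fin p) ℂ) -
        (Matrix.of W * (Matrix.of W)ᵀ).map Complex.ofReal).det /
      (a • (1 : Matrix (Fin p) (Fin p) ℂ) -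
        (Matrix.of W * (Matrix.of W)ᵀ).map Complex.ofReal).det
    ∂(wishartMeasureReal p n Λ)

open ProbabilityTheory
open scoped ComplexOrder

/-- A finite product of measures with integrable real densities has the product density. -/
theorem pi_withDensity_ofReal {ι : Type*} [Fintype ι] {E : ι → Type*}
    {mE : ∀ i, MeasurableSpace (E i)} {μ : (i : ι) → Measure (E i)} [∀ i, SigmaFinite (μ i)]
    {g : (i : ι) → E i → ℝ} (hg : ∀ i, Integrable (g i) (μ i)) (hg0 : ∀ i x, 0 ≤ g i x) :
    Measure.pi (fun i => (μ i).withDensity fun x => ENNReal.ofReal (g i x)) =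
      (Measure.pi μ).withDensity fun x => ENNReal.ofReal (∏ i, g i (x i)) := by
  have hfin (i : ι) : IsFiniteMeasure ((μ i).withDensity fun x => ENNReal.ofReal (g i x)) :=
    isFiniteMeasure_withDensity_ofReal (hg i).2
  refine Measure.pi_eq fun s hs => ?_
  rw [withDensity_apply _ (MeasurableSet.univ_pi hs), Measure.restrict_pi_pi,
    ← ofReal_integral_eq_lintegral_ofReal
      (Integrable.fintype_prod_dep fun i => (hg i).restrict)
      (Eventually.of_forall fun x => Finset.prod_nonneg fun i _ => hg0 i (x i)),
    integral_fintype_prod_eq_prod, ENNReal.ofReal_prod_of_nonneg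
      fun i _ => integral_nonneg (hg0 i)]
  refine Finset.prod_congr rfl fun i _ => ?_
  rw [withDensity_apply _ (hs i), ofReal_integral_eq_lintegral_ofReal (hg i).restrict
    (Eventually.of_forall (hg0 i))]

theorem trace_transpose_mul_diagonal_inv_mul {p n : ℕ} {Λ : Fin p → ℝ} (hΛ : ∀ j, 0 < Λ j)
    (W : Fin p → Fin n → ℝ) :
    ((Matrix.of W)ᵀ * (Matrix.diagonal Λ)⁻¹ * Matrix.of W).trace =
      ∑ j, ∑ k, W j k ^ 2 / Λ j := by
  have hinv : (Matrix.diagonal Λ)⁻¹ = Matrix.diagonal fun j => (Λ j)⁻¹ := by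
    refine Matrix.inv_eq_left_inv ?_
    rw [Matrix.diagonal_mul_diagonal, ← Matrix.diagonal_one]
    exact congrArg _ (funext fun j => inv_mul_cancel₀ (hΛ j).ne')
  rw [hinv, Finset.sum_comm]
  simp only [Matrix.trace, Matrix.diag, Matrix.mul_apply (M := _ * _), Matrix.mul_diagonal,
    Matrix.transpose_apply, Matrix.of_apply]
  exact Finset.sum_congr rfl fun k _ => Finset.sum_congr rfl fun j _ => by ring

/-- The Wishart density is the product of the Gaussian densities of the entries. -/
theorem wishart_density_eq_prod {p n : ℕ} {Λ : Fin p → ℝ} (hΛ : ∀ j, 0 < Λ j)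
    (W : Fin p → Fin n → ℝ) :
    (((2 * Real.pi) ^ p * ∏ j, Λ j) ^ (-(n : ℝ) / 2)) *
      Real.exp (-(1 / 2) * ((Matrix.of W)ᵀ * (Matrix.diagonal Λ)⁻¹ * Matrix.of W).trace) =
      ∏ j, ∏ k, gaussianPDFReal 0 (Λ j).toNNReal (W j k) := by
  have hpos (j : Fin p) : 0 < 2 * Real.pi * Λ j := by have := hΛ j; positivity
  have hbase : (2 * Real.pi) ^ p * ∏ j, Λ j = ∏ j, (2 * Real.pi * Λ j) := by
    simp [Finset.prod_mul_distrib]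
  have hroot (j : Fin p) :
      (2 * Real.pi * Λ j) ^ (-(n : ℝ) / 2) = ∏ _k : Fin n, (√(2 * Real.pi * Λ j))⁻¹ := by
    rw [Finset.prod_const, Finset.card_univ, Fintype.card_fin, Real.sqrt_eq_rpow,
      ← Real.rpow_neg (hpos j).le, ← Real.rpow_mul_natCast (hpos j).le]
    congr 1
    ring
  simp only [gaussianPDFReal, Finset.prod_mul_distrib, Real.coe_toNNReal _ (hΛ _).le, sub_zero]
  rw [hbase, ← Real.finsetProd_rpow _ _ fun j _ => (hpos j).le,
    trace_transpose_mul_diagonal_inv_mul hΛ, Finset.mul_sum, Real.exp_sum]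
  congr 1
  · exact Finset.prod_congr rfl fun j _ => hroot j
  · refine Finset.prod_congr rfl fun j _ => ?_
    rw [Finset.mul_sum, Real.exp_sum]
    refine Finset.prod_congr rfl fun k _ => congrArg _ ?_
    have := (hΛ j).ne'
    field_simp

/-- Under the Wishart measure, the entries are independent centred Gaussians, those of the
`j`-th row having variance `Λ j`. -/
theorem wishartMeasureReal_eq_pi_gaussianReal (p n : ℕ) {Λ : Fin p → ℝ} (hΛ : ∀ j, 0 < Λ j) :
    wishartMeasureReal p n Λ =
      Measure.pi fun j => Measure.pi fun _ : Fin n => gaussianReal 0 (Λ j).toNNReal := by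
  have hv (j : Fin p) : (Λ j).toNNReal ≠ 0 := (Real.toNNReal_pos.2 (hΛ j)).ne'
  have hrow (j : Fin p) : (Measure.pi fun _ : Fin n => gaussianReal 0 (Λ j).toNNReal) =
      (Measure.pi fun _ => volume).withDensity fun w =>
        ENNReal.ofReal (∏ k, gaussianPDFReal 0 (Λ j).toNNReal (w k)) := by
    simp only [gaussianReal_of_var_ne_zero 0 (hv j), gaussianPDF_def]
    exact pi_withDensity_ofReal (fun _ => integrable_gaussianPDFReal _ _)
      fun _ => gaussianPDFReal_nonneg _ _
  simp only [hrow]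
  rw [pi_withDensity_ofReal
    (fun j => Integrable.fintype_prod fun _ => integrable_gaussianPDFReal _ _)
    fun j w => Finset.prod_nonneg fun k _ => gaussianPDFReal_nonneg _ _ _]
  simp only [wishartMeasureReal, wishart_density_eq_prod hΛ]
  rfl

/-- The law of an array of independent centred Gaussians with infinitely many columns, the
entries of the `j`-th row having variance `Λ j`. -/
noncomputable def gaussianArray {p : ℕ} (Λ : Fin p → ℝ) : Measure (Fin p × ℕ → ℝ) :=
  Measure.infinitePi fun q => gaussianReal 0 (Λ q.1).toNNReal

instance {p : ℕ} (Λ : Fin p → ℝ) : IsProbabilityMeasure (gaussianArray Λ) := by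
  unfold gaussianArray
  infer_instance

/-- The matrix of the first `n` columns of an array. -/
def firstColumns {p : ℕ} (n : ℕ) (ω : Fin p × ℕ → ℝ) : Fin p → Fin n → ℝ :=
  fun j k => ω (j, k)

theorem measurable_firstColumns {p n : ℕ} : Measurable (firstColumns (p := p) n) := by
  unfold firstColumns
  fun_prop

theorem map_firstColumns_gaussianArray {p : ℕ} (n : ℕ) {Λ : Fin p → ℝ} (hΛ : ∀ j, 0 < Λ j) :
    (gaussianArray Λ).map (firstColumns n) = wishartMeasureReal p n Λ := by
  have hinj : Function.Injective fun q : Fin p × Fin n => (q.1, (q.2 : ℕ)) := by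
    rintro ⟨a, b⟩ ⟨c, d⟩ h
    simpa [Fin.ext_iff] using h
  have hcomp : firstColumns n = MeasurableEquiv.curry (Fin p) (Fin n) ℝ ∘
      fun (ω : Fin p × ℕ → ℝ) (q : Fin p × Fin n) => ω (q.1, (q.2 : ℕ)) := rfl
  rw [hcomp, ← Measure.map_map (MeasurableEquiv.measurable _) (by fun_prop), gaussianArray,
    Measure.map_infinitePi_infinitePi_of_inj hinj,
    Measure.infinitePi_map_curry (μ := fun (j : Fin p) (_ : Fin n) =>
      gaussianReal 0 (Λ j).toNNReal),
    Measure.infinitePi_eq_pi, wishartMeasureReal_eq_pi_gaussianReal p n hΛ]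
  simp only [Measure.infinitePi_eq_pi]

theorem hasLaw_eval_gaussianArray {p : ℕ} (Λ : Fin p → ℝ) (q : Fin p × ℕ) :
    HasLaw (fun ω => ω q) (gaussianReal 0 (Λ q.1).toNNReal) (gaussianArray Λ) :=
  ⟨(measurable_pi_apply q).aemeasurable, Measure.infinitePi_map_eval _ q⟩

theorem iIndepFun_eval_gaussianArray {p : ℕ} (Λ : Fin p → ℝ) :
    iIndepFun (fun (q : Fin p × ℕ) (ω : Fin p × ℕ → ℝ) => ω q) (gaussianArray Λ) :=
  iIndepFun_infinitePi (X := fun _ x => x) fun _ => measurable_id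

theorem memLp_eval_gaussianArray {p : ℕ} (Λ : Fin p → ℝ) (q : Fin p × ℕ) :
    MemLp (fun ω => ω q) 2 (gaussianArray Λ) := by
  have h := memLp_id_gaussianReal (μ := 0) (v := (Λ q.1).toNNReal) 2
  rw [← (hasLaw_eval_gaussianArray Λ q).map_eq] at h
  exact h.comp_of_map (measurable_pi_apply q).aemeasurable

theorem integral_mul_gaussianArray {p : ℕ} {Λ : Fin p → ℝ} (hΛ : ∀ j, 0 < Λ j) (i j : Fin p)
    (k : ℕ) : ∫ ω, ω (i, k) * ω (j, k) ∂gaussianArray Λ = Matrix.diagonal Λ i j := by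
  have hmean (q : Fin p × ℕ) : ∫ ω, ω q ∂gaussianArray Λ = 0 := by
    rw [(hasLaw_eval_gaussianArray Λ q).integral_eq, integral_id_gaussianReal]
  rcases eq_or_ne i j with rfl | hij
  · have hvar := (hasLaw_eval_gaussianArray Λ (i, k)).variance_eq
    rw [variance_id_gaussianReal, variance_of_integral_eq_zero (measurable_pi_apply _).aemeasurable (hmean _)] at hvar
    simpa [pow_two, Real.coe_toNNReal _ (hΛ i).le] using hvar
  · have hind := (iIndepFun_eval_gaussianArray Λ).indepFun
      (i := (i, k)) (j := (j, k)) (by simpa using hij)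
    rw [hind.integral_fun_mul_eq_mul_integral
      (measurable_pi_apply _).aestronglyMeasurable (measurable_pi_apply _).aestronglyMeasurable,
      hmean, zero_mul, Matrix.diagonal_apply_ne _ hij]

/-- Strong law of large numbers for the empirical covariances of the rows. -/
theorem ae_tendsto_empirical_covariance {p : ℕ} {Λ : Fin p → ℝ} (hΛ : ∀ j, 0 < Λ j)
    (i j : Fin p) :
    ∀ᵐ ω ∂gaussianArray Λ,
      Tendsto (fun n : ℕ => (∑ k ∈ Finset.range n, ω (i, k) * ω (j, k)) / (n : ℝ)) atTop
        (nhds (Matrix.diagonal Λ i j)) := by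
  have hmul : Measurable fun x : ℝ × ℝ => x.1 * x.2 := by fun_prop
  have hmeas (q : Fin p × ℕ) : Measurable fun ω : Fin p × ℕ → ℝ => ω q := measurable_pi_apply q
  have hint : Integrable (fun ω => ω (i, 0) * ω (j, 0)) (gaussianArray Λ) :=
    (memLp_eval_gaussianArray Λ (i, 0)).integrable_mul (memLp_eval_gaussianArray Λ (j, 0))
  simp only [← integral_mul_gaussianArray hΛ i j 0]
  refine strong_law_ae_real (μ := gaussianArray Λ)
    (fun (k : ℕ) (ω : Fin p × ℕ → ℝ) => ω (i, k) * ω (j, k)) hint ?_ ?_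
  · intro k l hkl
    exact ((iIndepFun_eval_gaussianArray Λ).indepFun_prodMk_prodMk hmeas (i, k) (j, k) (i, l) (j, l)
      (by simp [hkl]) (by simp [hkl]) (by simp [hkl]) (by simp [hkl])).comp hmul hmul
  · intro k
    rcases eq_or_ne i j with rfl | hij
    · exact ((hasLaw_eval_gaussianArray Λ (i, k)).identDistrib
        (hasLaw_eval_gaussianArray Λ (i, 0))).comp (u := fun x => x * x) (by fun_prop)
    · refine IdentDistrib.comp (u := fun x : ℝ × ℝ => x.1 * x.2)
        (f := fun ω : Fin p × ℕ → ℝ => (ω (i, k), ω (j, k)))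
        (g := fun ω : Fin p × ℕ → ℝ => (ω (i, 0), ω (j, 0))) ?_ hmul
      refine ⟨((hmeas _).prodMk (hmeas _)).aemeasurable,
        ((hmeas _).prodMk (hmeas _)).aemeasurable, ?_⟩
      simp only [gaussianArray]
      rw [Measure.infinitePi_map_eval_prod (by simpa using hij),
        Measure.infinitePi_map_eval_prod (by simpa using hij)]

/-- The ratio of the characteristic polynomials of a real matrix at two complex points. -/
noncomputable def charpolyRatio {p : ℕ} (a b : ℂ) (A : Matrix (Fin p) (Fin p) ℝ) : ℂ :=
  (b • (1 : Matrix (Fin p) (Fin p) ℂ) - A.map Complex.ofReal).det /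
    (a • (1 : Matrix (Fin p) (Fin p) ℂ) - A.map Complex.ofReal).det

theorem continuous_det_smul_one_sub_map {p : ℕ} (a : ℂ) :
    Continuous fun A : Matrix (Fin p) (Fin p) ℝ =>
      (a • (1 : Matrix (Fin p) (Fin p) ℂ) - A.map Complex.ofReal).det :=
  (continuous_const.sub (continuous_id.matrix_map Complex.continuous_ofReal)).matrix_det

theorem charpolyRatio_mul_left {p : ℕ} {c : ℝ} (hc : c ≠ 0) (a b : ℂ)
    (A : Matrix (Fin p) (Fin p) ℝ) :
    charpolyRatio (c * a) (c * b) A = charpolyRatio a b (c⁻¹ • A) := by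
  have hc' : (c : ℂ) ≠ 0 := Complex.ofReal_ne_zero.2 hc
  have hdet (z : ℂ) : (((c : ℂ) * z) • (1 : Matrix (Fin p) (Fin p) ℂ) - A.map Complex.ofReal).det =
      (c : ℂ) ^ p * (z • (1 : Matrix (Fin p) (Fin p) ℂ) - (c⁻¹ • A).map Complex.ofReal).det := by
    have hmat : ((c : ℂ) * z) • (1 : Matrix (Fin p) (Fin p) ℂ) - A.map Complex.ofReal =
        (c : ℂ) • (z • (1 : Matrix (Fin p) (Fin p) ℂ) - (c⁻¹ • A).map Complex.ofReal) := by
      ext i j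
      simp [mul_sub, hc', mul_assoc]
    rw [hmat, Matrix.det_smul, Fintype.card_fin]
  rw [charpolyRatio, hdet, hdet, mul_div_mul_left _ _ (pow_ne_zero _ hc'), charpolyRatio]

theorem charpolyRatio_diagonal {p : ℕ} (a b : ℂ) (Λ : Fin p → ℝ) :
    charpolyRatio a b (Matrix.diagonal Λ) = ∏ l, (b - (Λ l : ℂ)) / (a - (Λ l : ℂ)) := by
  have hdet (z : ℂ) : (z • (1 : Matrix (Fin p) (Fin p) ℂ) -
      (Matrix.diagonal Λ).map Complex.ofReal).det = ∏ l, (z - (Λ l : ℂ)) := by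
    rw [Matrix.diagonal_map Complex.ofReal_zero, ← Matrix.diagonal_one, ← Matrix.diagonal_smul,
      Matrix.diagonal_sub, Matrix.det_diagonal]
    simp
  rw [charpolyRatio, hdet, hdet, Finset.prod_div_distrib]

theorem continuousAt_charpolyRatio_diagonal {p : ℕ} {a : ℂ} (b : ℂ) {Λ : Fin p → ℝ}
    (ha : ∀ l, a ≠ Λ l) : ContinuousAt (charpolyRatio a b) (Matrix.diagonal Λ) := by
  refine (continuous_det_smul_one_sub_map b).continuousAt.div
    (continuous_det_smul_one_sub_map a).continuousAt ?_
  rw [Matrix.diagonal_map Complex.ofReal_zero, ← Matrix.diagonal_one, ← Matrix.diagonal_smul,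
    Matrix.diagonal_sub, Matrix.det_diagonal, Finset.prod_ne_zero_iff]
  simpa [sub_eq_zero] using ha

theorem posSemidef_map_ofReal_mul_transpose {p n : ℕ} (W : Matrix (Fin p) (Fin n) ℝ) :
    ((W * Wᵀ).map Complex.ofReal).PosSemidef := by
  have h : (W * Wᵀ).map Complex.ofReal = W.map Complex.ofReal * (W.map Complex.ofReal)ᴴ := by
    ext i j
    simp [Matrix.mul_apply]
  rw [h]
  exact Matrix.posSemidef_self_mul_conjTranspose _

theorem norm_charpolyRatio_le {p : ℕ} {a b : ℂ} {C : ℝ}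
    (hC : ∀ t : ℝ, 0 ≤ t → ‖(b - t) / (a - t)‖ ≤ C) {A : Matrix (Fin p) (Fin p) ℝ}
    (hA : (A.map Complex.ofReal).PosSemidef) : ‖charpolyRatio a b A‖ ≤ C ^ p := by
  have hdet (z : ℂ) : (z • (1 : Matrix (Fin p) (Fin p) ℂ) - A.map Complex.ofReal).det =
      ∏ i, (z - (hA.isHermitian.eigenvalues i : ℂ)) := by
    rw [Matrix.smul_one_eq_diagonal, ← Matrix.scalar_apply, ← Matrix.eval_charpoly,
      hA.isHermitian.charpoly_eq, Polynomial.eval_prod]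
    simp
  rw [charpolyRatio, hdet, hdet, ← Finset.prod_div_distrib, norm_prod]
  calc ∏ i, ‖(b - (hA.isHermitian.eigenvalues i : ℂ)) / (a - (hA.isHermitian.eigenvalues i : ℂ))‖
      ≤ ∏ _i : Fin p, C := Finset.prod_le_prod (fun _ _ => norm_nonneg _)
        fun i _ => hC _ (hA.eigenvalues_nonneg i)
    _ = C ^ p := by simp

theorem exists_bound_norm_div_sub {a : ℂ} (b : ℂ) (ha : ∀ t : ℝ, 0 ≤ t → a ≠ (t : ℂ)) :
    ∃ C : ℝ, ∀ t : ℝ, 0 ≤ t → ‖(b - t) / (a - t)‖ ≤ C := by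
  have hclosed : IsClosed (Complex.ofReal '' Set.Ici 0) :=
    Complex.isometry_ofReal.isClosedEmbedding.isClosedMap _ isClosed_Ici
  have hmem : a ∉ Complex.ofReal '' Set.Ici 0 := by
    rintro ⟨t, ht, rfl⟩
    exact ha t ht rfl
  obtain ⟨δ, hδ, hball⟩ := Metric.isOpen_iff.1 hclosed.isOpen_compl a hmem
  refine ⟨1 + ‖b - a‖ / δ, fun t ht => ?_⟩
  have hdist : δ ≤ ‖a - t‖ := by
    by_contra! hlt
    refine hball ?_ ⟨t, ht, rfl⟩
    rwa [Metric.mem_ball, dist_comm, dist_eq_norm]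
  have hsub : a - (t : ℂ) ≠ 0 := sub_ne_zero.2 (ha t ht)
  have hsplit : (b - t) / (a - t) = 1 + (b - a) / (a - t) := by
    field_simp
    ring
  calc ‖(b - t) / (a - t)‖ ≤ ‖(1 : ℂ)‖ + ‖(b - a) / (a - t)‖ := hsplit ▸ norm_add_le _ _
    _ ≤ 1 + ‖b - a‖ / δ := by
      rw [norm_one, norm_div]
      gcongr

/-- The normalised sample covariance matrix of the first `n` columns of an array. -/
noncomputable def sampleCovariance {p : ℕ} (n : ℕ) (ω : Fin p × ℕ → ℝ) :
    Matrix (Fin p) (Fin p) ℝ :=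
  (n : ℝ)⁻¹ • (Matrix.of (firstColumns n ω) * (Matrix.of (firstColumns n ω))ᵀ)

theorem sampleCovariance_apply {p : ℕ} (n : ℕ) (ω : Fin p × ℕ → ℝ) (i j : Fin p) :
    sampleCovariance n ω i j = (∑ k ∈ Finset.range n, ω (i, k) * ω (j, k)) / n := by
  simp [sampleCovariance, Matrix.mul_apply, firstColumns, div_eq_inv_mul,
    Finset.sum_range fun k => ω (i, k) * ω (j, k)]

theorem continuous_sampleCovariance {p n : ℕ} : Continuous (sampleCovariance (p := p) n) := by
  refine continuous_matrix fun i j => ?_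
  simp only [sampleCovariance_apply]
  fun_prop

theorem posSemidef_map_sampleCovariance {p : ℕ} (n : ℕ) (ω : Fin p × ℕ → ℝ) :
    ((sampleCovariance n ω).map Complex.ofReal).PosSemidef := by
  have h : (sampleCovariance n ω).map Complex.ofReal = ((n : ℝ)⁻¹ : ℝ) •
      (Matrix.of (firstColumns n ω) * (Matrix.of (firstColumns n ω))ᵀ).map Complex.ofReal := by
    ext i j
    simp [sampleCovariance]
  rw [h]
  exact (posSemidef_map_ofReal_mul_transpose _).smul (by positivity)

theorem Z1_natCast_mul {p n : ℕ} (hn : n ≠ 0) {Λ : Fin p → ℝ} (hΛ : ∀ j, 0 < Λ j) (a b : ℂ) :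
    Z1 p n Λ (n * a) (n * b) =
      ∫ ω, charpolyRatio a b (sampleCovariance n ω) ∂gaussianArray Λ := by
  have hcont : Continuous fun W : Fin p → Fin n → ℝ => Matrix.of W * (Matrix.of W)ᵀ :=
    continuous_id.matrix_mul continuous_id.matrix_transpose
  have hmeas : Measurable fun W : Fin p → Fin n → ℝ =>
      charpolyRatio (n * a) (n * b) (Matrix.of W * (Matrix.of W)ᵀ) :=
    ((continuous_det_smul_one_sub_map _).comp hcont).measurable.div
      ((continuous_det_smul_one_sub_map _).comp hcont).measurable
  have hZ : Z1 p n Λ (n * a) (n * b) = ∫ W, charpolyRatio (n * a) (n * b)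
      (Matrix.of W * (Matrix.of W)ᵀ) ∂wishartMeasureReal p n Λ := rfl
  rw [hZ, ← map_firstColumns_gaussianArray n hΛ,
    integral_map measurable_firstColumns.aemeasurable hmeas.aestronglyMeasurable]
  refine integral_congr_ae (Eventually.of_forall fun ω => ?_)
  exact_mod_cast charpolyRatio_mul_left (Nat.cast_ne_zero.2 hn) a b _

/-- Central-limit-theorem behavior of the real Wishart generating function:
for `p ≥ 1`, positive `Λ₁,…,Λ_p`, `x₀ ∈ ℂ \ [0,∞)`, `x₁ ∈ ℂ`:
`lim_{n→∞} Z₁⁽ⁿ⁾(n x₀, n x₁) = ∏_l (x₁ − Λ_l)/(x₀ − Λ_l)`. -/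
theorem generating_function_real_wishart_clt
    (p : ℕ) (hp : 1 ≤ p) (Λ : Fin p → ℝ) (hΛ : ∀ j, 0 < Λ j)
    (x₀ x₁ : ℂ) (h₀ : ∀ t : ℝ, 0 ≤ t → x₀ ≠ (t : ℂ)) :
    Tendsto (fun n : ℕ => Z1 p n Λ ((n : ℂ) * x₀) ((n : ℂ) * x₁)) atTop
      (nhds (∏ l, (x₁ - (Λ l : ℂ)) / (x₀ - (Λ l : ℂ)))) := by
  obtain ⟨C, hC⟩ := exists_bound_norm_div_sub x₁ h₀
  have hlim : Tendsto
      (fun n : ℕ => ∫ ω, charpolyRatio x₀ x₁ (sampleCovariance n ω) ∂gaussianArray Λ) atTop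
      (nhds (∫ _, charpolyRatio x₀ x₁ (Matrix.diagonal Λ) ∂gaussianArray Λ)) := by
    refine tendsto_integral_of_dominated_convergence (fun _ => C ^ p) (fun n => ?_)
      (integrable_const _)
      (fun n => Eventually.of_forall fun ω =>
        norm_charpolyRatio_le hC (posSemidef_map_sampleCovariance n ω)) ?_
    · exact (((continuous_det_smul_one_sub_map _).comp
        continuous_sampleCovariance).measurable.div
        ((continuous_det_smul_one_sub_map _).comp
          continuous_sampleCovariance).measurable).aestronglyMeasurable
    · filter_upwards [ae_all_iff.2 fun i => ae_all_iff.2 fun j =>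
        ae_tendsto_empirical_covariance hΛ i j] with ω hω
      refine (continuousAt_charpolyRatio_diagonal x₁ fun l => h₀ _ (hΛ l).le).tendsto.comp ?_
      refine tendsto_pi_nhds.2 fun i => tendsto_pi_nhds.2 fun j => ?_
      simpa only [sampleCovariance_apply] using hω i j
  rw [integral_const, probReal_univ, one_smul, charpolyRatio_diagonal] at hlim
  refine hlim.congr' ?_
  filter_upwards [eventually_ne_atTop 0] with n hn
  exact (Z1_natCast_mul hn hΛ x₀ x₁).symm
end
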